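/- Let R be a commutative Noetherian ring of finite Krull dimension which is virtually Gorenstein (GP^⊥ = ^⊥GI). Then a short exact sequence 0 → X₁ → X₂ → X₃ → 0 of R-modules is GP-pure exact if and only if it is GI-copure exact. -/

import Mathlib

open CategoryTheory Opposite Limits MonoidalCategory

universe u

variable {R : Type u} [CommRing R]

/-- `Q` is a Gorenstein projective module: it is the cokernel `Coker (P₁ → P₀)` of a totally
acyclic complex of projective modules, i.e. an exact complex of projectives which stays exact
under `Hom(-, P)` for every projective `P`. -/
def IsGorensteinProjective (Q : ModuleCat.{u} R) : Prop :=
  ∃ C : ChainComplex (ModuleCat.{u} R) ℤ,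
    (∀ i, Projective (C.X i)) ∧
    (∀ i, C.ExactAt i) ∧
    Nonempty (Q ≅ cokernel (C.d 1 0)) ∧
    ∀ P : ModuleCat.{u} R, Projective P →
      ∀ (i : ℤ) (f : C.X i ⟶ P), C.d (i + 1) i ≫ f = 0 →
        ∃ g : C.X (i - 1) ⟶ P, f = C.d i (i - 1) ≫ g

/-- `E` is a Gorenstein injective module: it is the kernel `Ker (I⁰ → I¹)` of a totally acyclic
complex of injective modules, i.e. an exact complex of injectives which stays exact under
`Hom(I, -)` for every injective `I`. -/
def IsGorensteinInjective (E : ModuleCat.{u} R) : Prop :=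
  ∃ C : CochainComplex (ModuleCat.{u} R) ℤ,
    (∀ i, Injective (C.X i)) ∧
    (∀ i, C.ExactAt i) ∧
    Nonempty (E ≅ kernel (C.d 0 1)) ∧
    ∀ I : ModuleCat.{u} R, Injective I →
      ∀ (i : ℤ) (f : I ⟶ C.X i), f ≫ C.d i (i + 1) = 0 →
        ∃ g : I ⟶ C.X (i - 1), f = g ≫ C.d (i - 1) i

/-- `M` is a Gorenstein flat module: it is a cokernel in an exact complex of flat modules which
remains exact after tensoring with any injective module. -/
def IsGorensteinFlat (M : ModuleCat.{u} R) : Prop :=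
  ∃ C : ChainComplex (ModuleCat.{u} R) ℤ,
    (∀ i, Module.Flat R (C.X i)) ∧
    (∀ i, C.ExactAt i) ∧
    Nonempty (M ≅ cokernel (C.d 1 0)) ∧
    ∀ I : ModuleCat.{u} R, Injective I → ∀ i : ℤ,
      (((tensorLeft I).mapHomologicalComplex (ComplexShape.down ℤ)).obj C).ExactAt i

/-- A short exact sequence `0 → X₁ → X₂ → X₃ → 0` is `𝒳`-pure exact if
`Hom(U, X₂) → Hom(U, X₃)` is surjective for every `U ∈ 𝒳`. -/
def XPureExact (𝒳 : ModuleCat.{u} R → Prop) (S : ShortComplex (ModuleCat.{u} R)) : Prop :=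
  ∀ U : ModuleCat.{u} R, 𝒳 U → ∀ φ : U ⟶ S.X₃, ∃ ψ : U ⟶ S.X₂, ψ ≫ S.g = φ

/-- A short exact sequence `0 → X₁ → X₂ → X₃ → 0` is `𝒳`-copure exact if
`Hom(X₂, V) → Hom(X₁, V)` is surjective for every `V ∈ 𝒳`. -/
def XCopureExact (𝒳 : ModuleCat.{u} R → Prop) (S : ShortComplex (ModuleCat.{u} R)) : Prop :=
  ∀ V : ModuleCat.{u} R, 𝒳 V → ∀ φ : S.X₁ ⟶ V, ∃ ψ : S.X₂ ⟶ V, S.f ≫ ψ = φ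

/-- `M` is `𝒳`-pure flat: `M ⊗ -` leaves every `𝒳`-pure exact short exact sequence exact. -/
def XPureFlat (𝒳 : ModuleCat.{u} R → Prop) (M : ModuleCat.{u} R) : Prop :=
  ∀ S : ShortComplex (ModuleCat.{u} R), S.ShortExact → XPureExact 𝒳 S →
    Function.Injective ((tensorLeft M).map S.f)

/-- `N` is `𝒳`-pure injective: `Hom(-, N)` leaves every `𝒳`-pure exact short exact
sequence exact. -/
def XPureInjective (𝒳 : ModuleCat.{u} R → Prop) (N : ModuleCat.{u} R) : Prop :=
  ∀ S : ShortComplex (ModuleCat.{u} R), S.ShortExact → XPureExact 𝒳 S →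
    ∀ φ : S.X₁ ⟶ N, ∃ ψ : S.X₂ ⟶ N, S.f ≫ ψ = φ

/-- `M` is `𝒳`-pure projective: `Hom(M, -)` leaves every `𝒳`-pure exact short exact
sequence exact. -/
def XPureProjective (𝒳 : ModuleCat.{u} R → Prop) (M : ModuleCat.{u} R) : Prop :=
  ∀ S : ShortComplex (ModuleCat.{u} R), S.ShortExact → XPureExact 𝒳 S →
    ∀ φ : M ⟶ S.X₃, ∃ ψ : M ⟶ S.X₂, ψ ≫ S.g = φ

/-- `GP`-pure exactness: `Hom(Q, -)` leaves the sequence exact for all Gorenstein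
projective `Q`. -/
abbrev GPPureExact (S : ShortComplex (ModuleCat.{u} R)) : Prop :=
  XPureExact IsGorensteinProjective S

/-- `GI`-copure exactness: `Hom(-, E)` leaves the sequence exact for all Gorenstein
injective `E`. -/
abbrev GICopureExact (S : ShortComplex (ModuleCat.{u} R)) : Prop :=
  XCopureExact IsGorensteinInjective S

abbrev GPPureProjective (M : ModuleCat.{u} R) : Prop :=
  XPureProjective IsGorensteinProjective M

abbrev GPPureInjective (M : ModuleCat.{u} R) : Prop :=
  XPureInjective IsGorensteinProjective M

abbrev GPPureFlat (M : ModuleCat.{u} R) : Prop :=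
  XPureFlat IsGorensteinProjective M

/-- `Ext^n_R(M, N)` vanishes. -/
abbrev extVanish (n : ℕ) (M N : ModuleCat.{u} R) : Prop :=
  Subsingleton (((Ext R (ModuleCat.{u} R) n).obj (op M)).obj N)

/-- `M` belongs to `GP^⊥`. -/
abbrev MemGPperp (M : ModuleCat.{u} R) : Prop :=
  ∀ Q : ModuleCat.{u} R, IsGorensteinProjective Q → extVanish 1 Q M

/-- `M` belongs to `^⊥GI`. -/
abbrev MemPerpGI (M : ModuleCat.{u} R) : Prop :=
  ∀ E : ModuleCat.{u} R, IsGorensteinInjective E → extVanish 1 M E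

/-- Gorenstein projective dimension of `M` is at most `n`: there is a resolution
`0 → G_n → ⋯ → G_0 → M → 0` by Gorenstein projective modules. -/
def GpdLE : ℕ → ModuleCat.{u} R → Prop
  | 0, M => IsGorensteinProjective M
  | n + 1, M =>
    ∃ S : ShortComplex (ModuleCat.{u} R), S.ShortExact ∧ Nonempty (S.X₃ ≅ M) ∧
      IsGorensteinProjective S.X₂ ∧ GpdLE n S.X₁

/-- Gorenstein injective dimension of `M` is at most `n`: there is a coresolution
`0 → M → E⁰ → ⋯ → Eⁿ → 0` by Gorenstein injective modules. -/
def GidLE : ℕ → ModuleCat.{u} R → Prop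
  | 0, M => IsGorensteinInjective M
  | n + 1, M =>
    ∃ S : ShortComplex (ModuleCat.{u} R), S.ShortExact ∧ Nonempty (S.X₁ ≅ M) ∧
      IsGorensteinInjective S.X₂ ∧ GidLE n S.X₃

/-- Gorenstein flat dimension of `M` is at most `n`. -/
def GfdLE : ℕ → ModuleCat.{u} R → Prop
  | 0, M => IsGorensteinFlat M
  | n + 1, M =>
    ∃ S : ShortComplex (ModuleCat.{u} R), S.ShortExact ∧ Nonempty (S.X₃ ≅ M) ∧
      IsGorensteinFlat S.X₂ ∧ GfdLE n S.X₁

/-- The Pontryagin dual `M⁺ = Hom_ℤ(M, ℚ/ℤ)` as an `R`-module. -/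
noncomputable def characterDual (M : ModuleCat.{u} R) : ModuleCat.{u} R :=
  ModuleCat.of R (CharacterModule M)

/-- `R` is a coherent ring: every finitely generated ideal is finitely presented. -/
def IsCoherentRing (R : Type u) [CommRing R] : Prop :=
  ∀ I : Ideal R, I.FG → Module.FinitePresentation R I

/-- `φ : G → M` is a Gorenstein projective precover. -/
def IsGPPrecover {G M : ModuleCat.{u} R} (φ : G ⟶ M) : Prop :=
  IsGorensteinProjective G ∧
    ∀ G' : ModuleCat.{u} R, IsGorensteinProjective G' →
      ∀ ψ : G' ⟶ M, ∃ χ : G' ⟶ G, χ ≫ φ = ψ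

/-- The short exact sequence `0 → Im d_{i+1} → X_i → Im d_i → 0` extracted from a complex. -/
noncomputable def imagesShortComplex (C : ChainComplex (ModuleCat.{u} R) ℤ) (i : ℤ) :
    ShortComplex (ModuleCat.{u} R) :=
  ShortComplex.mk (image.ι (C.d (i + 1) i)) (factorThruImage (C.d i (i - 1)))
    (by
      rw [← cancel_epi (factorThruImage (C.d (i + 1) i)),
        ← cancel_mono (image.ι (C.d i (i - 1)))]
      simp)

/-- A small family of monomorphisms in a category of modules permits the small object argument. -/
theorem hasSmallObjectArgument_ofHoms {ι : Type u} {A B : ι → ModuleCat.{u} R}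
    (i : ∀ t, A t ⟶ B t) (hi : ∀ t, Mono (i t)) :
    MorphismProperty.HasSmallObjectArgument.{u} (MorphismProperty.ofHoms i) := by
  have hle : MorphismProperty.ofHoms i ≤ MorphismProperty.monomorphisms (ModuleCat.{u} R) := by
    rintro _ _ _ ⟨t⟩
    exact hi t
  obtain ⟨κ, hκ', hκ⟩ := HasCardinalLT.exists_regular_cardinal.{u} (Σ t, Subobject (A t))
  have : Fact κ.IsRegular := ⟨hκ'⟩
  have : Nonempty κ.ord.ToType := by simpa using hκ'.ne_zero
  have := WellFoundedLT.toOrderBot κ.ord.ToType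
  exact ⟨κ, inferInstance, inferInstance,
    { preservesColimit := by
        intro A' B' X Y j hj f hf
        let hf' : (MorphismProperty.monomorphisms (ModuleCat.{u} R)).TransfiniteCompositionOfShape
            κ.ord.ToType f :=
          { toTransfiniteCompositionOfShape := hf.toTransfiniteCompositionOfShape
            map_mem j hj := by
              have := (hf.attachCells j hj).pushouts_coproducts
              simp only [MorphismProperty.ofHoms_homFamily] at this
              refine (?_ : _ ≤ MorphismProperty.monomorphisms (ModuleCat.{u} R)) _ this
              rw [MorphismProperty.pushouts_le_iff, MorphismProperty.coproducts_le_iff]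
              exact hle }
        have (j j' : κ.ord.ToType) (φ : j ⟶ j') : Mono (hf'.F.map φ) := hf'.mem_map φ
        obtain ⟨t⟩ := hj
        apply IsGrothendieckAbelian.preservesColimit_coyoneda_obj_of_mono (Y := hf'.F) (κ := κ)
        exact hκ.of_injective (fun S => (⟨t, S⟩ : Σ t, Subobject (A t)))
          (fun _ _ h => by simpa using h) }⟩

/-- `p` has the right lifting property against `i`. -/
def LiftsAgainst {A B X Y : Type u} [AddCommGroup A] [Module R A] [AddCommGroup B] [Module R B]
    [AddCommGroup X] [Module R X] [AddCommGroup Y] [Module R Y]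
    (i : A →ₗ[R] B) (p : X →ₗ[R] Y) : Prop :=
  ∀ (f : A →ₗ[R] X) (g : B →ₗ[R] Y), p ∘ₗ f = g ∘ₗ i → ∃ h : B →ₗ[R] X, h ∘ₗ i = f ∧ p ∘ₗ h = g

theorem liftsAgainst_iff {A B X Y : Type u} [AddCommGroup A] [Module R A] [AddCommGroup B]
    [Module R B] [AddCommGroup X] [Module R X] [AddCommGroup Y] [Module R Y]
    (i : A →ₗ[R] B) (p : X →ₗ[R] Y) :
    LiftsAgainst i p ↔ HasLiftingProperty (ModuleCat.ofHom i) (ModuleCat.ofHom p) := by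
  constructor
  · intro h
    refine ⟨fun {f g} sq => ?_⟩
    obtain ⟨l, h1, h2⟩ := h f.hom g.hom (by
      have := congrArg ModuleCat.Hom.hom sq.w
      simpa using this)
    exact ⟨⟨⟨ModuleCat.ofHom l, by ext1; simpa using h1, by ext1; simpa using h2⟩⟩⟩
  · intro h f g hfg
    have sq : CommSq (ModuleCat.ofHom f) (ModuleCat.ofHom i) (ModuleCat.ofHom p)
        (ModuleCat.ofHom g) := ⟨by ext1; simpa using hfg⟩
    refine ⟨sq.lift.hom, ?_, ?_⟩
    · exact congrArg ModuleCat.Hom.hom sq.fac_left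
    · exact congrArg ModuleCat.Hom.hom sq.fac_right

/-- The small object argument for a set of monomorphisms of modules. -/
theorem exists_factorization_liftsAgainst {ι : Type u} (A B : ι → Type u)
    [∀ t, AddCommGroup (A t)] [∀ t, Module R (A t)] [∀ t, AddCommGroup (B t)]
    [∀ t, Module R (B t)] (i : ∀ t, A t →ₗ[R] B t) (hi : ∀ t, Function.Injective (i t))
    {X Y : Type u} [AddCommGroup X] [Module R X] [AddCommGroup Y] [Module R Y] (f : X →ₗ[R] Y) :
    ∃ (Z : Type u) (_ : AddCommGroup Z) (_ : Module R Z) (a : X →ₗ[R] Z) (p : Z →ₗ[R] Y),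
      p ∘ₗ a = f ∧ (∀ t, LiftsAgainst (i t) p) ∧
      ∀ (V W : Type u) [AddCommGroup V] [Module R V] [AddCommGroup W] [Module R W]
        (q : V →ₗ[R] W), (∀ t, LiftsAgainst (i t) q) → LiftsAgainst a q := by
  have := hasSmallObjectArgument_ofHoms (fun t => ModuleCat.ofHom (i t))
    (fun t => (ModuleCat.mono_iff_injective _).2 (hi t))
  let I := MorphismProperty.ofHoms (fun t => ModuleCat.ofHom (i t))
  let F := MorphismProperty.factorizationData I.rlp.llp I.rlp (ModuleCat.ofHom f)
  refine ⟨F.Z, inferInstance, inferInstance, F.i.hom, F.p.hom, ?_, ?_, ?_⟩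
  · exact congrArg ModuleCat.Hom.hom F.fac
  · intro t
    rw [liftsAgainst_iff]
    exact F.hp _ (MorphismProperty.ofHoms.mk t)
  · intro V W _ _ _ _ q hq
    rw [liftsAgainst_iff]
    refine F.hi _ ?_
    rintro _ _ _ ⟨t⟩
    exact (liftsAgainst_iff _ _).1 (hq t)

section LinearFactorization

variable {A B C : Type u} [AddCommGroup A] [Module R A] [AddCommGroup B] [Module R B]
  [AddCommGroup C] [Module R C]

theorem exists_factor_of_surjective (p : A →ₗ[R] B) (hp : Function.Surjective p)
    (g : A →ₗ[R] C) (h : ∀ a, p a = 0 → g a = 0) : ∃ k : B →ₗ[R] C, ∀ a, k (p a) = g a := by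
  refine ⟨(LinearMap.ker p).liftQ g (fun a ha => h a ha) ∘ₗ
    (p.quotKerEquivOfSurjective hp).symm.toLinearMap, fun a => ?_⟩
  have : (p.quotKerEquivOfSurjective hp).symm (p a) = (LinearMap.ker p).mkQ a := by
    rw [LinearEquiv.symm_apply_eq]
    rfl
  simp only [LinearMap.comp_apply, LinearEquiv.coe_coe, this]
  rfl

theorem exists_factor_of_injective (i : B →ₗ[R] C) (hi : Function.Injective i)
    (g : A →ₗ[R] C) (h : ∀ a, ∃ b, i b = g a) : ∃ k : A →ₗ[R] B, ∀ a, i (k a) = g a := by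
  choose k hk using h
  refine ⟨{ toFun := k, map_add' := fun x y => hi ?_, map_smul' := fun r x => hi ?_ }, hk⟩
  · simp [hk]
  · simp [hk]

theorem exists_extend_of_injective [Module.Injective R C] (i : A →ₗ[R] B)
    (hi : Function.Injective i) (g : A →ₗ[R] C) : ∃ k : B →ₗ[R] C, ∀ a, k (i a) = g a :=
  Module.Injective.out i hi g

theorem exists_lift_of_projective [Module.Projective R C] (p : A →ₗ[R] B)
    (hp : Function.Surjective p) (g : C →ₗ[R] B) : ∃ k : C →ₗ[R] A, ∀ c, p (k c) = g c := by
  obtain ⟨k, hk⟩ := Module.projective_lifting_property p g hp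
  exact ⟨k, fun c => LinearMap.congr_fun hk c⟩

end LinearFactorization

/-- A totally acyclic complex of projectives all of whose differentials are equal to `d`. -/
structure IsSGP {P : Type u} [AddCommGroup P] [Module R P] (d : P →ₗ[R] P) : Prop where
  proj : Module.Projective R P
  exact : LinearMap.ker d = LinearMap.range d
  ext : ∀ (F : Type u) [AddCommGroup F] [Module R F] [Module.Projective R F]
    (f : LinearMap.ker d →ₗ[R] F), ∃ g : P →ₗ[R] F, ∀ x : LinearMap.ker d, g x = f x

/-- A totally acyclic complex of injectives all of whose differentials are equal to `d`. -/
structure IsSGI {I : Type u} [AddCommGroup I] [Module R I] (d : I →ₗ[R] I) : Prop where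
  inj : Module.Injective R I
  exact : LinearMap.ker d = LinearMap.range d
  lift : ∀ (J : Type u) [AddCommGroup J] [Module R J] [Module.Injective R J]
    (f : J →ₗ[R] LinearMap.ker d), ∃ g : J →ₗ[R] I, ∀ x, d (g x) = f x

/-- Every map from the cycles of a periodic totally acyclic complex of projectives to `M`
extends. -/
def GPTrivial (R : Type u) [CommRing R] (M : Type u) [AddCommGroup M] [Module R M] : Prop :=
  ∀ (P : Type u) [AddCommGroup P] [Module R P] (d : P →ₗ[R] P), IsSGP d →
    ∀ f : LinearMap.ker d →ₗ[R] M, ∃ g : P →ₗ[R] M, ∀ x : LinearMap.ker d, g x = f x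

/-- Every map from `M` to the cycles of a periodic totally acyclic complex of injectives
lifts. -/
def GITrivial (R : Type u) [CommRing R] (M : Type u) [AddCommGroup M] [Module R M] : Prop :=
  ∀ (I : Type u) [AddCommGroup I] [Module R I] (d : I →ₗ[R] I), IsSGI d →
    ∀ f : M →ₗ[R] LinearMap.ker d, ∃ g : M →ₗ[R] I, ∀ x, d (g x) = f x

section Exactness

variable {P M : Type u} [AddCommGroup P] [Module R P] [AddCommGroup M] [Module R M]

theorem apply_apply_of_exact {d : P →ₗ[R] P} (h : LinearMap.ker d = LinearMap.range d) (x : P) :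
    d (d x) = 0 := by
  have : d x ∈ LinearMap.ker d := h ▸ ⟨x, rfl⟩
  exact this

theorem exists_of_exact {d : P →ₗ[R] P} (h : LinearMap.ker d = LinearMap.range d) {x : P}
    (hx : d x = 0) : ∃ y, d y = x := by
  have : x ∈ LinearMap.range d := h ▸ hx
  exact this

/-- The corestriction of `d` to its kernel. -/
def toKer (d : P →ₗ[R] P) (h : LinearMap.ker d = LinearMap.range d) : P →ₗ[R] LinearMap.ker d :=
  d.codRestrict _ (apply_apply_of_exact h)

theorem toKer_surjective (d : P →ₗ[R] P) (h : LinearMap.ker d = LinearMap.range d) :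
    Function.Surjective (toKer d h) := by
  rintro ⟨x, hx⟩
  obtain ⟨y, hy⟩ := exists_of_exact h hx
  exact ⟨y, Subtype.ext hy⟩

@[simp] theorem coe_toKer (d : P →ₗ[R] P) (h : LinearMap.ker d = LinearMap.range d) (x : P) :
    (toKer d h x : P) = d x := rfl

theorem exists_factor_toKer (d : P →ₗ[R] P) (h : LinearMap.ker d = LinearMap.range d)
    (g : P →ₗ[R] M) (hg : ∀ x, d x = 0 → g x = 0) :
    ∃ k : LinearMap.ker d →ₗ[R] M, ∀ x, k (toKer d h x) = g x :=
  exists_factor_of_surjective (toKer d h) (toKer_surjective d h) g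
    (fun x hx => hg x (congrArg Subtype.val hx))

end Exactness

section Closure

variable {A B C : Type u} [AddCommGroup A] [Module R A] [AddCommGroup B] [Module R B]
  [AddCommGroup C] [Module R C]

theorem GPTrivial.of_projective [Module.Projective R A] : GPTrivial R A :=
  fun _ _ _ _ hd f => hd.ext _ f

theorem GPTrivial.of_injective [Module.Injective R A] : GPTrivial R A :=
  fun _ _ _ _ _ f => exists_extend_of_injective (Submodule.subtype _) Subtype.val_injective f

theorem GPTrivial.of_retract (hB : GPTrivial R B) (i : A →ₗ[R] B) (r : B →ₗ[R] A)
    (h : ∀ a, r (i a) = a) : GPTrivial R A := by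
  intro P _ _ d hd f
  obtain ⟨g, hg⟩ := hB P d hd (i ∘ₗ f)
  exact ⟨r ∘ₗ g, fun x => by simp [hg, h]⟩

theorem GPTrivial.of_equiv (hB : GPTrivial R B) (e : A ≃ₗ[R] B) : GPTrivial R A :=
  hB.of_retract e.toLinearMap e.symm.toLinearMap (by simp)

theorem GPTrivial.cokernel (hA : GPTrivial R A) (hB : GPTrivial R B) (i : A →ₗ[R] B)
    (p : B →ₗ[R] C) (hi : Function.Injective i) (hp : Function.Surjective p)
    (h : Function.Exact i p) : GPTrivial R C := by
  intro P _ _ d hd f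
  have := hd.proj
  obtain ⟨k, hk⟩ := exists_lift_of_projective p hp (f ∘ₗ toKer d hd.exact)
  obtain ⟨f', hf'⟩ := exists_factor_of_injective i hi (k ∘ₗ (LinearMap.ker d).subtype) (by
    intro a
    refine (h _).1 ?_
    have ha : toKer d hd.exact a = 0 := Subtype.ext a.2
    simp [hk, ha])
  obtain ⟨g, hg⟩ := hA P d hd f'
  obtain ⟨v, hv⟩ := exists_factor_toKer d hd.exact (k - i ∘ₗ g) (by
    intro x hx
    have := hg ⟨x, hx⟩
    have h2 := hf' ⟨x, hx⟩
    simp_all)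
  obtain ⟨V, hV⟩ := hB P d hd v
  refine ⟨p ∘ₗ V, fun x => ?_⟩
  obtain ⟨y, rfl⟩ := toKer_surjective d hd.exact x
  rw [LinearMap.comp_apply, hV, hv]
  simp [hk, h.apply_apply_eq_zero]

theorem GPTrivial.kernel (hB : GPTrivial R B) (hC : GPTrivial R C) (i : A →ₗ[R] B)
    (p : B →ₗ[R] C) (hi : Function.Injective i) (hp : Function.Surjective p)
    (h : Function.Exact i p) : GPTrivial R A := by
  intro P _ _ d hd f
  have := hd.proj
  obtain ⟨g, hg⟩ := hB P d hd (i ∘ₗ f)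
  obtain ⟨v, hv⟩ := exists_factor_toKer d hd.exact (p ∘ₗ g) (by
    intro x hx
    have := hg ⟨x, hx⟩
    simp_all [h.apply_apply_eq_zero])
  obtain ⟨U, hU⟩ := hC P d hd v
  obtain ⟨T, hT⟩ := exists_lift_of_projective p hp U
  obtain ⟨k, hk⟩ := exists_factor_of_injective i hi (g - T ∘ₗ d) (by
    intro x
    refine (h _).1 ?_
    have h1 := hU (toKer d hd.exact x)
    have h2 := hv x
    simp_all)
  refine ⟨k, fun x => hi ?_⟩
  have := hg x
  simp_all

/-- The trivial modules are closed under quotients by trivial submodules. -/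
theorem GPTrivial.quotient (hB : GPTrivial R B) (N : Submodule R B) (hN : GPTrivial R N) :
    GPTrivial R (B ⧸ N) :=
  hN.cokernel hB N.subtype N.mkQ Subtype.val_injective N.mkQ_surjective
    (LinearMap.exact_subtype_mkQ N)

theorem GPTrivial.of_subsingleton [Subsingleton A] : GPTrivial R A :=
  fun _ _ _ _ _ _ => ⟨0, fun _ => Subsingleton.elim _ _⟩

end Closure

section Periodize

theorem exists_shift {X : ℤ → Type u} (y : ∀ j : ℤ, X (j + 1)) : ∃ z : ∀ j, X j, ∀ j, z (j + 1) = y j := by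
  have : ∀ i : ℤ, ∃ w : X i, ∀ j (h : i = j + 1), w = h ▸ y j := fun i => by
    obtain ⟨j, rfl⟩ : ∃ j, i = j + 1 := ⟨i - 1, by omega⟩
    refine ⟨y j, fun k h => ?_⟩
    obtain rfl : j = k := by omega
    rfl
  choose w hw using this
  exact ⟨w, fun j => hw _ j rfl⟩

variable {X : ℤ → Type u} [∀ i, AddCommGroup (X i)] [∀ i, Module R (X i)]

/-- The total differential on the direct sum of the terms of a complex. -/
def sumDiff (D : ∀ j, X (j + 1) →ₗ[R] X j) : (Π₀ j, X j) →ₗ[R] (Π₀ j, X j) where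
  toFun x := DFinsupp.mapRange (fun j => D j) (fun j => map_zero (D j))
    (DFinsupp.comapDomain' (fun j => j + 1) (h' := fun j => j - 1) (fun j => by simp) x)
  map_add' x y := by ext; simp
  map_smul' r x := by ext; simp

@[simp] theorem sumDiff_apply (D : ∀ j, X (j + 1) →ₗ[R] X j) (x : Π₀ j, X j) (j : ℤ) :
    sumDiff D x j = D j (x (j + 1)) := rfl

theorem sumDiff_single (D : ∀ j, X (j + 1) →ₗ[R] X j) (j : ℤ) (a : X (j + 1)) :
    sumDiff D (DFinsupp.single (j + 1) a) = DFinsupp.single j (D j a) := by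
  ext k
  by_cases h : k = j
  · subst h
    simp
  · rw [sumDiff_apply, DFinsupp.single_eq_of_ne (by omega), DFinsupp.single_eq_of_ne h, map_zero]

theorem isSGP_sumDiff (D : ∀ j, X (j + 1) →ₗ[R] X j) [∀ j, Module.Projective R (X j)]
    (h0 : ∀ j x, D j (D (j + 1) x) = 0) (hex : ∀ j x, D j x = 0 → ∃ y, D (j + 1) y = x)
    (hext : ∀ (F : Type u) [AddCommGroup F] [Module R F] [Module.Projective R F] (j : ℤ)
      (f : X (j + 1) →ₗ[R] F), (∀ y, f (D (j + 1) y) = 0) →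
      ∃ g : X j →ₗ[R] F, ∀ x, g (D j x) = f x) : IsSGP (sumDiff D) := by
  have hker : LinearMap.ker (sumDiff D) = LinearMap.range (sumDiff D) := by
    apply le_antisymm
    · classical
      intro x hx
      have hx' : ∀ j, D j (x (j + 1)) = 0 := fun j => by
        rw [← sumDiff_apply, LinearMap.mem_ker.1 hx, DFinsupp.zero_apply]
      rw [← DFinsupp.sum_single (f := x)]
      refine Submodule.sum_mem _ fun i _ => ?_
      obtain ⟨j, rfl⟩ : ∃ j, i = j + 1 := ⟨i - 1, by omega⟩
      obtain ⟨y, hy⟩ := hex _ _ (hx' j)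
      exact ⟨DFinsupp.single (j + 1 + 1) y, by rw [sumDiff_single, hy]⟩
    · rintro _ ⟨x, rfl⟩
      rw [LinearMap.mem_ker]
      ext j
      simp [h0]
  refine ⟨inferInstance, hker, fun F _ _ _ f => ?_⟩
  have key : ∀ j, ∃ g : X j →ₗ[R] F, ∀ x : X (j + 1),
      g (D j x) = f (toKer _ hker (DFinsupp.single (j + 1) x)) := fun j => by
    refine hext F j (f ∘ₗ toKer _ hker ∘ₗ DFinsupp.lsingle (j + 1)) fun y => ?_
    have : toKer _ hker (DFinsupp.single (j + 1) (D (j + 1) y)) = 0 := by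
      apply Subtype.ext
      rw [coe_toKer, sumDiff_single, h0]
      simp
    simp [this]
  choose g hg using key
  refine ⟨DFinsupp.lsum ℕ g, fun x => ?_⟩
  obtain ⟨y, rfl⟩ := toKer_surjective _ hker x
  have : DFinsupp.lsum ℕ g ∘ₗ sumDiff D = f ∘ₗ toKer _ hker := by
    refine DFinsupp.lhom_ext' fun i => ?_
    obtain ⟨j, rfl⟩ : ∃ j, i = j + 1 := ⟨i - 1, by omega⟩
    ext a
    simp [sumDiff_single, hg]
  exact LinearMap.congr_fun this y

theorem exists_retract_ker_sumDiff (D : ∀ j, X (j + 1) →ₗ[R] X j) (j : ℤ) :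
    ∃ (i : LinearMap.ker (D j) →ₗ[R] LinearMap.ker (sumDiff D))
      (r : LinearMap.ker (sumDiff D) →ₗ[R] LinearMap.ker (D j)), ∀ x, r (i x) = x := by
  refine ⟨(DFinsupp.lsingle (j + 1) ∘ₗ (LinearMap.ker (D j)).subtype).codRestrict _ ?_,
    (DFinsupp.lapply (j + 1) ∘ₗ (LinearMap.ker (sumDiff D)).subtype).codRestrict _ ?_, ?_⟩
  · rintro ⟨x, hx⟩
    rw [LinearMap.mem_ker] at hx
    simp [sumDiff_single, hx]
  · rintro ⟨x, hx⟩
    have := congrArg (fun y : Π₀ j, X j => y j) (LinearMap.mem_ker.1 hx)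
    simpa using this
  · rintro ⟨x, hx⟩
    apply Subtype.ext
    simp

/-- The total differential on the product of the terms of a complex. -/
def prodDiff (D : ∀ j, X (j + 1) →ₗ[R] X j) : (∀ j, X j) →ₗ[R] (∀ j, X j) :=
  LinearMap.pi fun j => D j ∘ₗ LinearMap.proj (j + 1)

@[simp] theorem prodDiff_apply (D : ∀ j, X (j + 1) →ₗ[R] X j) (x : ∀ j, X j) (j : ℤ) :
    prodDiff D x j = D j (x (j + 1)) := rfl

theorem isSGI_prodDiff (D : ∀ j, X (j + 1) →ₗ[R] X j) [∀ j, Module.Injective R (X j)]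
    (h0 : ∀ j x, D j (D (j + 1) x) = 0) (hex : ∀ j x, D j x = 0 → ∃ y, D (j + 1) y = x)
    (hlift : ∀ (J : Type u) [AddCommGroup J] [Module R J] [Module.Injective R J] (j : ℤ)
      (f : J →ₗ[R] X (j + 1)), (∀ y, D j (f y) = 0) →
      ∃ g : J →ₗ[R] X (j + 1 + 1), ∀ x, D (j + 1) (g x) = f x) : IsSGI (prodDiff D) := by
  have hker : LinearMap.ker (prodDiff D) = LinearMap.range (prodDiff D) := by
    apply le_antisymm
    · intro x hx
      have hx' : ∀ j, D j (x (j + 1)) = 0 := fun j => by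
        rw [← prodDiff_apply, LinearMap.mem_ker.1 hx, Pi.zero_apply]
      choose y hy using fun j => hex _ _ (hx' j)
      obtain ⟨z, hz⟩ := exists_shift (X := fun i => X (i + 1)) y
      obtain ⟨z', hz'⟩ := exists_shift z
      refine ⟨z', ?_⟩
      ext i
      obtain ⟨j, rfl⟩ : ∃ j, i = j + 1 := ⟨i - 1, by omega⟩
      simp [hz', hz, hy]
    · rintro _ ⟨x, rfl⟩
      rw [LinearMap.mem_ker]
      ext j
      simp [h0]
  refine ⟨inferInstance, hker, fun J _ _ _ f => ?_⟩
  have key : ∀ j, ∃ g : J →ₗ[R] X (j + 1 + 1), ∀ x, D (j + 1) (g x) = (f x).1 (j + 1) :=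
    fun j => hlift J j (LinearMap.proj (j + 1) ∘ₗ Submodule.subtype _ ∘ₗ f) fun y =>
      congrFun (f y).2 j
  choose g hg using key
  obtain ⟨g', hg'⟩ := exists_shift (X := fun i => J →ₗ[R] X (i + 1)) g
  obtain ⟨g'', hg''⟩ := exists_shift (X := fun i => J →ₗ[R] X i) g'
  refine ⟨LinearMap.pi g'', fun x => ?_⟩
  ext i
  obtain ⟨j, rfl⟩ : ∃ j, i = j + 1 := ⟨i - 1, by omega⟩
  simp [hg'', hg', hg]

theorem exists_retract_ker_prodDiff (D : ∀ j, X (j + 1) →ₗ[R] X j) (j : ℤ) :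
    ∃ (i : LinearMap.ker (D j) →ₗ[R] LinearMap.ker (prodDiff D))
      (r : LinearMap.ker (prodDiff D) →ₗ[R] LinearMap.ker (D j)), ∀ x, r (i x) = x := by
  refine ⟨(LinearMap.single R X (j + 1) ∘ₗ (LinearMap.ker (D j)).subtype).codRestrict _ ?_,
    (LinearMap.proj (j + 1) ∘ₗ (LinearMap.ker (prodDiff D)).subtype).codRestrict _ ?_, ?_⟩
  · rintro ⟨x, hx⟩
    rw [LinearMap.mem_ker]
    ext k
    by_cases h : k = j
    · subst h
      simpa using hx
    · simp only [LinearMap.comp_apply, prodDiff_apply, Submodule.subtype_apply,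
        LinearMap.single_apply, Pi.zero_apply]
      rw [Pi.single_eq_of_ne (by omega), map_zero]
  · rintro ⟨x, hx⟩
    exact congrFun hx j
  · rintro ⟨x, hx⟩
    apply Subtype.ext
    simp

end Periodize

section Periodic

variable {P : Type u} [AddCommGroup P] [Module R P]

/-- The chain complex all of whose differentials are `d`. -/
def periodicChain (d : P →ₗ[R] P) (h : ∀ x, d (d x) = 0) : ChainComplex (ModuleCat.{u} R) ℤ where
  X _ := ModuleCat.of R P
  d i j := ModuleCat.ofHom (if j + 1 = i then d else 0)
  shape i j hij := by
    rw [if_neg (show ¬ j + 1 = i from hij)]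
    rfl
  d_comp_d' i j k hij hjk := by
    ext x
    simp [if_pos (show j + 1 = i from hij), if_pos (show k + 1 = j from hjk), h]

/-- The cochain complex all of whose differentials are `d`. -/
def periodicCochain (d : P →ₗ[R] P) (h : ∀ x, d (d x) = 0) :
    CochainComplex (ModuleCat.{u} R) ℤ where
  X _ := ModuleCat.of R P
  d i j := ModuleCat.ofHom (if i + 1 = j then d else 0)
  shape i j hij := by
    rw [if_neg (show ¬ i + 1 = j from hij)]
    rfl
  d_comp_d' i j k hij hjk := by
    ext x
    simp [if_pos (show i + 1 = j from hij), if_pos (show j + 1 = k from hjk), h]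

theorem periodicChain_d (d : P →ₗ[R] P) (h : ∀ x, d (d x) = 0) {i j : ℤ} (hij : j + 1 = i) :
    (periodicChain d h).d i j = ModuleCat.ofHom d := by
  simp only [periodicChain, if_pos hij]

theorem periodicCochain_d (d : P →ₗ[R] P) (h : ∀ x, d (d x) = 0) {i j : ℤ} (hij : i + 1 = j) :
    (periodicCochain d h).d i j = ModuleCat.ofHom d := by
  simp only [periodicCochain, if_pos hij]

theorem chainComplex_exactAt_iff (C : ChainComplex (ModuleCat.{u} R) ℤ) {i j k : ℤ}
    (hij : j + 1 = i) (hjk : k + 1 = j) :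
    C.ExactAt j ↔ ∀ x : C.X j, C.d j k x = 0 → ∃ y : C.X i, C.d i j y = x := by
  rw [C.exactAt_iff' i j k (by simp [hij]) (by simp; omega), ShortComplex.moduleCat_exact_iff]
  rfl

theorem cochainComplex_exactAt_iff (C : CochainComplex (ModuleCat.{u} R) ℤ) {i j k : ℤ}
    (hij : i + 1 = j) (hjk : j + 1 = k) :
    C.ExactAt j ↔ ∀ x : C.X j, C.d j k x = 0 → ∃ y : C.X i, C.d i j y = x := by
  rw [C.exactAt_iff' i j k (by simp; omega) (by simp [hjk]), ShortComplex.moduleCat_exact_iff]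
  rfl

theorem IsSGP.isGorensteinProjective {d : P →ₗ[R] P} (hd : IsSGP d) :
    IsGorensteinProjective (ModuleCat.of R (LinearMap.ker d)) := by
  have h0 := apply_apply_of_exact hd.exact
  have := hd.proj
  refine ⟨periodicChain d h0, fun i => ?_, fun i => ?_, ⟨?_⟩, fun F hF i f hf => ?_⟩
  · exact (IsProjective.iff_projective P).1 hd.proj
  · rw [chainComplex_exactAt_iff _ rfl (sub_add_cancel i 1), periodicChain_d _ _ rfl,
      periodicChain_d _ _ (sub_add_cancel i 1)]
    exact fun x hx => exists_of_exact hd.exact hx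
  · refine (?_ ≪≫ (ModuleCat.cokernelIsoRangeQuotient (ModuleCat.ofHom d)).symm) ≪≫
      cokernelIsoOfEq (periodicChain_d d h0 (show (0 : ℤ) + 1 = 1 from rfl)).symm
    exact (((Submodule.quotEquivOfEq _ _ hd.exact.symm).trans d.quotKerEquivRange).trans
      (LinearEquiv.ofEq _ _ hd.exact.symm)).symm.toModuleIso
  · have : Module.Projective R F := (IsProjective.iff_projective F).2 hF
    rw [periodicChain_d _ _ rfl] at hf
    obtain ⟨k, hk⟩ := exists_factor_toKer d hd.exact (f.hom : P →ₗ[R] F) (by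
      intro x hx
      obtain ⟨y, rfl⟩ := exists_of_exact hd.exact hx
      exact LinearMap.congr_fun (congrArg ModuleCat.Hom.hom hf) y)
    obtain ⟨g, hg⟩ := hd.ext F k
    refine ⟨ModuleCat.ofHom g, ?_⟩
    rw [periodicChain_d _ _ (sub_add_cancel i 1)]
    ext x
    exact ((hg (toKer d hd.exact x)).trans (hk x)).symm

theorem IsSGI.isGorensteinInjective {d : P →ₗ[R] P} (hd : IsSGI d) :
    IsGorensteinInjective (ModuleCat.of R (LinearMap.ker d)) := by
  have h0 := apply_apply_of_exact hd.exact
  refine ⟨periodicCochain d h0, fun i => ?_, fun i => ?_, ⟨?_⟩, fun F hF i f hf => ?_⟩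
  · exact (Module.injective_iff_injective_object R P).1 hd.inj
  · rw [cochainComplex_exactAt_iff _ (sub_add_cancel i 1) rfl, periodicCochain_d _ _ rfl,
      periodicCochain_d _ _ (sub_add_cancel i 1)]
    exact fun x hx => exists_of_exact hd.exact hx
  · exact (ModuleCat.kernelIsoKer (ModuleCat.ofHom d)).symm ≪≫
      kernelIsoOfEq (periodicCochain_d d h0 (show (0 : ℤ) + 1 = 1 from rfl)).symm
  · have : Module.Injective R F := (Module.injective_iff_injective_object R F).2 hF
    rw [periodicCochain_d _ _ rfl] at hf
    obtain ⟨g, hg⟩ := hd.lift F ((f.hom : F →ₗ[R] P).codRestrict _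
      fun x => LinearMap.congr_fun (congrArg ModuleCat.Hom.hom hf) x)
    refine ⟨ModuleCat.ofHom g, ?_⟩
    rw [periodicCochain_d _ _ (sub_add_cancel i 1)]
    ext x
    exact (hg x).symm

end Periodic

theorem IsGorensteinProjective.exists_retract {Q : ModuleCat.{u} R}
    (hQ : IsGorensteinProjective Q) :
    ∃ (P : Type u) (_ : AddCommGroup P) (_ : Module R P) (d : P →ₗ[R] P), IsSGP d ∧
      ∃ (i : Q →ₗ[R] LinearMap.ker d) (r : LinearMap.ker d →ₗ[R] Q), ∀ x, r (i x) = x := by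
  obtain ⟨C, hproj, hex, ⟨e⟩, hext⟩ := hQ
  have : ∀ j, Module.Projective R (C.X j) := fun j => (IsProjective.iff_projective _).2 (hproj j)
  let D : ∀ j, C.X (j + 1) →ₗ[R] C.X j := fun j => (C.d (j + 1) j).hom
  have h0 : ∀ j x, D j (D (j + 1) x) = 0 := fun j x =>
    LinearMap.congr_fun (congrArg ModuleCat.Hom.hom (C.d_comp_d (j + 1 + 1) (j + 1) j)) x
  have hex' : ∀ j x, D j x = 0 → ∃ y, D (j + 1) y = x := fun j =>
    (chainComplex_exactAt_iff C rfl rfl).1 (hex (j + 1))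
  have hS : IsSGP (sumDiff (X := fun j => C.X j) D) := by
    refine isSGP_sumDiff (X := fun j => C.X j) D h0 hex' fun F _ _ _ j f hf => ?_
    have h1 : ∀ k, k = j + 1 - 1 → ∃ g : C.X k ⟶ ModuleCat.of R F,
        ModuleCat.ofHom f = C.d (j + 1) k ≫ g := by
      rintro k rfl
      refine hext (ModuleCat.of R F) ((IsProjective.iff_projective F).1 inferInstance) (j + 1)
        (ModuleCat.ofHom f) ?_
      ext y
      exact hf y
    obtain ⟨g, hg⟩ := h1 j (by omega)
    exact ⟨g.hom, fun x => (LinearMap.congr_fun (congrArg ModuleCat.Hom.hom hg) x).symm⟩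
  obtain ⟨i, r, hir⟩ := exists_retract_ker_sumDiff (X := fun j => C.X j) D (-2)
  refine ⟨_, _, _, sumDiff (X := fun j => C.X j) D, hS, ?_⟩
  -- `Q` is the kernel of the differential in degree `-1`
  let π : C.X 0 →ₗ[R] Q := (cokernel.π (C.d 1 0) ≫ e.inv).hom
  have hπ : Function.Surjective π :=
    (ModuleCat.epi_iff_surjective (cokernel.π (C.d 1 0) ≫ e.inv)).1 inferInstance
  let δ : C.X 0 →ₗ[R] LinearMap.ker (D (-2)) := (C.d 0 (-1)).hom.codRestrict _ fun x =>
    LinearMap.congr_fun (congrArg ModuleCat.Hom.hom (C.d_comp_d 0 (-1) (-2))) x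
  have hδ : Function.Surjective δ := by
    rintro ⟨x, hx⟩
    obtain ⟨y, hy⟩ := (chainComplex_exactAt_iff C (i := 0) (j := -1) (k := -2) rfl rfl).1
      (hex (-1)) x hx
    exact ⟨y, Subtype.ext hy⟩
  have hπδ : ∀ x, π x = 0 ↔ δ x = 0 := by
    intro x
    have hπx : π x = 0 ↔ ∃ y, C.d 1 0 y = x := by
      have hS : (ShortComplex.mk (C.d 1 0) (cokernel.π (C.d 1 0))
        (cokernel.condition _)).Exact := ShortComplex.exact_cokernel _
      rw [ShortComplex.moduleCat_exact_iff] at hS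
      constructor
      · intro h
        refine hS x ?_
        have := congrArg e.hom h
        simpa [π] using this
      · rintro ⟨y, rfl⟩
        have := LinearMap.congr_fun (congrArg ModuleCat.Hom.hom
          (cokernel.condition (C.d 1 0))) y
        simp only [π]
        rw [ModuleCat.hom_comp, LinearMap.comp_apply]
        erw [this]
        simp
    rw [hπx]
    constructor
    · rintro ⟨y, rfl⟩
      exact Subtype.ext (LinearMap.congr_fun (congrArg ModuleCat.Hom.hom (C.d_comp_d 1 0 (-1))) y)
    · intro h
      exact (chainComplex_exactAt_iff C (i := 1) (j := 0) (k := -1) rfl rfl).1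
        (hex 0) x (congrArg Subtype.val h)
  obtain ⟨a, ha⟩ := exists_factor_of_surjective π hπ δ fun x => (hπδ x).1
  obtain ⟨b, hb⟩ := exists_factor_of_surjective δ hδ π fun x => (hπδ x).2
  refine ⟨i ∘ₗ a, b ∘ₗ r, fun q => ?_⟩
  obtain ⟨x, rfl⟩ := hπ q
  simp [ha, hir, hb]

theorem IsGorensteinInjective.exists_retract {E : ModuleCat.{u} R}
    (hE : IsGorensteinInjective E) :
    ∃ (I : Type u) (_ : AddCommGroup I) (_ : Module R I) (d : I →ₗ[R] I), IsSGI d ∧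
      ∃ (i : E →ₗ[R] LinearMap.ker d) (r : LinearMap.ker d →ₗ[R] E), ∀ x, r (i x) = x := by
  obtain ⟨C, hinj, hex, ⟨e⟩, hlift⟩ := hE
  let X : ℤ → Type u := fun j => C.X (-j)
  have : ∀ j, Module.Injective R (X j) := fun j =>
    (Module.injective_iff_injective_object R _).2 (hinj (-j))
  let D : ∀ j, X (j + 1) →ₗ[R] X j := fun j => (C.d (-(j + 1)) (-j)).hom
  have h0 : ∀ j x, D j (D (j + 1) x) = 0 := fun j x =>
    LinearMap.congr_fun (congrArg ModuleCat.Hom.hom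
      (C.d_comp_d (-(j + 1 + 1)) (-(j + 1)) (-j))) x
  have hex' : ∀ j x, D j x = 0 → ∃ y, D (j + 1) y = x := fun j =>
    (cochainComplex_exactAt_iff C (by omega) (by omega)).1 (hex (-(j + 1)))
  have hS : IsSGI (prodDiff D) := by
    refine isSGI_prodDiff D h0 hex' fun J _ _ _ j f hf => ?_
    have h1 : ∀ k l, k = -(j + 1) - 1 → l = -(j + 1) + 1 → ModuleCat.ofHom f ≫ C.d _ l = 0 →
        ∃ g : ModuleCat.of R J ⟶ C.X k, ModuleCat.ofHom f = g ≫ C.d k (-(j + 1)) := by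
      rintro k l rfl rfl h
      exact hlift (ModuleCat.of R J) ((Module.injective_iff_injective_object R J).1 inferInstance)
        (-(j + 1)) (ModuleCat.ofHom f) h
    obtain ⟨g, hg⟩ := h1 (-(j + 1 + 1)) (-j) (by omega) (by omega) (by
      ext y
      exact hf y)
    exact ⟨g.hom, fun x => (LinearMap.congr_fun (congrArg ModuleCat.Hom.hom hg) x).symm⟩
  obtain ⟨i, r, hir⟩ := exists_retract_ker_prodDiff D (-1)
  let f : E ≃ₗ[R] LinearMap.ker (D (-1)) :=
    (e ≪≫ ModuleCat.kernelIsoKer (C.d 0 1)).toLinearEquiv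
  exact ⟨_, _, _, prodDiff D, hS, i ∘ₗ f.toLinearMap, f.symm.toLinearMap ∘ₗ r, fun q => by
    simp [hir]⟩

section Ext

variable {M N F F' : Type u} [AddCommGroup M] [Module R M] [AddCommGroup N] [Module R N]
  [AddCommGroup F] [Module R F] [AddCommGroup F'] [Module R F']

theorem exists_extend_of_cover [Module.Projective R F] [Module.Projective R F']
    (p : F →ₗ[R] M) (p' : F' →ₗ[R] M) (hp : Function.Surjective p) (hp' : Function.Surjective p')
    (h : ∀ f : LinearMap.ker p →ₗ[R] N, ∃ g : F →ₗ[R] N, ∀ x : LinearMap.ker p, g x = f x)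
    (f : LinearMap.ker p' →ₗ[R] N) :
    ∃ g : F' →ₗ[R] N, ∀ x : LinearMap.ker p', g x = f x := by
  obtain ⟨a, ha⟩ := exists_lift_of_projective p' hp' p
  obtain ⟨b, hb⟩ := exists_lift_of_projective p hp p'
  obtain ⟨y, hy⟩ := h (f ∘ₗ (a ∘ₗ (LinearMap.ker p).subtype).codRestrict _ (by
    rintro ⟨x, hx⟩
    simpa [ha] using hx))
  refine ⟨y ∘ₗ b + f ∘ₗ (LinearMap.id - a ∘ₗ b).codRestrict _ (by simp [ha, hb]), ?_⟩
  rintro ⟨x, hx⟩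
  have hbx : p (b x) = 0 := by rw [hb]; exact hx
  have := hy ⟨b x, hbx⟩
  simp only [LinearMap.add_apply, LinearMap.comp_apply] at this ⊢
  rw [this, ← map_add]
  congr 1
  apply Subtype.ext
  simp

theorem extVanish_one_iff {M N : ModuleCat.{u} R} {F : Type u} [AddCommGroup F] [Module R F]
    [Module.Projective R F] (p : F →ₗ[R] M) (hp : Function.Surjective p) :
    extVanish 1 M N ↔
      ∀ f : LinearMap.ker p →ₗ[R] N, ∃ g : F →ₗ[R] N, ∀ x : LinearMap.ker p, g x = f x := by
  let P := projectiveResolution M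
  have : Module.Projective R (P.complex.X 0) :=
    (IsProjective.iff_projective _).2 (P.projective 0)
  let π : P.complex.X 0 →ₗ[R] M := (P.π.f 0 ≫ (HomologicalComplex.singleObjXSelf _ 0 M).hom).hom
  have hπ : Function.Surjective π := (ModuleCat.epi_iff_surjective
    (P.π.f 0 ≫ (HomologicalComplex.singleObjXSelf _ 0 M).hom)).1 inferInstance
  have hπ0 : ∀ z : P.complex.X 1, π (P.complex.d 1 0 z) = 0 := fun z => by
    have h1 := LinearMap.congr_fun (congrArg ModuleCat.Hom.hom P.complex_d_comp_π_f_zero) z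
    have h2 := congrArg (HomologicalComplex.singleObjXSelf (ComplexShape.down ℕ) 0 M).hom h1
    exact h2.trans (map_zero _)
  have hπex : ∀ y : P.complex.X 0, π y = 0 → ∃ z, P.complex.d 1 0 z = y := by
    intro y hy
    have h1 := P.exact₀
    rw [ShortComplex.moduleCat_exact_iff] at h1
    refine h1 y ?_
    apply (ModuleCat.mono_iff_injective
      (HomologicalComplex.singleObjXSelf (ComplexShape.down ℕ) 0 M).hom).1 inferInstance
    rw [map_zero]
    exact hy
  have key : extVanish 1 M N ↔ ∀ x : P.complex.X 1 ⟶ N, P.complex.d 2 1 ≫ x = 0 →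
      ∃ y : P.complex.X 0 ⟶ N, P.complex.d 1 0 ≫ y = x := by
    have e := P.isoExt (R := R) 1 N
    have h1 : extVanish 1 M N ↔ IsZero ((P.complex.linearYonedaObj R N).homology 1) := by
      rw [← e.isZero_iff]
      exact ⟨fun h => ModuleCat.isZero_of_subsingleton _,
        fun h => ModuleCat.subsingleton_of_isZero h⟩
    rw [h1, ← HomologicalComplex.exactAt_iff_isZero_homology,
      HomologicalComplex.exactAt_iff' _ 0 1 2 (by simp) (by simp),
      ShortComplex.moduleCat_exact_iff]
    rfl
  have hex2 : ∀ z : P.complex.X 1, P.complex.d 1 0 z = 0 → ∃ w, P.complex.d 2 1 w = z :=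
    (ShortComplex.moduleCat_exact_iff _).1 (P.exact_succ 0)
  have main : extVanish 1 M N ↔
      ∀ f : LinearMap.ker π →ₗ[R] N, ∃ g : P.complex.X 0 →ₗ[R] N,
        ∀ x : LinearMap.ker π, g x = f x := by
    let δ : P.complex.X 1 →ₗ[R] LinearMap.ker π := (P.complex.d 1 0).hom.codRestrict _ hπ0
    have hδ : Function.Surjective δ := by
      rintro ⟨x, hx⟩
      obtain ⟨z, hz⟩ := hπex x hx
      exact ⟨z, Subtype.ext hz⟩
    have hδ2 : ∀ w, δ (P.complex.d 2 1 w) = 0 := fun w =>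
      Subtype.ext (LinearMap.congr_fun (congrArg ModuleCat.Hom.hom (P.complex.d_comp_d 2 1 0)) w)
    rw [key]
    constructor
    · intro h f
      obtain ⟨y, hy⟩ := h (ModuleCat.ofHom (f ∘ₗ δ)) (by
        ext w
        have := hδ2 w
        simp [this])
      refine ⟨y.hom, fun x => ?_⟩
      obtain ⟨z, rfl⟩ := hδ x
      exact LinearMap.congr_fun (congrArg ModuleCat.Hom.hom hy) z
    · intro h x hx
      obtain ⟨f, hf⟩ := exists_factor_of_surjective δ hδ x.hom (by
        intro z hz
        obtain ⟨w, rfl⟩ := hex2 z (congrArg Subtype.val hz)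
        exact LinearMap.congr_fun (congrArg ModuleCat.Hom.hom hx) w)
      obtain ⟨g, hg⟩ := h f
      refine ⟨ModuleCat.ofHom g, ?_⟩
      ext z
      exact (hg (δ z)).trans (hf z)
  rw [main]
  exact ⟨fun h => exists_extend_of_cover π p hπ hp h, fun h => exists_extend_of_cover p π hp hπ h⟩

theorem memGPperp_iff (M : ModuleCat.{u} R) : MemGPperp M ↔ GPTrivial R M := by
  constructor
  · intro h P _ _ d hd f
    have := hd.proj
    have h1 := (extVanish_one_iff (toKer d hd.exact) (toKer_surjective d hd.exact)).1
      (h _ hd.isGorensteinProjective)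
    have h2 : LinearMap.ker d = LinearMap.ker (toKer d hd.exact) := by
      ext x
      simp [Subtype.ext_iff]
    obtain ⟨g, hg⟩ := h1 (f ∘ₗ (LinearEquiv.ofEq _ _ h2).symm.toLinearMap)
    refine ⟨g, fun x => ?_⟩
    exact hg ((LinearEquiv.ofEq _ _ h2) x)
  · intro h Q hQ
    obtain ⟨P, _, _, d, hd, i, r, hir⟩ := hQ.exists_retract
    have := hd.proj
    have hs : Function.Surjective (r ∘ₗ toKer d hd.exact) :=
      (Function.LeftInverse.surjective hir).comp (toKer_surjective d hd.exact)
    rw [extVanish_one_iff _ hs]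
    intro f
    obtain ⟨g, hg⟩ := h P d hd (f ∘ₗ Submodule.inclusion (by
      intro x hx
      have : toKer d hd.exact x = 0 := Subtype.ext hx
      simp [this]))
    let q : LinearMap.ker (r ∘ₗ toKer d hd.exact) →ₗ[R] LinearMap.ker r :=
      (toKer d hd.exact ∘ₗ Submodule.subtype _).codRestrict _ fun x => x.2
    obtain ⟨h', hh'⟩ := exists_factor_of_surjective q (by
      rintro ⟨z, hz⟩
      obtain ⟨x, rfl⟩ := toKer_surjective d hd.exact z
      exact ⟨⟨x, hz⟩, rfl⟩) (f - g ∘ₗ Submodule.subtype _) (by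
      intro x hx
      have hx' : d x = 0 := congrArg (fun z => ((z : LinearMap.ker d) : P)) (congrArg Subtype.val hx)
      have := hg ⟨x, hx'⟩
      simp only [LinearMap.sub_apply, LinearMap.comp_apply, Submodule.subtype_apply, this]
      exact sub_self _)
    refine ⟨g + h' ∘ₗ (LinearMap.id - i ∘ₗ r).codRestrict _ (by simp [hir]) ∘ₗ toKer d hd.exact,
      fun x => ?_⟩
    have hq : (LinearMap.id - i ∘ₗ r).codRestrict (LinearMap.ker r) (by simp [hir])
        (toKer d hd.exact x) = q x := by
      apply Subtype.ext
      have hx := LinearMap.mem_ker.1 x.2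
      simp only [LinearMap.comp_apply] at hx
      simp [q, hx]
      rfl
    simp only [LinearMap.add_apply, LinearMap.comp_apply, hq, hh']
    simp

theorem linearCombination_id_surjective (M : Type u) [AddCommGroup M] [Module R M] :
    Function.Surjective (Finsupp.linearCombination R (id : M → M)) :=
  Finsupp.linearCombination_id_surjective R M

theorem memPerpGI_iff (M : ModuleCat.{u} R) : MemPerpGI M ↔ GITrivial R M := by
  let p : (M →₀ R) →ₗ[R] M := Finsupp.linearCombination R id
  have hp : Function.Surjective p := linearCombination_id_surjective M
  constructor
  · intro h I _ _ d hd φ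
    have h1 := (extVanish_one_iff p hp).1 (h _ hd.isGorensteinInjective)
    obtain ⟨G, hG⟩ := exists_lift_of_projective (toKer d hd.exact) (toKer_surjective d hd.exact)
      (φ ∘ₗ p)
    have hG' : ∀ x, d (G x) = φ (p x) := fun x => congrArg Subtype.val (hG x)
    obtain ⟨H, hH⟩ := h1 ((G ∘ₗ Submodule.subtype _).codRestrict (LinearMap.ker d) (by
      rintro ⟨x, hx⟩
      simp [hG', LinearMap.mem_ker.1 hx]))
    obtain ⟨k, hk⟩ := exists_factor_of_surjective p hp (G - Submodule.subtype _ ∘ₗ H) (by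
      intro x hx
      have := congrArg Subtype.val (hH ⟨x, hx⟩)
      simp_all)
    refine ⟨k, fun m => ?_⟩
    obtain ⟨x, rfl⟩ := hp m
    rw [hk]
    simp [hG']
  · intro h E hE
    obtain ⟨I, _, _, d, hd, i, r, hir⟩ := hE.exists_retract
    have := hd.inj
    rw [extVanish_one_iff p hp]
    intro f
    let f' : LinearMap.ker p →ₗ[R] I := Submodule.subtype _ ∘ₗ i ∘ₗ f
    obtain ⟨G, hG⟩ := exists_extend_of_injective (A := LinearMap.ker p) (B := M →₀ R) (C := I)
      (LinearMap.ker p).subtype Subtype.val_injective f'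
    have hG' : ∀ x : LinearMap.ker p, G x = i (f x) := hG
    obtain ⟨φ, hφ⟩ := exists_factor_of_surjective p hp (toKer d hd.exact ∘ₗ G) (by
      intro x hx
      apply Subtype.ext
      simp [hG' ⟨x, hx⟩])
    obtain ⟨g, hg⟩ := h I d hd φ
    refine ⟨r ∘ₗ (G - g ∘ₗ p).codRestrict _ (fun x => ?_), fun x => ?_⟩
    · have := congrArg Subtype.val (hφ x)
      simp [hg, this]
    · rw [LinearMap.comp_apply, ← hir (f x)]
      congr 1
      apply Subtype.ext
      have := hG' x
      simp [this]

end Ext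

section ChainExtension

variable {M N : Type u} [AddCommGroup M] [Module R M] [AddCommGroup N] [Module R N]

/-- The supremum of a directed set of partial linear maps satisfying a pointwise condition
satisfies it as well. -/
theorem LinearPMap.sSup_induction {c : Set (M →ₗ.[R] N)} (hc : DirectedOn (· ≤ ·) c)
    (G : M → N → Prop) (h00 : G 0 0) (h : ∀ f ∈ c, ∀ x : f.domain, G x (f x))
    (x : (LinearPMap.sSup c hc).domain) : G x (LinearPMap.sSup c hc x) := by
  rcases c.eq_empty_or_nonempty with rfl | hne
  · have hx : x = 0 := by
      have hdom : (LinearPMap.sSup ∅ hc).domain = ⊥ := by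
        rw [LinearPMap.domain_sSup]
        simp
      exact Subtype.ext ((Submodule.mem_bot R).1 (hdom ▸ x.2))
    rw [hx, LinearPMap.map_zero]
    exact h00
  · obtain ⟨f, hf, hxf⟩ := (LinearPMap.mem_domain_sSup_iff hne hc).1 x.2
    have := (LinearPMap.le_sSup hc hf).2 (x := ⟨x, hxf⟩) (y := x) rfl
    rw [← this]
    exact h f hf ⟨x, hxf⟩

/-- A linear map with a pointwise prescribed property can be constructed on the union of a well
ordered chain of submodules by extending from the earlier members of the chain. -/
theorem exists_linearMap_iSup {ι : Type*} [LinearOrder ι] [WellFoundedLT ι]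
    (K : ι → Submodule R M) (hK : Monotone K) (G : M → N → Prop) (h00 : G 0 0)
    (step : ∀ j, ∀ g : (⨆ i < j, K i : Submodule R M) →ₗ[R] N,
      (∀ x : (⨆ i < j, K i : Submodule R M), G x (g x)) →
      ∃ h : K j →ₗ[R] N, (∀ x : K j, G x (h x)) ∧
        ∀ x (hx : x ∈ ⨆ i < j, K i) (hx' : x ∈ K j), h ⟨x, hx'⟩ = g ⟨x, hx⟩) :
    ∃ h : (⨆ i, K i : Submodule R M) →ₗ[R] N, ∀ x : (⨆ i, K i : Submodule R M), G x (h x) := by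
  have step' : ∀ (j : ι) (g : M →ₗ.[R] N), g.domain = ⨆ i < j, K i →
      (∀ x : g.domain, G x (g x)) →
      ∃ h : M →ₗ.[R] N, g ≤ h ∧ h.domain = K j ∧ ∀ x : h.domain, G x (h x) := by
    rintro j ⟨D, g⟩ hD hg
    change D = _ at hD
    subst hD
    obtain ⟨h, hG, hext⟩ := step j g hg
    refine ⟨⟨K j, h⟩, ⟨iSup₂_le fun i hi => hK hi.le, fun x y hxy => ?_⟩, rfl, hG⟩
    obtain ⟨x, hx⟩ := x
    obtain ⟨y, hy⟩ := y
    obtain rfl : x = y := hxy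
    exact (hext x hx hy).symm
  let S : Set (M →ₗ.[R] N) := {f | (∀ x : f.domain, G x (f x)) ∧
    ∃ A : Set ι, f.domain = ⨆ i ∈ A, K i}
  obtain ⟨f, ⟨hfG, A, hA⟩, hmax⟩ : ∃ m, Maximal (· ∈ S) m := by
    refine zorn_le₀ S fun c hcS hc => ?_
    have hdir := hc.directedOn
    refine ⟨LinearPMap.sSup c hdir, ⟨?_, ?_⟩, fun z hz => LinearPMap.le_sSup hdir hz⟩
    · exact LinearPMap.sSup_induction hdir G h00 fun f hf => (hcS hf).1
    · choose! A hA using fun f (hf : f ∈ c) => (hcS hf).2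
      refine ⟨⋃ f ∈ c, A f, ?_⟩
      rw [LinearPMap.domain_sSup]
      apply le_antisymm
      · apply sSup_le
        rintro _ ⟨f, hf, rfl⟩
        rw [hA f hf]
        exact iSup₂_le fun i hi => le_iSup₂_of_le i (Set.mem_biUnion hf hi) le_rfl
      · refine iSup₂_le fun i hi => ?_
        obtain ⟨f, hf, hif⟩ := Set.mem_iUnion₂.1 hi
        refine le_trans ?_ (le_sSup ⟨f, hf, rfl⟩)
        rw [hA f hf]
        exact le_iSup₂_of_le i hif le_rfl
  have htop : f.domain = ⨆ i, K i := by
    apply le_antisymm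
    · rw [hA]
      exact iSup₂_le fun i _ => le_iSup K i
    · by_contra hcon
      have hne : {j | ¬ K j ≤ f.domain}.Nonempty := by
        by_contra hemp
        refine hcon (iSup_le fun j => ?_)
        by_contra hj
        exact hemp ⟨j, hj⟩
      let j := wellFounded_lt.min _ hne
      have hj : ¬ K j ≤ f.domain := wellFounded_lt.min_mem _ hne
      have hlt : ∀ i < j, K i ≤ f.domain := fun i hi => by
        by_contra h
        exact wellFounded_lt.not_lt_min {j | ¬ K j ≤ f.domain} h hi
      have hdom : f.domain = ⨆ i < j, K i := by
        apply le_antisymm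
        · rw [hA]
          refine iSup₂_le fun i hi => ?_
          have hij : i < j := by
            by_contra h
            refine hj ((hK (not_lt.1 h)).trans ?_)
            rw [hA]
            exact le_iSup₂_of_le i hi le_rfl
          exact le_iSup₂_of_le i hij le_rfl
        · exact iSup₂_le hlt
      obtain ⟨h, hle, hdomh, hG⟩ := step' j f hdom hfG
      exact hj (hdomh ▸ (hmax (y := h) ⟨hG, {j}, by simp [hdomh]⟩ hle).1)
  clear hmax hA
  obtain ⟨D, f⟩ := f
  change D = _ at htop
  subst htop
  exact ⟨f, hfG⟩

end ChainExtension

/-- The modules in the right orthogonal of the Gorenstein projectives are those in the left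
orthogonal of the Gorenstein injectives. -/
def VirtuallyGorenstein (R : Type u) [CommRing R] : Prop :=
  ∀ (M : Type u) [AddCommGroup M] [Module R M], GPTrivial R M ↔ GITrivial R M

section WellOrderedUnion

variable {A B C : Type u} [AddCommGroup A] [Module R A] [AddCommGroup B] [Module R B]
  [AddCommGroup C] [Module R C]

theorem GITrivial.exists_lift_extend (hC : GITrivial R C) (i : A →ₗ[R] B) (p : B →ₗ[R] C)
    (hi : Function.Injective i) (hp : Function.Surjective p) (h : Function.Exact i p)
    {I : Type u} [AddCommGroup I] [Module R I] {d : I →ₗ[R] I} (hd : IsSGI d)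
    (φ : B →ₗ[R] LinearMap.ker d) (σ : A →ₗ[R] I) (hσ : ∀ a, d (σ a) = φ (i a)) :
    ∃ τ : B →ₗ[R] I, (∀ b, d (τ b) = φ b) ∧ ∀ a, τ (i a) = σ a := by
  have := hd.inj
  obtain ⟨τ, hτ⟩ := exists_extend_of_injective i hi σ
  obtain ⟨v, hv⟩ := exists_factor_of_surjective p hp (φ - toKer d hd.exact ∘ₗ τ) (by
    intro b hb
    obtain ⟨a, rfl⟩ := (h b).1 hb
    apply Subtype.ext
    simp [hτ, hσ])
  obtain ⟨w, hw⟩ := hC I d hd v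
  refine ⟨τ + w ∘ₗ p, fun b => ?_, fun a => ?_⟩
  · simp [hw, hv]
  · simp [hτ, h.apply_apply_eq_zero]

theorem GPTrivial.quotient_of_le {K L : Submodule R A} (hK : GPTrivial R K) (hL : GPTrivial R L)
    (h : K ≤ L) : GPTrivial R (L ⧸ K.submoduleOf L) :=
  hL.quotient _ (hK.of_equiv (Submodule.submoduleOfEquivOfLe h))

theorem GPTrivial.iSup_aux (hVG : VirtuallyGorenstein R) {ι : Type*} [LinearOrder ι]
    [WellFoundedLT ι] (K : ι → Submodule R A) (hK : Monotone K)
    (hlt : ∀ j, GPTrivial R (⨆ i < j, K i : Submodule R A)) (h : ∀ j, GPTrivial R (K j)) :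
    GPTrivial R (⨆ i, K i : Submodule R A) := by
  rw [hVG]
  intro I _ _ d hd φ
  have key : ∃ g : (⨆ i, K i : Submodule R A) →ₗ[R] I, ∀ x : (⨆ i, K i : Submodule R A),
      ∀ hx : x.1 ∈ ⨆ i, K i, d (g x) = φ ⟨x, hx⟩ := by
    refine exists_linearMap_iSup K hK (fun x y => ∀ hx : x ∈ ⨆ i, K i, d y = φ ⟨x, hx⟩)
      (fun hx => ?_) (fun j σ hσ => ?_)
    · rw [map_zero]
      exact (congrArg Subtype.val (map_zero φ)).symm
    have hle : (⨆ i < j, K i) ≤ K j := iSup₂_le fun i hi => hK hi.le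
    have hle' : K j ≤ ⨆ i, K i := le_iSup K j
    have hC := (hVG _).1 ((hlt j).quotient_of_le (h j) hle)
    obtain ⟨τ, h1, h2⟩ := hC.exists_lift_extend (Submodule.inclusion hle) (Submodule.mkQ _)
      (Submodule.inclusion_injective hle) (Submodule.mkQ_surjective _)
      (by
        intro x
        refine (Submodule.Quotient.mk_eq_zero _).trans ?_
        constructor
        · intro hx
          exact ⟨⟨x, hx⟩, rfl⟩
        · rintro ⟨y, rfl⟩
          exact y.2) hd (φ ∘ₗ Submodule.inclusion hle') σ
      (fun a => hσ a (hle' (hle a.2)))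
    exact ⟨τ, fun x hx => h1 x, fun x hx hx' => h2 ⟨x, hx⟩⟩
  obtain ⟨g, hg⟩ := key
  exact ⟨g, fun x => hg x x.2⟩

theorem GPTrivial.iSup (hVG : VirtuallyGorenstein R) {ι : Type*} [LinearOrder ι]
    [WellFoundedLT ι] (K : ι → Submodule R A) (hK : Monotone K) (h : ∀ j, GPTrivial R (K j)) :
    GPTrivial R (⨆ i, K i : Submodule R A) := by
  refine GPTrivial.iSup_aux hVG K hK (fun j => ?_) h
  induction j using WellFoundedLT.induction with
  | ind j ih =>
    have := GPTrivial.iSup_aux hVG (fun i : Set.Iio j => K i) (fun a b hab => hK hab)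
      (fun k => ?_) (fun i => h i)
    · rwa [iSup_subtype] at this
    · have hk := ih k k.2
      have heq : (⨆ i < k, K i.1) = ⨆ i < k.1, K i := by
        apply le_antisymm
        · exact iSup₂_le fun i hi => le_iSup₂_of_le i.1 hi le_rfl
        · exact iSup₂_le fun i hi => le_iSup₂_of_le (⟨i, lt_trans hi k.2⟩ : Set.Iio j) hi le_rfl
      exact heq ▸ hk

end WellOrderedUnion

section FinitaryClosure

variable {X : Type u}

/-- `S` is closed under the finitary operation `c`. -/
def IsClosedUnder (c : Finset X → Finset X) (S : Set X) : Prop :=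
  ∀ Y : Finset X, Y.Nonempty → (Y : Set X) ⊆ S → (c Y : Set X) ⊆ S

variable {c : Finset X → Finset X}

theorem exists_isClosedUnder_mk_le (c : Finset X → Finset X) (A : Set X) :
    ∃ S, A ⊆ S ∧ IsClosedUnder c S ∧ Cardinal.mk S ≤ max Cardinal.aleph0 (Cardinal.mk A) := by
  classical
  let step : Set X → Set X := fun A => A ∪ ⋃ l : List A, c (l.map Subtype.val).toFinset
  have hcard : ∀ B : Set X, Cardinal.mk B ≤ max Cardinal.aleph0 (Cardinal.mk A) →
      Cardinal.mk (step B) ≤ max Cardinal.aleph0 (Cardinal.mk A) := by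
    intro B hB
    refine (Cardinal.mk_union_le _ _).trans (Cardinal.add_le_of_le (le_max_left _ _) hB ?_)
    refine (Cardinal.mk_iUnion_le _).trans (Cardinal.mul_le_of_le (le_max_left _ _) ?_ ?_)
    · exact (Cardinal.mk_list_le_max _).trans (max_le (le_max_left _ _) hB)
    · refine (ciSup_le' fun l => ?_).trans (le_max_left _ _)
      exact (Cardinal.lt_aleph0_of_finite _).le
  have hmono : Monotone fun n => step^[n] A := by
    refine monotone_nat_of_le_succ fun n => ?_
    rw [Function.iterate_succ_apply']
    exact Set.subset_union_left
  refine ⟨⋃ n, step^[n] A, Set.subset_iUnion (fun n => step^[n] A) 0, fun Y _ hY => ?_, ?_⟩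
  · obtain ⟨n, hn⟩ : ∃ n, (Y : Set X) ⊆ step^[n] A :=
      Directed.exists_mem_subset_of_finset_subset_biUnion hmono.directed_le hY
    refine subset_trans ?_ (Set.subset_iUnion _ (n + 1))
    rw [Function.iterate_succ_apply']
    refine subset_trans ?_ Set.subset_union_right
    refine subset_trans ?_ (Set.subset_iUnion _ (Y.toList.attach.map fun y =>
      ⟨y.1, hn (Finset.mem_coe.2 (Finset.mem_toList.1 y.2))⟩))
    refine (congrArg (fun Z => ((c Z : Finset X) : Set X)) ?_).le
    ext x
    simp
  · have hn : ∀ n, Cardinal.mk (step^[n] A) ≤ max Cardinal.aleph0 (Cardinal.mk A) := by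
      intro n
      induction n with
      | zero => exact le_max_right _ _
      | succ n ih =>
        rw [Function.iterate_succ_apply']
        exact hcard _ ih
    have := Cardinal.mk_iUnion_le_lift fun n => step^[n] A
    rw [Cardinal.lift_uzero, Cardinal.mk_nat, Cardinal.lift_aleph0] at this
    refine this.trans (Cardinal.mul_le_of_le (le_max_left _ _) (le_max_left _ _)
      (ciSup_le' fun n => ?_))
    rw [Cardinal.lift_uzero]
    exact hn n

theorem exists_monotone_of_countable {S : Set X} (hS : IsClosedUnder c S) (hc : S.Countable)
    (hne : S.Nonempty) : ∃ b : ℕ → Finset X, Monotone b ∧ (∀ n, (b n).Nonempty) ∧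
      (∀ n, c (b n) ⊆ b (n + 1)) ∧ ⋃ n, (b n : Set X) = S := by
  classical
  obtain ⟨e, rfl⟩ := hc.exists_eq_range hne
  let b : ℕ → Finset X := fun n => Nat.rec {e 0} (fun n b => insert (e n) (b ∪ c b)) n
  have hb : ∀ n, b (n + 1) = insert (e n) (b n ∪ c (b n)) := fun n => rfl
  have hmono : Monotone b := monotone_nat_of_le_succ fun n => by
    rw [hb]
    exact Finset.subset_union_left.trans (Finset.subset_insert _ _)
  have hne' : ∀ n, (b n).Nonempty := fun n =>
    ⟨e 0, hmono (Nat.zero_le n) (Finset.mem_singleton_self _)⟩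
  refine ⟨b, hmono, hne', fun n => ?_, ?_⟩
  · rw [hb]
    exact Finset.subset_union_right.trans (Finset.subset_insert _ _)
  · apply subset_antisymm
    · refine Set.iUnion_subset fun n => ?_
      induction n with
      | zero => simp [b]
      | succ n ih =>
        rw [hb]
        simp only [Finset.coe_insert, Finset.coe_union]
        exact Set.insert_subset ⟨n, rfl⟩ (Set.union_subset ih (hS _ (hne' n) ih))
    · rintro _ ⟨n, rfl⟩
      refine Set.mem_iUnion.2 ⟨n + 1, ?_⟩
      rw [hb]
      simp

/-- A property of closed sets holds if it holds for the countable ones and is preserved by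
unions of well ordered chains. -/
theorem IsClosedUnder.induction (P : Set X → Prop)
    (hcount : ∀ S, IsClosedUnder c S → S.Countable → P S)
    (hchain : ∀ (ι : Type u) [LinearOrder ι] [WellFoundedLT ι] (S : ι → Set X), Monotone S →
      (∀ i, IsClosedUnder c (S i)) → (∀ i, P (S i)) → (∀ j, P (⋃ i < j, S i)) → P (⋃ i, S i))
    {S : Set X} (hS : IsClosedUnder c S) : P S := by
  induction hκ : Cardinal.mk S using WellFoundedLT.induction generalizing S with
  | ind κ ih =>
  by_cases hκ0 : κ ≤ Cardinal.aleph0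
  · exact hcount S hS (Cardinal.le_aleph0_iff_set_countable.1 (hκ ▸ hκ0))
  push Not at hκ0
  obtain ⟨e⟩ : Nonempty (κ.ord.ToType ≃ S) := Cardinal.eq.1 (by rw [Cardinal.mk_ord_toType, hκ])
  let T : κ.ord.ToType → Set X := fun i =>
    ⋂₀ {B | IsClosedUnder c B ∧ (fun j => (e j : X)) '' Set.Iic i ⊆ B}
  have hT : ∀ i, IsClosedUnder c (T i) := fun i Y hne hY =>
    Set.subset_sInter fun B hB => hB.1 Y hne (hY.trans (Set.sInter_subset_of_mem hB))
  have hmono : Monotone T := fun i j hij => Set.subset_sInter fun B hB =>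
    Set.sInter_subset_of_mem ⟨hB.1, (Set.image_mono (Set.Iic_subset_Iic.2 hij)).trans hB.2⟩
  have hU : ⋃ i, T i = S := by
    apply subset_antisymm
    · refine Set.iUnion_subset fun i => Set.sInter_subset_of_mem ⟨hS, ?_⟩
      rintro _ ⟨j, -, rfl⟩
      exact (e j).2
    · intro x hx
      refine Set.mem_iUnion.2 ⟨e.symm ⟨x, hx⟩, Set.mem_sInter.2 fun B hB => ?_⟩
      exact hB.2 ⟨e.symm ⟨x, hx⟩, Set.mem_Iic.2 le_rfl, by simp⟩
  rw [← hU]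
  have hP : ∀ i, P (T i) := fun i => ih _ ?_ (hT i) rfl
  · refine hchain _ T hmono hT hP fun j => ?_
    induction j using WellFoundedLT.induction with
    | ind j ihj =>
      have := hchain (Set.Iio j) (fun i => T i) (fun a b hab => hmono hab) (fun i => hT i)
        (fun i => hP i) (fun k => ?_)
      · rwa [Set.iUnion_subtype] at this
      · have heq : (⋃ i < k, T i.1) = ⋃ i < k.1, T i := by
          apply subset_antisymm
          · exact Set.iUnion₂_subset fun i hi => Set.subset_iUnion₂_of_subset i.1 hi subset_rfl
          · exact Set.iUnion₂_subset fun i hi => Set.subset_iUnion₂_of_subset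
              (⟨i, lt_trans hi k.2⟩ : Set.Iio j) hi subset_rfl
        exact heq ▸ ihj k k.2
  obtain ⟨B, h1, h2, h3⟩ := exists_isClosedUnder_mk_le c ((fun j => (e j : X)) '' Set.Iic i)
  have hTB : T i ⊆ B := Set.sInter_subset_of_mem ⟨h2, h1⟩
  refine (Cardinal.mk_le_mk_of_subset hTB).trans_lt
    (h3.trans_lt (max_lt hκ0 (lt_of_le_of_lt Cardinal.mk_image_le ?_)))
  have := Cardinal.mk_Iic_lt i (by rw [Cardinal.mk_ord_toType, Ordinal.type_toType])
    (by rw [Cardinal.mk_ord_toType]; exact hκ0.le)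
  rwa [Cardinal.mk_ord_toType] at this

end FinitaryClosure

section LocallyProjective

/-- A module with a sequence of compatible endomorphisms factoring through a projective module
which eventually fix every element is projective. -/
theorem projective_of_eventually_fixed {A L : Type u} [AddCommGroup A] [Module R A]
    [AddCommGroup L] [Module R L] [Module.Projective R L] (i : A →ₗ[R] L) (ψ : ℕ → L →ₗ[R] A)
    (h0 : ψ 0 = 0) (hs : ∀ n x, ψ (n + 1) (i (ψ n x)) = ψ n x)
    (hfix : ∀ a, ∃ m, ∀ n, m ≤ n → ψ n (i a) = a) : Module.Projective R A := by
  classical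
  choose m hm using hfix
  have hs' : ∀ a n, n ∉ Finset.range (m a) → i a - i (ψ n (i a)) = 0 := fun a n hn => by
    rw [hm a n (not_lt.1 (Finset.mem_range.not.1 hn)), sub_self]
  let s : A →ₗ[R] (ℕ →₀ L) :=
    { toFun := fun a => Finsupp.onFinset (Finset.range (m a)) (fun n => i a - i (ψ n (i a)))
        fun n hn => by
          by_contra h
          exact hn (hs' a n h)
      map_add' := fun a b => by
        ext n
        simp only [Finsupp.onFinset_apply, Finsupp.add_apply, map_add]
        abel
      map_smul' := fun r a => by
        ext n
        simp [smul_sub] }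
  have : Module.Projective R (ℕ →₀ L) :=
    Module.Projective.of_equiv (finsuppLequivDFinsupp (M := L) (ι := ℕ) R).symm
  refine Module.Projective.of_split s (Finsupp.lsum ℕ fun n => ψ (n + 1)) (LinearMap.ext fun a => ?_)
  have h1 : Finsupp.lsum ℕ (fun n => ψ (n + 1)) (s a) =
      ∑ n ∈ Finset.range (m a), ψ (n + 1) (i a - i (ψ n (i a))) := by
    rw [Finsupp.lsum_apply]
    exact Finsupp.onFinset_sum (fun n hn => by_contra fun h => hn (hs' a n h)) fun n => map_zero _
  rw [LinearMap.comp_apply, h1, LinearMap.id_apply]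
  simp only [map_sub, hs]
  rw [Finset.sum_range_sub (fun n => ψ n (i a)), hm a _ le_rfl, h0]
  simp

variable {L : Type u} [AddCommGroup L] [Module R L]

/-- A submodule of a projective module, every finite subset of which is fixed by a finite rank
retraction, is trivial. -/
theorem GPTrivial.of_local_retracts (hVG : VirtuallyGorenstein R) [Module.Projective R L]
    (K : Submodule R L) (H : ∀ Y : Finset K, ∃ φ : L →ₗ[R] K, (∀ y ∈ Y, φ y = y) ∧
      (LinearMap.range φ).FG) : GPTrivial R K := by
  choose φ hφ c hc using H
  have key : ∀ S : Set K, IsClosedUnder c S → GPTrivial R (Submodule.span R S) := by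
    intro S hS
    refine hS.induction (fun S => GPTrivial R (Submodule.span R S)) (fun S hS hcount => ?_)
      (fun ι _ _ S hmono _ h _ => ?_)
    · rcases S.eq_empty_or_nonempty with rfl | hne
      · rw [Submodule.span_empty]
        exact GPTrivial.of_subsingleton
      obtain ⟨b, hb, hbne, hcb, hbS⟩ := exists_monotone_of_countable hS hcount hne
      have hbS' : ∀ n, (b n : Set K) ⊆ S := fun n => hbS ▸ Set.subset_iUnion (fun n => (b n : Set K)) n
      have hfix : ∀ n x, x ∈ Submodule.span R (b n : Set K) → φ (b n) x = x := by
        intro n x hx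
        induction hx using Submodule.span_induction with
        | mem y hy => exact hφ _ y hy
        | zero => simp
        | add x y _ _ h1 h2 => simp [h1, h2]
        | smul r x _ h1 => simp [h1]
      have hrange : ∀ n x, φ (b n) x ∈ Submodule.span R (b (n + 1) : Set K) := fun n x =>
        Submodule.span_mono (hcb n) (by rw [hc]; exact ⟨x, rfl⟩)
      let θ : ℕ → L →ₗ[R] Submodule.span R S := fun n =>
        (φ (b n)).codRestrict _ fun x => Submodule.span_mono (hbS' _) (hrange n x)
      refine @GPTrivial.of_projective R _ _ _ _ (projective_of_eventually_fixed
        (K.subtype ∘ₗ (Submodule.span R S).subtype) (fun n => Nat.rec 0 (fun n _ => θ n) n) rfl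
        (fun n x => ?_) (fun a => ?_))
      · cases n with
        | zero => simp
        | succ n => exact Subtype.ext (hfix (n + 1) _ (hrange n x))
      · have ha : (a : K) ∈ ⨆ n, Submodule.span R (b n : Set K) := by
          rw [← Submodule.span_iUnion, hbS]
          exact a.2
        rw [Submodule.mem_iSup_of_directed _ (Monotone.directed_le fun m n h =>
          Submodule.span_mono (hb h))] at ha
        obtain ⟨m, hm⟩ := ha
        refine ⟨m + 1, fun n hn => ?_⟩
        obtain ⟨n, rfl⟩ : ∃ k, n = k + 1 := ⟨n - 1, by omega⟩
        exact Subtype.ext (hfix n _ (Submodule.span_mono (hb (by omega)) hm))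
    · rw [Submodule.span_iUnion]
      exact GPTrivial.iSup hVG _ (fun i j hij => Submodule.span_mono (hmono hij)) h
  have := key Set.univ fun _ _ _ => Set.subset_univ _
  rw [Submodule.span_univ] at this
  exact this.of_equiv Submodule.topEquiv.symm

end LocallyProjective

/-- Finite sets of relations of a flat module are fixed by finite rank retractions. -/
theorem Module.Flat.exists_local_retract [IsNoetherianRing R] {F : Type u} [AddCommGroup F] [Module R F]
    [Module.Flat R F] (Y : Finset (LinearMap.ker (Finsupp.linearCombination R (id : F → F)))) :
    ∃ φ : (F →₀ R) →ₗ[R] LinearMap.ker (Finsupp.linearCombination R (id : F → F)),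
      (∀ y ∈ Y, φ y = y) ∧ (LinearMap.range φ).FG := by
  classical
  let π := Finsupp.linearCombination R (id : F → F)
  let b : Finset F := Y.biUnion fun y => y.1.support
  let ι : (b →₀ R) →ₗ[R] (F →₀ R) := Finsupp.lmapDomain R R Subtype.val
  let ρ : (F →₀ R) →ₗ[R] (b →₀ R) := Finsupp.lcomapDomain Subtype.val Subtype.val_injective
  have hιρ : ∀ y ∈ Y, ι (ρ y) = y := by
    intro y hy
    refine Finsupp.mapDomain_comapDomain _ Subtype.val_injective _ fun x hx => ?_
    exact ⟨⟨x, Finset.mem_biUnion.2 ⟨y, hy, hx⟩⟩, rfl⟩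
  let f : (Y →₀ R) →ₗ[R] (b →₀ R) := Finsupp.linearCombination R fun y : Y => ρ y
  have hf : (π ∘ₗ ι) ∘ₗ f = 0 := by
    refine Finsupp.lhom_ext' fun y => LinearMap.ext_ring ?_
    simp only [f, LinearMap.comp_apply, Finsupp.lsingle_apply, Finsupp.linearCombination_single,
      one_smul, LinearMap.zero_apply]
    rw [hιρ y y.2]
    exact y.1.2
  obtain ⟨k, a, y, h1, h2⟩ := Module.Flat.exists_factorization_of_comp_eq_zero_of_free hf
  obtain ⟨z, hz⟩ := exists_lift_of_projective π (linearCombination_id_surjective F) y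
  refine ⟨((ι - z ∘ₗ a).codRestrict (LinearMap.ker π) fun x => ?_) ∘ₗ ρ, fun x hx => ?_, ?_⟩
  · have := LinearMap.congr_fun h1 x
    simp only [LinearMap.comp_apply] at this
    rw [LinearMap.mem_ker, LinearMap.sub_apply, map_sub, LinearMap.comp_apply, this, hz, sub_self]
  · have : a (ρ x) = 0 := by
      have := LinearMap.congr_fun h2 (Finsupp.single ⟨x, hx⟩ 1)
      simpa [f] using this
    apply Subtype.ext
    simp [this, hιρ x hx]
  · rw [LinearMap.range_comp]
    exact (IsNoetherian.noetherian _).map _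

theorem GPTrivial.of_flat [IsNoetherianRing R] (hVG : VirtuallyGorenstein R) (F : Type u) [AddCommGroup F] [Module R F]
    [Module.Flat R F] : GPTrivial R F :=
  (GPTrivial.of_local_retracts hVG _ Module.Flat.exists_local_retract).cokernel
    GPTrivial.of_projective (Submodule.subtype _) _ Subtype.val_injective
    (linearCombination_id_surjective F) (LinearMap.exact_subtype_ker_map _)

section ReducedProduct

variable {ι : Type u} [SemilatticeSup ι] (F : ι → Type u) [∀ i, AddCommGroup (F i)]
  [∀ i, Module R (F i)]

/-- The families which vanish eventually. -/
def eventuallyZero (R : Type u) [CommRing R] {ι : Type u} [SemilatticeSup ι] (F : ι → Type u)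
    [∀ i, AddCommGroup (F i)] [∀ i, Module R (F i)] : Submodule R (∀ i, F i) where
  carrier := {y | ∀ᶠ i in Filter.atTop, y i = 0}
  add_mem' := fun {x y} hx hy => by
    filter_upwards [hx, hy] with i h1 h2
    simp [h1, h2]
  zero_mem' := Filter.Eventually.of_forall fun _ => rfl
  smul_mem' := fun r x hx => by
    filter_upwards [hx] with i h1
    simp [h1]

theorem mem_eventuallyZero {y : ∀ i, F i} :
    y ∈ eventuallyZero R F ↔ ∀ᶠ i in Filter.atTop, y i = 0 := Iff.rfl

/-- Over a Noetherian ring, a relation in flat modules is trivial with coefficients depending only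
on the relation. -/
theorem exists_uniform_trivialRelation [IsNoetherianRing R] {l : ℕ} (f : Fin l → R) :
    ∃ (m : ℕ) (g : Fin m → Fin l → R), (∀ j, ∑ i, f i * g j i = 0) ∧
      ∀ (M : Type u) [AddCommGroup M] [Module R M] [Module.Flat R M] (y : Fin l → M),
        ∑ i, f i • y i = 0 → ∃ z : Fin m → M, ∀ i, y i = ∑ j, g j i • z j := by
  obtain ⟨m, g, hg⟩ := Submodule.fg_iff_exists_fin_generating_family.1
    (IsNoetherian.noetherian (LinearMap.ker (Fintype.linearCombination R f)))
  refine ⟨m, g, fun j => ?_, fun M _ _ _ y hy => ?_⟩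
  · have : g j ∈ LinearMap.ker (Fintype.linearCombination R f) :=
      hg ▸ Submodule.subset_span ⟨j, rfl⟩
    rw [LinearMap.mem_ker, Fintype.linearCombination_apply] at this
    rw [← this]
    exact Finset.sum_congr rfl fun i _ => by rw [smul_eq_mul, mul_comm]
  · obtain ⟨k, a, w, h1, h2⟩ := Module.Flat.iff_forall_isTrivialRelation.1 ‹_› hy
    have h3 : ∀ j, ∃ c : Fin m → R, ∑ t, c t • g t = fun i => a i j := fun j => by
      rw [← Submodule.mem_span_range_iff_exists_fun, hg, LinearMap.mem_ker,
        Fintype.linearCombination_apply, ← h2 j]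
      exact Finset.sum_congr rfl fun i _ => by rw [smul_eq_mul, mul_comm]
    choose c hc using h3
    refine ⟨fun t => ∑ j, c j t • w j, fun i => ?_⟩
    rw [h1]
    simp only [Finset.smul_sum, smul_smul]
    rw [Finset.sum_comm]
    refine Finset.sum_congr rfl fun j _ => ?_
    rw [← congrFun (hc j) i, Finset.sum_apply, Finset.sum_smul]
    exact Finset.sum_congr rfl fun t _ => by simp [mul_comm]

theorem flat_quotient_eventuallyZero [IsNoetherianRing R] [∀ i, Module.Flat R (F i)] :
    Module.Flat R ((∀ i, F i) ⧸ eventuallyZero R F) := by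
  classical
  rw [Module.Flat.iff_forall_isTrivialRelation]
  intro l f x hx
  obtain ⟨m, g, hg, hz⟩ := exists_uniform_trivialRelation f
  choose y hy using fun i => (eventuallyZero R F).mkQ_surjective (x i)
  have hev : ∀ᶠ b in Filter.atTop, ∑ i, f i • y i b = 0 := by
    have : ∑ i, f i • y i ∈ eventuallyZero R F := by
      rw [← Submodule.ker_mkQ (eventuallyZero R F), LinearMap.mem_ker, map_sum, ← hx]
      exact Finset.sum_congr rfl fun i _ => by rw [map_smul, hy]
    filter_upwards [(mem_eventuallyZero F).1 this] with b hb
    simpa using hb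
  have hz' : ∀ b, ∃ z : Fin m → F b, ∑ i, f i • y i b = 0 → ∀ i, y i b = ∑ j, g j i • z j := by
    intro b
    by_cases h : ∑ i, f i • y i b = 0
    · obtain ⟨z, h1⟩ := hz (F b) (fun i => y i b) h
      exact ⟨z, fun _ => h1⟩
    · exact ⟨0, fun h' => absurd h' h⟩
  choose z hz' using hz'
  refine ⟨m, fun i j => g j i, fun j => (eventuallyZero R F).mkQ fun b => z b j, fun i => ?_, hg⟩
  rw [← hy i, ← sub_eq_zero]
  simp only [← map_smul, ← map_sum, ← map_sub]
  rw [← LinearMap.mem_ker, Submodule.ker_mkQ, mem_eventuallyZero]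
  filter_upwards [hev] with b hb
  simp [hz' b hb i]

end ReducedProduct

section Extension

variable {P : Type u} [AddCommGroup P] [Module R P]

/-- Every map from `N` to `w` extends to the ambient module. -/
def Submodule.ExtendsTo (N : Submodule R P) (w : Type u) [AddCommGroup w] [Module R w] : Prop :=
  ∀ f : N →ₗ[R] w, ∃ g : P →ₗ[R] w, ∀ x : N, g x = f x

/-- For a directed family of finitely generated submodules exhausting the cycles, restrictions of
maps into projective modules extend. -/
theorem IsSGP.exists_index_extend [IsNoetherianRing R] (hVG : VirtuallyGorenstein R)
    {d : P →ₗ[R] P} (hd : IsSGP d) {ι : Type u} [SemilatticeSup ι] (N : ι → Submodule R P)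
    (hN : Monotone N) (hfg : ∀ i, (N i).FG)
    (hle : ∀ i, N i ≤ LinearMap.ker d) (hsup : ∀ x, d x = 0 → ∃ i, x ∈ N i) (b : ι) :
    ∃ b', b ≤ b' ∧ ∀ (F : Type u) [AddCommGroup F] [Module R F] [Module.Projective R F]
      (h : N b' →ₗ[R] F), ∃ H : P →ₗ[R] F, ∀ x (_ : x ∈ N b) (hx' : x ∈ N b'),
        H x = h ⟨x, hx'⟩ := by
  classical
  by_contra hcon
  push Not at hcon
  choose F i1 i2 i3 h hbad using fun b' : Set.Ici b => hcon b' b'.2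
  have := hd.proj
  have hflat := flat_quotient_eventuallyZero (R := R) F
  let ν := (eventuallyZero R F).mkQ
  let y : P → ∀ b', F b' := fun x b' => if hx : x ∈ N b' then h b' ⟨x, hx⟩ else 0
  have hy : ∀ x, d x = 0 → ∀ᶠ b' in Filter.atTop, x ∈ N (b' : Set.Ici b) := by
    intro x hx
    obtain ⟨i, hi⟩ := hsup x hx
    filter_upwards [Filter.eventually_ge_atTop (⟨b ⊔ i, le_sup_left⟩ : Set.Ici b)] with b' hb'
    exact hN (le_sup_right.trans hb') hi
  let Φ : LinearMap.ker d →ₗ[R] ((∀ b', F b') ⧸ eventuallyZero R F) :=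
    { toFun := fun x => ν (y x)
      map_add' := fun x x' => by
        rw [← map_add, ← sub_eq_zero, ← map_sub, ← LinearMap.mem_ker, Submodule.ker_mkQ,
          mem_eventuallyZero]
        filter_upwards [hy x x.2, hy x' x'.2] with b' h1 h2
        have h3 := (N b').add_mem h1 h2
        simp only [y, Pi.sub_apply, Pi.add_apply, Submodule.coe_add, dif_pos h1, dif_pos h2,
          dif_pos h3, ← map_add, ← map_sub]
        rw [← map_zero (h b')]
        exact congrArg _ (Subtype.ext (by simp))
      map_smul' := fun r x => by
        rw [RingHom.id_apply, ← map_smul, ← sub_eq_zero, ← map_sub, ← LinearMap.mem_ker,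
          Submodule.ker_mkQ, mem_eventuallyZero]
        filter_upwards [hy x x.2] with b' h1
        have h3 := (N b').smul_mem r h1
        simp only [y, Pi.sub_apply, Pi.smul_apply, Submodule.coe_smul, dif_pos h1,
          dif_pos h3, ← map_smul, ← map_sub]
        rw [← map_zero (h b')]
        exact congrArg _ (Subtype.ext (by simp)) }
  obtain ⟨G, hG⟩ := GPTrivial.of_flat hVG _ P d hd Φ
  obtain ⟨Γ, hΓ⟩ := exists_lift_of_projective ν (eventuallyZero R F).mkQ_surjective G
  have hev : ∀ x, d x = 0 → ∀ᶠ b' in Filter.atTop, Γ x b' = y x b' := by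
    intro x hx
    have : Γ x - y x ∈ eventuallyZero R F := by
      rw [← Submodule.ker_mkQ (eventuallyZero R F), LinearMap.mem_ker, map_sub, sub_eq_zero]
      exact (hΓ x).trans (hG ⟨x, hx⟩)
    filter_upwards [(mem_eventuallyZero F).1 this] with b' hb'
    exact sub_eq_zero.1 hb'
  obtain ⟨t, ht⟩ := hfg b
  have htd : ∀ x ∈ t, d x = 0 := fun x hx => hle b (ht ▸ Submodule.subset_span hx)
  have hfin : ∀ᶠ b' : Set.Ici b in Filter.atTop, ∀ x ∈ t, Γ x b' = y x b' ∧ x ∈ N b' :=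
    (Filter.eventually_all_finset t).2 fun x hx => (hev x (htd x hx)).and (hy x (htd x hx))
  obtain ⟨b', hb'⟩ := hfin.exists
  obtain ⟨x, hx, hx', hne⟩ := hbad b' (LinearMap.proj b' ∘ₗ Γ)
  have key : ∃ hx' : x ∈ N b', Γ x b' = h b' ⟨x, hx'⟩ := by
    rw [← ht] at hx
    clear hne hx'
    induction hx using Submodule.span_induction with
    | mem x hx => exact ⟨(hb' x hx).2, (hb' x hx).1.trans (dif_pos _)⟩
    | zero => exact ⟨zero_mem _, by rw [map_zero]; exact (map_zero (h b')).symm⟩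
    | add x z _ _ h1 h2 =>
      obtain ⟨h1, h1'⟩ := h1
      obtain ⟨h2, h2'⟩ := h2
      refine ⟨add_mem h1 h2, ?_⟩
      rw [map_add, Pi.add_apply, h1', h2', ← map_add]
      rfl
    | smul r x _ h1 =>
      obtain ⟨h1, h1'⟩ := h1
      refine ⟨Submodule.smul_mem _ r h1, ?_⟩
      rw [map_smul, Pi.smul_apply, h1', ← map_smul]
      rfl
  exact hne key.2

end Extension

section Pieces

variable {P : Type u} [AddCommGroup P] [Module R P] {X : Type u}

/-- The elements of `P` whose coordinates are supported in `S`. -/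
noncomputable def coordSupported (s : P →ₗ[R] (X →₀ R)) (S : Set X) : Submodule R P :=
  (Finsupp.supported R R S).comap s

variable {s : P →ₗ[R] (X →₀ R)} {π : (X →₀ R) →ₗ[R] P}

theorem mem_coordSupported {S : Set X} {p : P} :
    p ∈ coordSupported s S ↔ ((s p).support : Set X) ⊆ S := Iff.rfl

theorem coordSupported_mono : Monotone (coordSupported s) := fun _ _ h _ hp =>
  (mem_coordSupported.1 hp).trans h

theorem coordSupported_fg [IsNoetherianRing R] (hs : ∀ p, π (s p) = p) (b : Finset X) :
    (coordSupported s (b : Set X)).FG := by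
  have : IsNoetherian R (Finsupp.supported R R (b : Set X)) :=
    isNoetherian_of_linearEquiv (Finsupp.supportedEquivFinsupp (M := R) (R := R) (b : Set X)).symm
  have h : IsNoetherian R (coordSupported s (b : Set X)) :=
    isNoetherian_of_injective (s.restrict (p := coordSupported s (b : Set X))
      (q := Finsupp.supported R R (b : Set X)) fun x hx => hx) (by
      intro x y hxy
      have : s x = s y := congrArg Subtype.val hxy
      exact Subtype.ext (by rw [← hs x, this, hs]))
  exact (Submodule.fg_top _).1 (IsNoetherian.noetherian _)

/-- The closure properties of a finitary operation on coordinates which ensure that closed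
sets of coordinates give rise to totally acyclic subcomplexes. -/
structure IsGoodClosure (d : P →ₗ[R] P) (s : P →ₗ[R] (X →₀ R)) (π : (X →₀ R) →ₗ[R] P)
    (c : Finset X → Finset X) : Prop where
  section_apply : ∀ p, π (s p) = p
  subset : ∀ b, b ⊆ c b
  proj_mem : ∀ (b : Finset X) y, y ∈ Finsupp.supported R R (b : Set X) →
    π y ∈ coordSupported s (c b : Set X)
  diff_mem : ∀ (b : Finset X) p, p ∈ coordSupported s (b : Set X) →
    d p ∈ coordSupported s (c b : Set X)
  exists_diff : ∀ (b : Finset X) p, p ∈ coordSupported s (b : Set X) → d p = 0 →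
    ∃ q ∈ coordSupported s (c b : Set X), d q = p
  extend : ∀ (b : Finset X) (F : Type u) [AddCommGroup F] [Module R F] [Module.Projective R F]
    (h : (LinearMap.ker d ⊓ coordSupported s (c b : Set X) : Submodule R P) →ₗ[R] F),
    ∃ H : P →ₗ[R] F, ∀ x (_ : x ∈ LinearMap.ker d ⊓ coordSupported s (b : Set X))
      (hx' : x ∈ LinearMap.ker d ⊓ coordSupported s (c b : Set X)), H x = h ⟨x, hx'⟩

theorem map_mem_of_supported {M : Type u} [AddCommGroup M] [Module R M] (f : (X →₀ R) →ₗ[R] M)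
    (N : Submodule R M) (S : Set X) (h : ∀ x ∈ S, f (Finsupp.single x 1) ∈ N) {y : X →₀ R}
    (hy : y ∈ Finsupp.supported R R S) : f y ∈ N := by
  rw [Finsupp.supported_eq_span_single] at hy
  induction hy using Submodule.span_induction with
  | mem y hy =>
    obtain ⟨x, hx, rfl⟩ := hy
    exact h x hx
  | zero => simp
  | add x y _ _ h1 h2 => simpa using add_mem h1 h2
  | smul r x _ h1 => simpa using N.smul_mem r h1

theorem exists_finset_mem_coordSupported (N : Submodule R P) (hN : N.FG) :
    ∃ t : Finset X, N ≤ coordSupported s (t : Set X) := by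
  classical
  obtain ⟨g, rfl⟩ := hN
  refine ⟨g.biUnion fun p => (s p).support, Submodule.span_le.2 fun p hp => ?_⟩
  exact Finset.coe_subset.2 (Finset.subset_biUnion_of_mem (fun p => (s p).support) hp)

theorem IsSGP.exists_isGoodClosure [IsNoetherianRing R] (hVG : VirtuallyGorenstein R)
    {d : P →ₗ[R] P} (hd : IsSGP d) (hs : ∀ p, π (s p) = p) : ∃ c, IsGoodClosure d s π c := by
  classical
  have hfg := fun b : Finset X => coordSupported_fg (b := b) hs
  have hmono : Monotone fun b : Finset X => coordSupported s (b : Set X) :=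
    fun _ _ h => coordSupported_mono (Finset.coe_subset.2 h)
  have hfg' : ∀ b : Finset X, (LinearMap.ker d ⊓ coordSupported s (b : Set X)).FG := fun b => by
    have : IsNoetherian R (coordSupported s (b : Set X)) :=
      isNoetherian_of_fg_of_noetherian _ (hfg b)
    exact Submodule.FG.of_le (hfg b) inf_le_right
  have h1 : ∀ b : Finset X, ∃ t : Finset X, ∀ y ∈ Finsupp.supported R R (b : Set X),
      π y ∈ coordSupported s (t : Set X) := fun b => by
    refine ⟨b.biUnion fun x => (s (π (Finsupp.single x 1))).support, fun y hy => ?_⟩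
    refine map_mem_of_supported π _ _ (fun x hx => ?_) hy
    exact Finset.coe_subset.2
      (Finset.subset_biUnion_of_mem (fun x => (s (π (Finsupp.single x 1))).support) hx)
  have h2 : ∀ b : Finset X, ∃ t : Finset X, ∀ p ∈ coordSupported s (b : Set X),
      d p ∈ coordSupported s (t : Set X) := fun b => by
    obtain ⟨t, ht⟩ := exists_finset_mem_coordSupported (s := s) _ ((hfg b).map d)
    exact ⟨t, fun p hp => ht ⟨p, hp, rfl⟩⟩
  have h3 : ∀ b : Finset X, ∃ t : Finset X, ∀ p ∈ coordSupported s (b : Set X), d p = 0 →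
      ∃ q ∈ coordSupported s (t : Set X), d q = p := fun b => by
    obtain ⟨g, hg⟩ := hfg' b
    have hg' : ∀ p ∈ g, ∃ q, d q = p := fun p hp =>
      exists_of_exact hd.exact (hg ▸ Submodule.subset_span hp :
        p ∈ LinearMap.ker d ⊓ coordSupported s (b : Set X)).1
    choose! q hq using hg'
    obtain ⟨t, ht⟩ := exists_finset_mem_coordSupported (s := s)
      (Submodule.span R (g.image q : Set P)) ⟨_, rfl⟩
    refine ⟨t, fun p hp hdp => ?_⟩
    have hp' : p ∈ Submodule.span R (g : Set P) := hg ▸ ⟨hdp, hp⟩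
    have : Submodule.span R (g : Set P) ≤ (coordSupported s (t : Set X)).map d :=
      Submodule.span_le.2 fun p hp => ⟨q p, ht (Submodule.subset_span
        (Finset.mem_coe.2 (Finset.mem_image_of_mem q hp))), hq p hp⟩
    exact this hp'
  have h4 := fun b : Finset X => hd.exists_index_extend hVG
    (fun b : Finset X => LinearMap.ker d ⊓ coordSupported s (b : Set X))
    (fun _ _ h => inf_le_inf_left _ (hmono h)) hfg' (fun _ => inf_le_left)
    (fun x hx => ⟨(s x).support, hx, mem_coordSupported.2 subset_rfl⟩) b
  choose t1 h1 using h1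
  choose t2 h2 using h2
  choose t3 h3 using h3
  choose t4 ht4 h4 using h4
  refine ⟨fun b => t1 b ∪ t2 b ∪ t3 b ∪ t4 b, hs, fun b => (ht4 b).trans Finset.subset_union_right,
    fun b y hy => hmono ?_ (h1 b y hy), fun b p hp => hmono ?_ (h2 b p hp),
    fun b p hp hdp => ?_, fun b F _ _ _ h => ?_⟩
  · intro x hx; simp [hx]
  · intro x hx; simp [hx]
  · obtain ⟨q, hq, rfl⟩ := h3 b p hp hdp
    exact ⟨q, hmono (fun x hx => by simp [hx]) hq, rfl⟩
  · have hle : LinearMap.ker d ⊓ coordSupported s (t4 b : Set X) ≤ LinearMap.ker d ⊓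
        coordSupported s ((t1 b ∪ t2 b ∪ t3 b ∪ t4 b : Finset X) : Set X) :=
      inf_le_inf_left _ (hmono Finset.subset_union_right)
    obtain ⟨H, hH⟩ := h4 b F (h ∘ₗ Submodule.inclusion hle)
    exact ⟨H, fun x hx hx' => hH x hx (inf_le_inf_left _ (hmono (ht4 b)) hx)⟩

end Pieces

section ClosedPieces

variable {P : Type u} [AddCommGroup P] [Module R P] {X : Type u} {d : P →ₗ[R] P}
  {s : P →ₗ[R] (X →₀ R)} {π : (X →₀ R) →ₗ[R] P} {c : Finset X → Finset X}

theorem mem_coordSupported_support (p : P) :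
    p ∈ coordSupported s ((s p).support : Set X) := mem_coordSupported.2 subset_rfl

theorem IsGoodClosure.eq_zero_or_subset (hc : IsGoodClosure d s π c) {S : Set X}
    (hS : IsClosedUnder c S) {p : P} (hp : p ∈ coordSupported s S) :
    p = 0 ∨ (c (s p).support : Set X) ⊆ S := by
  rcases (s p).support.eq_empty_or_nonempty with h | h
  · rw [Finsupp.support_eq_empty] at h
    exact Or.inl (by rw [← hc.section_apply p, h, map_zero])
  · exact Or.inr (hS _ h hp)

theorem IsGoodClosure.diff_mem_of_closed (hc : IsGoodClosure d s π c) {S : Set X}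
    (hS : IsClosedUnder c S) {p : P} (hp : p ∈ coordSupported s S) :
    d p ∈ coordSupported s S := by
  rcases hc.eq_zero_or_subset hS hp with rfl | h
  · simp
  · exact coordSupported_mono h (hc.diff_mem _ p (mem_coordSupported_support p))

theorem IsGoodClosure.exists_diff_of_closed (hc : IsGoodClosure d s π c) {S : Set X}
    (hS : IsClosedUnder c S) {p : P} (hp : p ∈ coordSupported s S) (hdp : d p = 0) :
    ∃ q ∈ coordSupported s S, d q = p := by
  rcases hc.eq_zero_or_subset hS hp with rfl | h
  · exact ⟨0, zero_mem _, map_zero d⟩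
  · obtain ⟨q, hq, rfl⟩ := hc.exists_diff _ p (mem_coordSupported_support p) hdp
    exact ⟨q, coordSupported_mono h hq, rfl⟩

theorem IsGoodClosure.proj_mem_of_closed (hc : IsGoodClosure d s π c) {S : Set X}
    (hS : IsClosedUnder c S) {y : X →₀ R} (hy : y ∈ Finsupp.supported R R S) :
    π y ∈ coordSupported s S := by
  rcases y.support.eq_empty_or_nonempty with h | h
  · rw [Finsupp.support_eq_empty] at h
    simp [h]
  · exact coordSupported_mono (hS _ h hy) (hc.proj_mem _ y ((Finsupp.mem_supported R y).2 subset_rfl))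

theorem IsGoodClosure.exists_retraction (hc : IsGoodClosure d s π c) {S : Set X}
    (hS : IsClosedUnder c S) :
    ∃ ρ : P →ₗ[R] coordSupported s S, ∀ p : coordSupported s S, ρ p = p := by
  classical
  refine ⟨(π ∘ₗ (Finsupp.supported R R S).subtype ∘ₗ Finsupp.restrictDom R R S ∘ₗ s).codRestrict _
    fun p => hc.proj_mem_of_closed hS (Subtype.property _), fun p => Subtype.ext ?_⟩
  have := LinearMap.congr_fun (Finsupp.restrictDom_comp_subtype (M := R) (R := R) S) ⟨s p, p.2⟩
  simp only [LinearMap.comp_apply, Submodule.subtype_apply, LinearMap.id_apply] at this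
  simp [this, hc.section_apply]

theorem IsGoodClosure.exists_factor_diff (hc : IsGoodClosure d s π c) {b : ℕ → Finset X}
    (hb : Monotone b) (hcb : ∀ n, c (b n) ⊆ b (n + 1)) (hdd : ∀ x, d (d x) = 0)
    {F : Type u} [AddCommGroup F] [Module R F] [Module.Projective R F] (n : ℕ) (g : P →ₗ[R] F)
    (hg : ∀ x ∈ LinearMap.ker d ⊓ coordSupported s (b (n + 3) : Set X), g x = 0) :
    ∃ U : P →ₗ[R] F, ∀ x ∈ coordSupported s (b n : Set X), U (d x) = g x := by
  have hV : ∀ k, coordSupported s (c (b k) : Set X) ≤ coordSupported s (b (k + 1) : Set X) :=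
    fun k => coordSupported_mono (Finset.coe_subset.2 (hcb k))
  let D := coordSupported s (b (n + 3) : Set X)
  obtain ⟨u, hu⟩ := exists_factor_of_surjective (d ∘ₗ D.subtype).rangeRestrict
    (LinearMap.surjective_rangeRestrict _) (g ∘ₗ D.subtype)
    (fun a ha => hg a ⟨congrArg Subtype.val ha, a.2⟩)
  have hle : LinearMap.ker d ⊓ coordSupported s (c (b (n + 1)) : Set X) ≤
      LinearMap.range (d ∘ₗ D.subtype) := by
    rintro x ⟨hx1, hx2⟩
    obtain ⟨q, hq, rfl⟩ := hc.exists_diff (b (n + 2)) x (hV _ hx2) hx1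
    exact ⟨⟨q, hV _ hq⟩, rfl⟩
  obtain ⟨U, hU⟩ := hc.extend (b (n + 1)) F (u ∘ₗ Submodule.inclusion hle)
  refine ⟨U, fun x hx => ?_⟩
  have h1 : d x ∈ LinearMap.ker d ⊓ coordSupported s (b (n + 1) : Set X) :=
    ⟨hdd x, hV _ (hc.diff_mem _ x hx)⟩
  rw [hU _ h1 ⟨h1.1, coordSupported_mono (Finset.coe_subset.2 (hc.subset _)) h1.2⟩]
  exact hu ⟨x, coordSupported_mono (Finset.coe_subset.2 (hb (by omega))) hx⟩

theorem IsGoodClosure.extendsTo_projective (hc : IsGoodClosure d s π c) {b : ℕ → Finset X}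
    (hb : Monotone b) (hcb : ∀ n, c (b n) ⊆ b (n + 1)) (hdd : ∀ x, d (d x) = 0)
    (F : Type u) [AddCommGroup F] [Module R F] [Module.Projective R F] :
    (LinearMap.ker d ⊓ coordSupported s (⋃ n, (b n : Set X))).ExtendsTo F := by
  classical
  intro f
  have hV : ∀ k, coordSupported s (c (b k) : Set X) ≤ coordSupported s (b (k + 1) : Set X) :=
    fun k => coordSupported_mono (Finset.coe_subset.2 (hcb k))
  have hVm : ∀ {m n}, m ≤ n → coordSupported s (b m : Set X) ≤ coordSupported s (b n : Set X) :=
    fun h => coordSupported_mono (Finset.coe_subset.2 (hb h))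
  have hVS : ∀ k, coordSupported s (b k : Set X) ≤ coordSupported s (⋃ n, (b n : Set X)) :=
    fun k => coordSupported_mono (Set.subset_iUnion (fun n => (b n : Set X)) k)
  have hh : ∀ n, ∃ h : P →ₗ[R] F, ∀ x (hx : x ∈ LinearMap.ker d ⊓ coordSupported s (b n : Set X)),
      h x = f ⟨x, hx.1, hVS n hx.2⟩ := fun n => by
    obtain ⟨h, hh⟩ := hc.extend (b n) F
      (f ∘ₗ Submodule.inclusion (inf_le_inf_left _ ((hV n).trans (hVS _))))
    exact ⟨h, fun x hx => hh x hx
      ⟨hx.1, coordSupported_mono (Finset.coe_subset.2 (hc.subset _)) hx.2⟩⟩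
  choose h hh using hh
  choose U hU using fun n => hc.exists_factor_diff hb hcb hdd n (h (n + 4) - h (n + 3)) (by
    intro x hx
    rw [LinearMap.sub_apply, hh (n + 3) x hx, hh (n + 4) x ⟨hx.1, hVm (by omega) hx.2⟩, sub_self])
  let H : ℕ → P →ₗ[R] F := fun n => h (n + 3) - ∑ k ∈ Finset.range n, U k ∘ₗ d
  have hH : ∀ n, ∀ x ∈ coordSupported s (b n : Set X), H (n + 1) x = H n x := fun n x hx => by
    have := hU n x hx
    simp only [H, LinearMap.sub_apply, Finset.sum_range_succ, LinearMap.add_apply,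
      LinearMap.comp_apply] at this ⊢
    rw [this]
    abel
  have hH' : ∀ n m, n ≤ m → ∀ x ∈ coordSupported s (b n : Set X), H m x = H n x := by
    intro n m hnm x hx
    induction m, hnm using Nat.le_induction with
    | base => rfl
    | succ m hnm ih => rw [hH m x (hVm hnm hx), ih]
  let e : X → F := fun x => if h : ∃ n, x ∈ b n then H (Nat.find h + 1) (π (Finsupp.single x 1)) else 0
  have he : ∀ n, ∀ x ∈ b n, e x = H (n + 1) (π (Finsupp.single x 1)) := by
    intro n x hx
    have hex : ∃ n, x ∈ b n := ⟨n, hx⟩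
    simp only [e, dif_pos hex]
    refine (hH' _ _ (Nat.succ_le_succ (Nat.find_min' hex hx)) _ (hV _ ?_)).symm
    exact hc.proj_mem _ _ (Finsupp.single_mem_supported R 1 (Nat.find_spec hex))
  refine ⟨Finsupp.linearCombination R e ∘ₗ s, fun x => ?_⟩
  obtain ⟨n, hn⟩ : ∃ n, ((s x).support : Set X) ⊆ b n :=
    Directed.exists_mem_subset_of_finset_subset_biUnion
      (Monotone.directed_le fun m n h => Finset.coe_subset.2 (hb h)) x.2.2
  have h1 : (Finsupp.linearCombination R e - H (n + 1) ∘ₗ π) (s x) ∈ (⊥ : Submodule R F) :=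
    map_mem_of_supported _ _ (b n : Set X) (fun y hy => by
      simp [he n y hy]) hn
  rw [Submodule.mem_bot, LinearMap.sub_apply, sub_eq_zero, LinearMap.comp_apply,
    hc.section_apply] at h1
  rw [LinearMap.comp_apply, h1]
  have hdx : d x = 0 := x.2.1
  simp only [H, LinearMap.sub_apply, LinearMap.sum_apply, LinearMap.comp_apply, hdx, map_zero,
    Finset.sum_const_zero, sub_zero]
  exact hh _ x ⟨hdx, hVm (by omega) (show (x : P) ∈ coordSupported s (b n : Set X) from hn)⟩

theorem coordSupported_empty (hs : ∀ p, π (s p) = p) : coordSupported s (∅ : Set X) = ⊥ := by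
  rw [eq_bot_iff]
  intro p hp
  have : s p = 0 := by
    rw [← Finsupp.support_eq_empty]
    exact Finset.coe_eq_empty.1 (Set.subset_empty_iff.1 hp)
  rw [Submodule.mem_bot, ← hs p, this, map_zero]

theorem IsGoodClosure.isSGP_restrict (hc : IsGoodClosure d s π c) (hd : IsSGP d) {S : Set X}
    (hS : IsClosedUnder c S) (hcount : S.Countable) :
    IsSGP (d.restrict fun _ hp => hc.diff_mem_of_closed hS hp :
      coordSupported s S →ₗ[R] coordSupported s S) where
  proj := by
    have := hd.proj
    obtain ⟨ρ, hρ⟩ := hc.exists_retraction hS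
    exact Module.Projective.of_split (coordSupported s S).subtype ρ (LinearMap.ext hρ)
  exact := by
    apply le_antisymm
    · intro p hp
      obtain ⟨q, hq, hqp⟩ := hc.exists_diff_of_closed hS p.2 (congrArg Subtype.val hp)
      exact ⟨⟨q, hq⟩, Subtype.ext hqp⟩
    · rintro _ ⟨q, rfl⟩
      exact Subtype.ext (apply_apply_of_exact hd.exact _)
  ext := by
    intro F _ _ _ f
    rcases S.eq_empty_or_nonempty with rfl | hne
    · refine ⟨0, fun x => ?_⟩
      have : x = 0 := by
        have h := (coordSupported_empty hc.section_apply).le x.1.2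
        exact Subtype.ext (Subtype.ext ((Submodule.mem_bot R).1 h))
      simp [this]
    obtain ⟨b, hb, -, hcb, rfl⟩ := exists_monotone_of_countable hS hcount hne
    let j : (LinearMap.ker d ⊓ coordSupported s (⋃ n, (b n : Set X)) : Submodule R P) →ₗ[R]
        LinearMap.ker (d.restrict fun _ hp => hc.diff_mem_of_closed hS hp :
          coordSupported s (⋃ n, (b n : Set X)) →ₗ[R] coordSupported s (⋃ n, (b n : Set X))) :=
      (Submodule.inclusion inf_le_right).codRestrict _ fun x => Subtype.ext x.2.1
    obtain ⟨g, hg⟩ := hc.extendsTo_projective hb hcb (apply_apply_of_exact hd.exact) F (f ∘ₗ j)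
    exact ⟨g ∘ₗ Submodule.subtype _, fun x => hg ⟨x.1.1, congrArg Subtype.val x.2, x.1.2⟩⟩

theorem IsClosedUnder.iUnion {ι : Type*} [LinearOrder ι] {S : ι → Set X} (hmono : Monotone S)
    (hS : ∀ i, IsClosedUnder c (S i)) : IsClosedUnder c (⋃ i, S i) := by
  intro Y hne hY
  have : Nonempty ι := by
    obtain ⟨y, hy⟩ := hne
    obtain ⟨i, -⟩ := Set.mem_iUnion.1 (hY hy)
    exact ⟨i⟩
  obtain ⟨i, hi⟩ := Directed.exists_mem_subset_of_finset_subset_biUnion hmono.directed_le hY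
  exact (hS i Y hne hi).trans (Set.subset_iUnion S i)

theorem IsClosedUnder.iUnion_lt {ι : Type*} [LinearOrder ι] {S : ι → Set X} (hmono : Monotone S)
    (hS : ∀ i, IsClosedUnder c (S i)) (j : ι) : IsClosedUnder c (⋃ i < j, S i) := by
  have := IsClosedUnder.iUnion (S := fun i : Set.Iio j => S i) (fun a b h => hmono h)
    (fun i => hS i)
  rwa [Set.iUnion_subtype] at this

theorem coordSupported_iUnion (hs : ∀ p, π (s p) = p) {ι : Type*} [LinearOrder ι]
    {S : ι → Set X} (hmono : Monotone S) :
    coordSupported s (⋃ i, S i) = ⨆ i, coordSupported s (S i) := by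
  refine le_antisymm (fun p hp => ?_)
    (iSup_le fun i => coordSupported_mono (Set.subset_iUnion S i))
  rcases isEmpty_or_nonempty ι with hι | hι
  · rw [Set.iUnion_of_empty, coordSupported_empty hs] at hp
    rw [(Submodule.mem_bot R).1 hp]
    exact zero_mem _
  · obtain ⟨i, hi⟩ := Directed.exists_mem_subset_of_finset_subset_biUnion hmono.directed_le
      (mem_coordSupported.1 hp)
    exact (le_iSup (fun i => coordSupported s (S i)) i) (mem_coordSupported.2 hi)

theorem coordSupported_iUnion_lt (hs : ∀ p, π (s p) = p) {ι : Type*} [LinearOrder ι]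
    {S : ι → Set X} (hmono : Monotone S) (j : ι) :
    coordSupported s (⋃ i < j, S i) = ⨆ i < j, coordSupported s (S i) := by
  have := coordSupported_iUnion hs (S := fun i : Set.Iio j => S i) (fun a b h => hmono h)
  rwa [Set.iUnion_subtype, iSup_subtype] at this

theorem IsGoodClosure.extendsTo (hc : IsGoodClosure d s π c) (hd : IsSGP d) (w : Type u)
    [AddCommGroup w] [Module R w]
    (hcount : ∀ S : Set X, IsClosedUnder c S → S.Countable →
      (LinearMap.ker d ⊓ coordSupported s S).ExtendsTo w) {S : Set X} (hS : IsClosedUnder c S) :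
    (LinearMap.ker d ⊓ coordSupported s S).ExtendsTo w := by
  refine IsClosedUnder.induction (c := c)
    (fun S => (LinearMap.ker d ⊓ coordSupported s S).ExtendsTo w) hcount ?_ hS
  intro ι _ _ S hmono hcl hP hP' f
  have hiU := coordSupported_iUnion hc.section_apply hmono
  have key : ∃ h : (⨆ i, coordSupported s (S i) : Submodule R P) →ₗ[R] w,
      ∀ x : (⨆ i, coordSupported s (S i) : Submodule R P),
        ∀ hx : x.1 ∈ LinearMap.ker d ⊓ coordSupported s (⋃ i, S i), h x = f ⟨x, hx⟩ := by
    refine exists_linearMap_iSup (fun i => coordSupported s (S i))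
      (fun i j h => coordSupported_mono (hmono h))
      (fun x y => ∀ hx : x ∈ LinearMap.ker d ⊓ coordSupported s (⋃ i, S i), y = f ⟨x, hx⟩)
      (fun hx => (map_zero f).symm) fun j g hg => ?_
    have hlt := coordSupported_iUnion_lt hc.section_apply hmono j
    have hSj : S j ⊆ ⋃ i, S i := Set.subset_iUnion S j
    have hlt' : (⋃ i < j, S i) ⊆ S j := Set.iUnion₂_subset fun i hi => hmono hi.le
    have hcl' := IsClosedUnder.iUnion_lt hmono hcl j
    obtain ⟨h, hh⟩ := hP j (f ∘ₗ Submodule.inclusion (inf_le_inf_left _ (coordSupported_mono hSj)))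
    let δ : coordSupported s (⋃ i < j, S i) →ₗ[R]
        (LinearMap.ker d ⊓ coordSupported s (⋃ i < j, S i) : Submodule R P) :=
      (d ∘ₗ Submodule.subtype _).codRestrict _ fun x =>
        ⟨apply_apply_of_exact hd.exact _, hc.diff_mem_of_closed hcl' x.2⟩
    have hδ : Function.Surjective δ := by
      rintro ⟨x, hx1, hx2⟩
      obtain ⟨q, hq, rfl⟩ := hc.exists_diff_of_closed hcl' hx2 hx1
      exact ⟨⟨q, hq⟩, rfl⟩
    obtain ⟨u, hu⟩ := exists_factor_of_surjective δ hδ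
      (g ∘ₗ Submodule.inclusion hlt.le - h ∘ₗ Submodule.subtype _) (by
        intro a ha
        have hda : d a = 0 := congrArg Subtype.val ha
        have h1 := hg ⟨a, hlt.le a.2⟩ ⟨hda, coordSupported_mono (hlt'.trans hSj) a.2⟩
        have h2 := hh ⟨a, hda, coordSupported_mono hlt' a.2⟩
        exact sub_eq_zero.2 (h1.trans h2.symm))
    obtain ⟨U, hU⟩ := hP' j u
    refine ⟨(h + U ∘ₗ d) ∘ₗ Submodule.subtype _, fun x hx => ?_, fun x hx hx' => ?_⟩
    · have hdx : d x = 0 := hx.1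
      have h1 : h x + U (d x) = f ⟨x, hx⟩ := by
        rw [hdx, map_zero, add_zero]
        exact hh ⟨x, hx.1, x.2⟩
      exact h1
    · have h1 := hU (δ ⟨x, hlt.ge hx⟩)
      rw [hu] at h1
      have h2 : U (d x) = g ⟨x, hx⟩ - h x := h1
      simp [h2]
  obtain ⟨h, hh⟩ := key
  obtain ⟨ρ, hρ⟩ := hc.exists_retraction (IsClosedUnder.iUnion hmono hcl)
  refine ⟨h ∘ₗ Submodule.inclusion hiU.le ∘ₗ ρ, fun x => ?_⟩
  have := hρ ⟨x, x.2.2⟩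
  simp only [LinearMap.comp_apply, this]
  exact hh _ x.2

end ClosedPieces

theorem IsSGP.conj {P Q : Type u} [AddCommGroup P] [Module R P] [AddCommGroup Q] [Module R Q]
    {d : P →ₗ[R] P} (hd : IsSGP d) (e : P ≃ₗ[R] Q) :
    IsSGP (e.toLinearMap ∘ₗ d ∘ₗ e.symm.toLinearMap) where
  proj := by
    have := hd.proj
    exact Module.Projective.of_equiv e
  exact := by
    ext x
    have h : d (e.symm x) = 0 ↔ ∃ y, d y = e.symm x :=
      ⟨exists_of_exact hd.exact, fun ⟨y, hy⟩ => hy ▸ apply_apply_of_exact hd.exact y⟩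
    simp only [LinearMap.mem_ker, LinearMap.mem_range, LinearMap.comp_apply, LinearEquiv.coe_coe,
      LinearEquiv.map_eq_zero_iff, h]
    constructor
    · rintro ⟨y, hy⟩
      exact ⟨e y, by simp [hy]⟩
    · rintro ⟨y, rfl⟩
      exact ⟨e.symm y, by simp⟩
  ext := by
    intro F _ _ _ f
    let a : LinearMap.ker d →ₗ[R] LinearMap.ker (e.toLinearMap ∘ₗ d ∘ₗ e.symm.toLinearMap) :=
      (e.toLinearMap ∘ₗ Submodule.subtype _).codRestrict _ fun x => by simp
    obtain ⟨g, hg⟩ := hd.ext F (f ∘ₗ a)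
    refine ⟨g ∘ₗ e.symm.toLinearMap, fun x => ?_⟩
    have hx : d (e.symm x) = 0 := by
      have := x.2
      simpa only [LinearMap.mem_ker, LinearMap.comp_apply, LinearEquiv.coe_coe,
        LinearEquiv.map_eq_zero_iff] using this
    rw [LinearMap.comp_apply]
    refine (hg ⟨e.symm x, hx⟩).trans ?_
    rw [LinearMap.comp_apply]
    congr 1
    exact Subtype.ext (e.apply_symm_apply x.1)

/-- A set of representatives of the countably generated periodic totally acyclic complexes of
projectives. -/
def SmallSGP (R : Type u) [CommRing R] : Type u :=
  Σ q : Submodule R (ULift.{u} ℕ →₀ R), {d : q →ₗ[R] q // IsSGP (R := R) (P := q) d}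

/-- The total module of a small periodic complex. -/
noncomputable def SmallSGP.carrier (t : SmallSGP R) : ModuleCat.{u} R := ModuleCat.of R t.1

/-- The differential of a small periodic complex. -/
def SmallSGP.d (t : SmallSGP R) : t.carrier →ₗ[R] t.carrier := t.2.1

theorem SmallSGP.isSGP (t : SmallSGP R) : IsSGP t.d := t.2.2

theorem IsSGP.exists_smallSGP {V : Type u} [AddCommGroup V] [Module R V] {d : V →ₗ[R] V}
    (hd : IsSGP d) (j : V →ₗ[R] (ULift.{u} ℕ →₀ R)) (hj : Function.Injective j) :
    ∃ (t : SmallSGP R) (e : V ≃ₗ[R] t.carrier), ∀ x, t.d (e x) = e (d x) :=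
  ⟨⟨LinearMap.range j, _, hd.conj (LinearEquiv.ofInjective j hj)⟩, LinearEquiv.ofInjective j hj,
    fun x => congrArg (fun y => LinearEquiv.ofInjective j hj (d y))
      ((LinearEquiv.ofInjective j hj).symm_apply_apply x)⟩

theorem gpTrivial_iff_small [IsNoetherianRing R] (hVG : VirtuallyGorenstein R) (M : Type u)
    [AddCommGroup M] [Module R M] :
    GPTrivial R M ↔ ∀ t : SmallSGP R, (LinearMap.ker t.d).ExtendsTo M := by
  refine ⟨fun h t => h _ _ t.isSGP, fun h P _ _ d hd f => ?_⟩
  obtain ⟨s, hs⟩ := Module.projective_def'.1 hd.proj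
  obtain ⟨c, hc⟩ := hd.exists_isGoodClosure hVG (π := Finsupp.linearCombination R id)
    fun p => LinearMap.congr_fun hs p
  have hext := hc.extendsTo hd M ?_ (S := Set.univ) fun _ _ _ => Set.subset_univ _
  · have hU : ∀ p : P, p ∈ coordSupported s Set.univ := fun p =>
      mem_coordSupported.2 (Set.subset_univ _)
    obtain ⟨g, hg⟩ := hext (f ∘ₗ Submodule.inclusion inf_le_left)
    exact ⟨g, fun x => hg ⟨x, x.2, hU x⟩⟩
  intro S hS hcount f
  obtain ⟨φ, hφ⟩ := Set.countable_iff_exists_injOn.1 hcount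
  let V := coordSupported s S
  obtain ⟨t, e, he⟩ := (hc.isSGP_restrict hd hS hcount).exists_smallSGP
    (Finsupp.lmapDomain R R (fun x => ULift.up (φ x)) ∘ₗ s ∘ₗ V.subtype) (by
      intro x y hxy
      have h1 : s x = s y := Finsupp.mapDomain_injOn (S := S) (f := fun x => ULift.up.{u} (φ x))
        (fun a ha b hb hab => hφ ha hb (congrArg ULift.down hab)) x.2 y.2 hxy
      exact Subtype.ext (by rw [← hc.section_apply x, h1, hc.section_apply]))
  have hker : ∀ y, t.d y = 0 → d (e.symm y) = 0 := fun y hy => by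
    have h1 := he (e.symm y)
    rw [e.apply_symm_apply, hy, eq_comm, e.map_eq_zero_iff] at h1
    exact congrArg Subtype.val h1
  let a : LinearMap.ker t.d →ₗ[R] (LinearMap.ker d ⊓ V : Submodule R P) :=
    (V.subtype ∘ₗ e.symm.toLinearMap ∘ₗ Submodule.subtype _).codRestrict _
      fun y => ⟨hker y y.2, (e.symm y).2⟩
  obtain ⟨g, hg⟩ := h t (f ∘ₗ a)
  obtain ⟨ρ, hρ⟩ := hc.exists_retraction hS
  refine ⟨g ∘ₗ e.toLinearMap ∘ₗ ρ, fun x => ?_⟩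
  have hx : ρ x = ⟨x, x.2.2⟩ := hρ ⟨x, x.2.2⟩
  have hd0 : d x = 0 := x.2.1
  have h0 : t.d (e ⟨x, x.2.2⟩) = 0 := by
    rw [he, e.map_eq_zero_iff]
    exact Subtype.ext hd0
  have h1 := hg ⟨e ⟨x, x.2.2⟩, h0⟩
  rw [LinearMap.comp_apply, LinearMap.comp_apply, hx]
  refine h1.trans ?_
  rw [LinearMap.comp_apply]
  congr 1
  exact Subtype.ext (congrArg (fun v : V => (v : P)) (e.symm_apply_apply ⟨x, x.2.2⟩))

section IntegerSequences

theorem exists_int_chain {α : Type*} (r : α → α → Prop) (hf : ∀ a, ∃ b, r a b)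
    (hg : ∀ b, ∃ a, r a b) (a : α) : ∃ s : ℤ → α, s 0 = a ∧ ∀ n, r (s n) (s (n + 1)) := by
  choose f hf using hf
  choose g hg using hg
  refine ⟨fun n => Int.casesOn n (fun n => f^[n] a) (fun n => g^[n + 1] a), rfl, fun n => ?_⟩
  rcases n with n | n
  · change r (f^[n] a) (f^[n + 1] a)
    rw [Function.iterate_succ_apply']
    exact hf _
  · rcases n with n | n
    · exact hg a
    · change r (g^[n + 2] a) (g^[n + 1] a)
      rw [Function.iterate_succ_apply']
      exact hg _

theorem exists_int_complex (Q Pr : ModuleCat.{u} R → Prop)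
    (hl : ∀ B, Q B → ∃ A, Q A ∧ ∃ P, Pr P ∧ ∃ (i : A →ₗ[R] P) (p : P →ₗ[R] B),
      Function.Injective i ∧ Function.Surjective p ∧ Function.Exact i p)
    (hr : ∀ A, Q A → ∃ B, Q B ∧ ∃ P, Pr P ∧ ∃ (i : A →ₗ[R] P) (p : P →ₗ[R] B),
      Function.Injective i ∧ Function.Surjective p ∧ Function.Exact i p)
    (G : ModuleCat.{u} R) (hG : Q G) :
    ∃ (s X : ℤ → ModuleCat.{u} R) (i : ∀ j, s (j + 1) →ₗ[R] X j) (p : ∀ j, X j →ₗ[R] s j),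
      s 0 = G ∧ (∀ j, Q (s j)) ∧ (∀ j, Pr (X j)) ∧ (∀ j, Function.Injective (i j)) ∧
      (∀ j, Function.Surjective (p j)) ∧ ∀ j, Function.Exact (i j) (p j) := by
  obtain ⟨s, hs, h⟩ := exists_int_chain (α := {A // Q A})
    (fun B A => ∃ P, Pr P ∧ ∃ (i : A.1 →ₗ[R] P) (p : P →ₗ[R] B.1),
      Function.Injective i ∧ Function.Surjective p ∧ Function.Exact i p)
    (fun B => by
      obtain ⟨A, hA, h⟩ := hl B.1 B.2
      exact ⟨⟨A, hA⟩, h⟩)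
    (fun A => by
      obtain ⟨B, hB, h⟩ := hr A.1 A.2
      exact ⟨⟨B, hB⟩, h⟩) ⟨G, hG⟩
  choose X hX i p hi hp hip using h
  exact ⟨fun j => (s j).1, X, i, p, congrArg Subtype.val hs, fun j => (s j).2, hX, hi, hp, hip⟩

end IntegerSequences

section Lifting

variable {A B V W : Type u} [AddCommGroup A] [Module R A] [AddCommGroup B] [Module R B]
  [AddCommGroup V] [Module R V] [AddCommGroup W] [Module R W]

theorem liftsAgainst_prod_zero_iff (i : A →ₗ[R] B) (p : V →ₗ[R] W) :
    LiftsAgainst (i.prod (0 : A →ₗ[R] R)) p ↔ LiftsAgainst i p ∧ Function.Surjective p := by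
  constructor
  · refine fun h => ⟨fun f g hfg => ?_, fun w => ?_⟩
    · obtain ⟨k, hk1, hk2⟩ := h f (g ∘ₗ LinearMap.fst R B R) (by
        rw [hfg]
        ext
        simp)
      refine ⟨k ∘ₗ LinearMap.inl R B R, ?_, ?_⟩
      · rw [← hk1]
        ext
        simp
      · rw [← LinearMap.comp_assoc, hk2]
        ext
        simp
    · obtain ⟨k, -, hk⟩ := h 0 (LinearMap.toSpanSingleton R W w ∘ₗ LinearMap.snd R B R) (by
        ext
        simp)
      refine ⟨k (0, 1), ?_⟩
      have := LinearMap.congr_fun hk (0, 1)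
      simpa using this
  · rintro ⟨h, hp⟩ f g hfg
    obtain ⟨k, hk1, hk2⟩ := h f (g ∘ₗ LinearMap.inl R B R) (by
      rw [hfg]
      ext
      simp)
    obtain ⟨l, hl⟩ := exists_lift_of_projective p hp (g ∘ₗ LinearMap.inr R B R)
    refine ⟨k.coprod l, ?_, ?_⟩
    · rw [← hk1]
      ext
      simp
    · refine LinearMap.prod_ext ?_ (LinearMap.ext fun x => ?_)
      · rw [← hk2]
        ext
        simp
      · simpa using hl x

theorem exists_injective_embedding (M : Type u) [AddCommGroup M] [Module R M] :
    ∃ (I : Type u) (_ : AddCommGroup I) (_ : Module R I) (i : M →ₗ[R] I),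
      Module.Injective R I ∧ Function.Injective i := by
  let I : ModuleCat.{u} R := Injective.under (ModuleCat.of R M)
  let ι : ModuleCat.of R M ⟶ I := Injective.ι _
  exact ⟨I, inferInstance, inferInstance, ι.hom, (Module.injective_iff_injective_object R I).2
    (inferInstanceAs (Injective (Injective.under (ModuleCat.of R M)))),
    (ModuleCat.mono_iff_injective _).1 (inferInstanceAs (Mono (Injective.ι (ModuleCat.of R M))))⟩

end Lifting

/-- Every map from `G` lifts along all epimorphisms with trivial kernel. -/
def GPLiftable (R : Type u) [CommRing R] (G : Type u) [AddCommGroup G] [Module R G] : Prop :=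
  ∀ (V W : Type u) [AddCommGroup V] [Module R V] [AddCommGroup W] [Module R W] (p : V →ₗ[R] W),
    Function.Surjective p → GPTrivial R (LinearMap.ker p) →
    ∀ g : G →ₗ[R] W, ∃ h : G →ₗ[R] V, ∀ x, p (h x) = g x

section GPLiftable

variable {G P M V W N : Type u} [AddCommGroup G] [Module R G] [AddCommGroup P] [Module R P]
  [AddCommGroup M] [Module R M] [AddCommGroup V] [Module R V] [AddCommGroup W] [Module R W]
  [AddCommGroup N] [Module R N]

theorem IsSGP.liftsAgainst {d : P →ₗ[R] P} (hd : IsSGP d) (p : V →ₗ[R] W)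
    (hp : Function.Surjective p) (hk : GPTrivial R (LinearMap.ker p)) :
    LiftsAgainst (LinearMap.ker d).subtype p := by
  intro f g hfg
  have := hd.proj
  obtain ⟨h, hh⟩ := exists_lift_of_projective p hp g
  obtain ⟨k, hk⟩ := hk P d hd ((f - h ∘ₗ (LinearMap.ker d).subtype).codRestrict _ fun x => by
    have := LinearMap.congr_fun hfg x
    simp only [LinearMap.comp_apply, Submodule.subtype_apply] at this
    simp [hh, this])
  refine ⟨h + Submodule.subtype _ ∘ₗ k, LinearMap.ext fun x => ?_, LinearMap.ext fun x => ?_⟩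
  · have h1 : (k x : V) = f x - h x := congrArg Subtype.val (hk x)
    simp [h1]
  · simp [hh, LinearMap.mem_ker.1 (k x).2]

/-- The monomorphisms against which the epimorphisms with trivial kernel are characterised. -/
noncomputable def smallSGPMap (t : SmallSGP R) : LinearMap.ker t.d →ₗ[R] t.carrier × R :=
  (LinearMap.ker t.d).subtype.prod 0

theorem smallSGPMap_injective (t : SmallSGP R) : Function.Injective (smallSGPMap t) := by
  intro x y hxy
  exact Subtype.ext (congrArg Prod.fst hxy)

theorem forall_liftsAgainst_smallSGPMap_iff [IsNoetherianRing R] (hVG : VirtuallyGorenstein R)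
    (p : V →ₗ[R] W) : (∀ t : SmallSGP R, LiftsAgainst (smallSGPMap t) p) ↔
      Function.Surjective p ∧ GPTrivial R (LinearMap.ker p) := by
  constructor
  · intro h
    have h' : ∀ t : SmallSGP R, _ := fun t => (liftsAgainst_prod_zero_iff _ _).1 (h t)
    refine ⟨(h' ⟨⊥, 0, ?_⟩).2, (gpTrivial_iff_small hVG _).2 fun t f => ?_⟩
    · refine ⟨inferInstance, Subsingleton.elim _ _, fun F _ _ _ f => ⟨0, fun x => ?_⟩⟩
      rw [Subsingleton.elim x 0]
      simp
    · obtain ⟨k, hk1, hk2⟩ := (h' t).1 (Submodule.subtype _ ∘ₗ f) 0 (by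
        ext x
        simp)
      refine ⟨k.codRestrict _ fun x => LinearMap.congr_fun hk2 x, fun x => Subtype.ext ?_⟩
      exact LinearMap.congr_fun hk1 x
  · rintro ⟨h1, h2⟩ t
    exact (liftsAgainst_prod_zero_iff _ _).2 ⟨t.isSGP.liftsAgainst p h1 h2, h1⟩

/-- Factorizations with respect to the cotorsion pair cogenerated by the trivial modules. -/
theorem exists_gp_factorization [IsNoetherianRing R] (hVG : VirtuallyGorenstein R)
    (f : M →ₗ[R] N) :
    ∃ (Z : Type u) (_ : AddCommGroup Z) (_ : Module R Z) (a : M →ₗ[R] Z) (p : Z →ₗ[R] N),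
      p ∘ₗ a = f ∧ Function.Surjective p ∧ GPTrivial R (LinearMap.ker p) ∧
      ∀ (V W : Type u) [AddCommGroup V] [Module R V] [AddCommGroup W] [Module R W]
        (q : V →ₗ[R] W), Function.Surjective q → GPTrivial R (LinearMap.ker q) →
        LiftsAgainst a q := by
  obtain ⟨Z, _, _, a, p, hpa, hp, ha⟩ := exists_factorization_liftsAgainst
    (fun t : SmallSGP R => LinearMap.ker t.d) (fun t => t.carrier × R) smallSGPMap
    smallSGPMap_injective f
  obtain ⟨h1, h2⟩ := (forall_liftsAgainst_smallSGPMap_iff hVG p).1 hp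
  exact ⟨Z, _, _, a, p, hpa, h1, h2, fun V W _ _ _ _ q hq hk =>
    ha V W q ((forall_liftsAgainst_smallSGPMap_iff hVG q).2 ⟨hq, hk⟩)⟩

theorem exists_gpLiftable_cover [IsNoetherianRing R] (hVG : VirtuallyGorenstein R) (M : Type u)
    [AddCommGroup M] [Module R M] :
    ∃ (G : Type u) (_ : AddCommGroup G) (_ : Module R G) (p : G →ₗ[R] M),
      GPLiftable R G ∧ Function.Surjective p ∧ GPTrivial R (LinearMap.ker p) := by
  obtain ⟨G, _, _, a, p, -, hp, hk, ha⟩ :=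
    exists_gp_factorization hVG (0 : (PUnit.{u + 1} : Type u) →ₗ[R] M)
  refine ⟨G, _, _, p, fun V W _ _ _ _ q hq hkq g => ?_, hp, hk⟩
  obtain ⟨h, -, hh⟩ := ha V W q hq hkq 0 g
    (LinearMap.ext fun x => by rw [Subsingleton.elim x 0, map_zero, map_zero])
  exact ⟨h, LinearMap.congr_fun hh⟩

theorem GPLiftable.exists_extend (hG : GPLiftable R G) (hN : GPTrivial R N) (i : M →ₗ[R] P)
    (p : P →ₗ[R] G) (hi : Function.Injective i) (hp : Function.Surjective p)
    (h : Function.Exact i p) (f : M →ₗ[R] N) : ∃ g : P →ₗ[R] N, ∀ x, g (i x) = f x := by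
  let K : Submodule R (N × P) := LinearMap.range (f.prod (-i))
  let q : ((N × P) ⧸ K) →ₗ[R] G := K.liftQ (p ∘ₗ LinearMap.snd R N P) (by
    rintro _ ⟨x, rfl⟩
    simp [h.apply_apply_eq_zero])
  have hq : Function.Surjective q := fun x => by
    obtain ⟨y, rfl⟩ := hp x
    exact ⟨K.mkQ (0, y), by simp [q]⟩
  let j : N →ₗ[R] LinearMap.ker q := (K.mkQ ∘ₗ LinearMap.inl R N P).codRestrict _ fun x => by
    simp [q]
  have hj : Function.Bijective j := by
    constructor
    · rw [← LinearMap.ker_eq_bot, LinearMap.ker_eq_bot']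
      intro n hn
      have h1 : ((n, 0) : N × P) ∈ K := (Submodule.Quotient.mk_eq_zero K).1 (congrArg Subtype.val hn)
      obtain ⟨x, hx⟩ := h1
      simp only [LinearMap.prod_apply, Function.prod, LinearMap.neg_apply, Prod.mk.injEq,
        neg_eq_zero] at hx
      rw [← hx.1, hi (hx.2.trans (map_zero i).symm), map_zero]
    · rintro ⟨y, hy⟩
      obtain ⟨⟨n, x⟩, rfl⟩ := K.mkQ_surjective y
      have hx : p x = 0 := by simpa [q] using hy
      obtain ⟨m, rfl⟩ := (h x).1 hx
      refine ⟨n + f m, Subtype.ext ?_⟩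
      refine (Submodule.Quotient.eq K).2 ⟨m, ?_⟩
      simp
  let e := LinearEquiv.ofBijective j hj
  obtain ⟨σ, hσ⟩ := hG _ _ q hq (hN.of_equiv e.symm) LinearMap.id
  let τ : P →ₗ[R] LinearMap.ker q := (K.mkQ ∘ₗ LinearMap.inr R N P - σ ∘ₗ p).codRestrict _
    fun x => by simp [hσ, q]
  refine ⟨e.symm.toLinearMap ∘ₗ τ, fun x => ?_⟩
  rw [LinearMap.comp_apply, LinearEquiv.coe_coe, LinearEquiv.symm_apply_eq]
  refine Subtype.ext ?_
  have h1 : (τ (i x) : (N × P) ⧸ K) = K.mkQ (0, i x) - σ (p (i x)) := rfl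
  rw [h1, h.apply_apply_eq_zero, map_zero, sub_zero]
  have h2 : ((f x, 0) : N × P) - (0, i x) ∈ K := ⟨x, by simp⟩
  exact ((Submodule.Quotient.eq K).2 h2).symm

theorem GPLiftable.kernel [Module.Projective R P] (hG : GPLiftable R G) (i : M →ₗ[R] P)
    (p : P →ₗ[R] G) (hi : Function.Injective i) (hp : Function.Surjective p)
    (h : Function.Exact i p) : GPLiftable R M := by
  intro V W _ _ _ _ q hq hk g
  obtain ⟨I, _, _, ι, hI, hι⟩ := exists_injective_embedding (R := R) (LinearMap.ker q)
  obtain ⟨J, hJ⟩ := exists_extend_of_injective (Submodule.subtype _) Subtype.val_injective ι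
  let L := LinearMap.range ι
  obtain ⟨J', hJ'⟩ := exists_factor_of_surjective q hq (L.mkQ ∘ₗ J) (fun v hv => by
    have := hJ ⟨v, hv⟩
    simp only [Submodule.subtype_apply] at this
    simp [this, L])
  have hL : GPTrivial R (I ⧸ L) := hk.cokernel GPTrivial.of_injective ι L.mkQ hι
    L.mkQ_surjective (LinearMap.exact_map_mkQ_range ι)
  obtain ⟨E, hE⟩ := hG.exists_extend hL i p hi hp h (J' ∘ₗ g)
  obtain ⟨T, hT⟩ := exists_lift_of_projective L.mkQ L.mkQ_surjective E
  let δ : V →ₗ[R] W × I := q.prod J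
  have hδ : Function.Injective δ := by
    rw [← LinearMap.ker_eq_bot, LinearMap.ker_eq_bot']
    intro v hv
    have h1 : q v = 0 := congrArg Prod.fst hv
    have h2 : J v = 0 := congrArg Prod.snd hv
    have h3 := hJ ⟨v, h1⟩
    rw [Submodule.subtype_apply, h2] at h3
    exact congrArg Subtype.val (hι (h3.symm.trans (map_zero ι).symm))
  obtain ⟨k, hk⟩ := exists_factor_of_injective δ hδ (g.prod (T ∘ₗ i)) (fun m => by
    obtain ⟨v, hv⟩ := hq (g m)
    have h1 : L.mkQ (T (i m) - J v) = 0 := by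
      rw [map_sub, hT, hE, LinearMap.comp_apply, ← hv, hJ', LinearMap.comp_apply, sub_self]
    rw [Submodule.mkQ_apply, Submodule.Quotient.mk_eq_zero] at h1
    obtain ⟨w, hw⟩ := h1
    refine ⟨v + w, ?_⟩
    have h2 := hJ w
    rw [Submodule.subtype_apply] at h2
    simp [δ, hv, h2, hw])
  exact ⟨k, fun x => congrArg Prod.fst (hk x)⟩

theorem GPLiftable.projective_of_gpTrivial (hG : GPLiftable R G) (hW : GPTrivial R G) :
    Module.Projective R G := by
  obtain ⟨s, hs⟩ := hG _ _ (Finsupp.linearCombination R (id : G → G))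
    (linearCombination_id_surjective G) (GPTrivial.of_projective.kernel hW _ _
      Subtype.val_injective (linearCombination_id_surjective G)
      (LinearMap.exact_subtype_ker_map _)) LinearMap.id
  exact Module.Projective.of_split s (Finsupp.linearCombination R (id : G → G)) (LinearMap.ext hs)

theorem GPLiftable.exists_embedding [IsNoetherianRing R] (hVG : VirtuallyGorenstein R)
    (hG : GPLiftable R G) :
    ∃ (P : Type u) (_ : AddCommGroup P) (_ : Module R P) (i : G →ₗ[R] P),
      Module.Projective R P ∧ Function.Injective i ∧ GPLiftable R (P ⧸ LinearMap.range i) := by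
  obtain ⟨P, _, _, a, p, -, hp, hk, ha⟩ :=
    exists_gp_factorization hVG (0 : G →ₗ[R] (PUnit.{u + 1} : Type u))
  have hP : GPTrivial R P := hk.of_equiv (LinearEquiv.ofTop (LinearMap.ker p)
    (eq_top_iff.2 fun x _ => Subsingleton.elim _ _)).symm
  refine ⟨P, _, _, a, GPLiftable.projective_of_gpTrivial (fun V W _ _ _ _ q hq hk g => ?_) hP,
    ?_, fun V W _ _ _ _ q hq hk g => ?_⟩
  · obtain ⟨f, hf⟩ := hG V W q hq hk (g ∘ₗ a)
    obtain ⟨h, -, hh⟩ := ha V W q hq hk f g (LinearMap.ext hf)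
    exact ⟨h, LinearMap.congr_fun hh⟩
  · obtain ⟨I, _, _, ι, hI, hι⟩ := exists_injective_embedding (R := R) G
    obtain ⟨h, hh, -⟩ := ha I (PUnit.{u + 1} : Type u) 0 (fun x => ⟨0, Subsingleton.elim _ _⟩)
      (GPTrivial.of_injective.of_equiv (LinearEquiv.ofTop _ LinearMap.ker_zero)) ι 0 (by
        ext)
    refine Function.Injective.of_comp (f := h) ?_
    rw [← LinearMap.coe_comp, hh]
    exact hι
  · obtain ⟨h, h1, h2⟩ := ha V W q hq hk 0 (g ∘ₗ Submodule.mkQ _) (LinearMap.ext fun x => by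
      have h0 : Submodule.mkQ (LinearMap.range a) (a x) = 0 :=
        (Submodule.Quotient.mk_eq_zero _).2 ⟨x, rfl⟩
      rw [LinearMap.comp_apply, LinearMap.comp_apply, LinearMap.comp_apply, h0]
      simp)
    refine ⟨Submodule.liftQ _ h ?_, fun x => ?_⟩
    · rintro _ ⟨x, rfl⟩
      exact LinearMap.congr_fun h1 x
    · obtain ⟨y, rfl⟩ := Submodule.mkQ_surjective _ x
      exact LinearMap.congr_fun h2 y

/-- The cycles of totally acyclic complexes of projectives contain all `G` such that every
map from `G` lifts along epimorphisms with trivial kernel. -/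
theorem GPLiftable.exists_retract [IsNoetherianRing R] (hVG : VirtuallyGorenstein R)
    (hG : GPLiftable R G) :
    ∃ (P : Type u) (_ : AddCommGroup P) (_ : Module R P) (d : P →ₗ[R] P), IsSGP d ∧
      ∃ (i : G →ₗ[R] LinearMap.ker d) (r : LinearMap.ker d →ₗ[R] G), ∀ x, r (i x) = x := by
  obtain ⟨s, X, i, p, hs, hQ, hX, hi, hp, hip⟩ := exists_int_complex
    (fun M : ModuleCat.{u} R => GPLiftable R M) (fun M => Module.Projective R M)
    (fun B hB => by
      have hsurj := linearCombination_id_surjective (R := R) B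
      exact ⟨ModuleCat.of R (LinearMap.ker (Finsupp.linearCombination R (id : B → B))),
        hB.kernel (Submodule.subtype _) _ Subtype.val_injective hsurj
          (LinearMap.exact_subtype_ker_map _), ModuleCat.of R (B →₀ R),
        inferInstanceAs (Module.Projective R (B →₀ R)), Submodule.subtype _, _,
        Subtype.val_injective, hsurj, LinearMap.exact_subtype_ker_map _⟩)
    (fun A hA => by
      obtain ⟨P, _, _, a, hP, ha, hL⟩ := hA.exists_embedding hVG
      exact ⟨ModuleCat.of R (P ⧸ LinearMap.range a), hL, ModuleCat.of R P, hP, a,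
        Submodule.mkQ _, ha, Submodule.mkQ_surjective _, LinearMap.exact_map_mkQ_range a⟩)
    (ModuleCat.of R G) hG
  let D : ∀ j, X (j + 1) →ₗ[R] X j := fun j => i j ∘ₗ p (j + 1)
  have hD : ∀ j x, D j x = 0 ↔ p (j + 1) x = 0 := fun j x =>
    (map_eq_zero_iff (i j) (hi j))
  have hSGP : IsSGP (sumDiff (X := fun j => X j) D) := by
    refine isSGP_sumDiff (X := fun j => X j) D (fun j x => ?_) (fun j x hx => ?_)
      fun F _ _ _ j f hf => ?_
    · exact (hD _ _).2 ((hip (j + 1)).apply_apply_eq_zero _)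
    · obtain ⟨y, rfl⟩ := (hip (j + 1) x).1 ((hD _ _).1 hx)
      obtain ⟨z, rfl⟩ := hp _ y
      exact ⟨z, rfl⟩
    · obtain ⟨f', hf'⟩ := exists_factor_of_surjective (p (j + 1)) (hp _) f fun a ha => by
        obtain ⟨y, rfl⟩ := (hip (j + 1) a).1 ha
        obtain ⟨z, rfl⟩ := hp _ y
        exact hf z
      obtain ⟨g, hg⟩ := (hQ j).exists_extend GPTrivial.of_projective (i j) (p j) (hi j) (hp j)
        (hip j) f'
      exact ⟨g, fun x => (hg _).trans (hf' x)⟩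
  have key : ∀ n, ∃ (a : s n →ₗ[R] LinearMap.ker (sumDiff (X := fun j => X j) D))
      (r : LinearMap.ker (sumDiff (X := fun j => X j) D) →ₗ[R] s n), ∀ x, r (a x) = x := by
    intro n
    obtain ⟨j, rfl⟩ : ∃ j, n = j + 1 + 1 := ⟨n - 2, by omega⟩
    obtain ⟨a, r, hr⟩ := exists_retract_ker_sumDiff (X := fun j => X j) D j
    let e : s (j + 1 + 1) →ₗ[R] LinearMap.ker (D j) := (i (j + 1)).codRestrict _ fun x =>
      (hD _ _).2 ((hip (j + 1)).apply_apply_eq_zero _)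
    have he : Function.Bijective e := by
      refine ⟨fun x y hxy => hi _ (congrArg Subtype.val hxy), fun ⟨x, hx⟩ => ?_⟩
      obtain ⟨y, rfl⟩ := (hip (j + 1) x).1 ((hD _ _).1 hx)
      exact ⟨y, rfl⟩
    let e' := LinearEquiv.ofBijective e he
    exact ⟨a ∘ₗ e'.toLinearMap, e'.symm.toLinearMap ∘ₗ r, fun x => by simp [hr]⟩
  obtain ⟨a, r, hr⟩ := hs ▸ key 0
  exact ⟨_, _, _, _, hSGP, a, r, hr⟩

end GPLiftable

theorem exists_isCofinal_wellFoundedLT (α : Type*) [LinearOrder α] :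
    ∃ s : Set α, IsCofinal s ∧ WellFoundedLT s := by
  refine ⟨{x | ∀ y, WellOrderingRel y x → y < x}, fun a => ?_, ⟨?_⟩⟩
  · have hwf : WellFounded (WellOrderingRel (α := α)) := IsWellFounded.wf
    refine ⟨hwf.min {x | a ≤ x} ⟨a, le_rfl⟩, fun y hy => ?_, hwf.min_mem {x | a ≤ x} _⟩
    refine lt_of_lt_of_le ?_ (hwf.min_mem {x | a ≤ x} ⟨a, le_rfl⟩)
    by_contra h
    exact hwf.not_lt_min {x | a ≤ x} (not_lt.1 h) hy
  · refine Subrelation.wf (r := InvImage WellOrderingRel Subtype.val) (fun {x y} hxy => ?_)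
      (InvImage.wf _ IsWellFounded.wf)
    rcases trichotomous_of WellOrderingRel x.1 y.1 with h | h | h
    · exact h
    · exact absurd (Subtype.ext h) hxy.ne
    · exact absurd (x.2 _ h) hxy.asymm

section Chains

variable {A B C : Type u} [AddCommGroup A] [Module R A] [AddCommGroup B] [Module R B]
  [AddCommGroup C] [Module R C]

theorem GPTrivial.iSup_of_linearOrder (hVG : VirtuallyGorenstein R) {ι : Type*} [LinearOrder ι]
    (K : ι → Submodule R A) (hK : Monotone K) (h : ∀ j, GPTrivial R (K j)) :
    GPTrivial R (⨆ i, K i : Submodule R A) := by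
  obtain ⟨s, hs, hwf⟩ := exists_isCofinal_wellFoundedLT ι
  have heq : (⨆ i, K i) = ⨆ i : s, K i := by
    refine le_antisymm (iSup_le fun i => ?_) (iSup_le fun i => le_iSup K i)
    obtain ⟨j, hj, hij⟩ := hs i
    exact (hK hij).trans (le_iSup (fun i : s => K i) ⟨j, hj⟩)
  rw [heq]
  exact GPTrivial.iSup hVG (fun i : s => K i) (fun a b hab => hK hab) fun j => h j

theorem GPTrivial.sSup_of_isChain (hVG : VirtuallyGorenstein R) {c : Set (Submodule R A)}
    (hc : IsChain (· ≤ ·) c) (h : ∀ K ∈ c, GPTrivial R K) :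
    GPTrivial R (sSup c : Submodule R A) := by
  let _ : LinearOrder c :=
    { (inferInstance : PartialOrder c) with
      le_total := fun a b => hc.total a.2 b.2
      toDecidableLE := Classical.decRel _ }
  rw [sSup_eq_iSup']
  exact GPTrivial.iSup_of_linearOrder hVG (fun K : c => K.1) (fun a b hab => hab) fun K => h _ K.2

theorem GPTrivial.extension (hVG : VirtuallyGorenstein R) (hA : GPTrivial R A)
    (hC : GPTrivial R C) (i : A →ₗ[R] B) (p : B →ₗ[R] C) (hi : Function.Injective i)
    (hp : Function.Surjective p) (h : Function.Exact i p) : GPTrivial R B := by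
  rw [hVG]
  intro I _ _ d hd φ
  obtain ⟨σ, hσ⟩ := (hVG A).1 hA I d hd (φ ∘ₗ i)
  obtain ⟨τ, hτ, -⟩ := ((hVG C).1 hC).exists_lift_extend i p hi hp h hd φ σ hσ
  exact ⟨τ, hτ⟩

end Chains

/-- Terms generated from one element by the module operations and by formal extensions of maps
along the inclusions of cycles of small periodic complexes. -/
inductive SmallTree (R : Type u) [CommRing R] : Type u
  | root : SmallTree R
  | add (a b : SmallTree R) : SmallTree R
  | smul (r : R) (a : SmallTree R) : SmallTree R
  | ext (t : SmallSGP R) (p : t.carrier) (k : LinearMap.ker t.d → SmallTree R) : SmallTree R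

namespace SmallTree

variable {M : Type u} [AddCommGroup M] [Module R M]

/-- Evaluation of a term, given the value at the root and a choice of extensions. -/
noncomputable def eval (E : ∀ t : SmallSGP R, (LinearMap.ker t.d → M) → t.carrier → M) (x : M) :
    SmallTree R → M
  | root => x
  | add a b => eval E x a + eval E x b
  | smul r a => r • eval E x a
  | ext t p k => E t (fun y => eval E x (k y)) p

end SmallTree

/-- Every element of a trivial module lies in a trivial submodule of bounded size. -/
theorem GPTrivial.exists_small_submodule [IsNoetherianRing R] (hVG : VirtuallyGorenstein R)
    {M : Type u} [AddCommGroup M] [Module R M] (hM : GPTrivial R M) (x : M) :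
    ∃ e : SmallTree R → M, x ∈ LinearMap.range (Finsupp.linearCombination R e) ∧
      GPTrivial R (LinearMap.range (Finsupp.linearCombination R e)) := by
  have hE : ∀ (t : SmallSGP R) (f : LinearMap.ker t.d → M), ∃ g : t.carrier → M,
      ∀ f' : LinearMap.ker t.d →ₗ[R] M, (∀ y, f' y = f y) →
        IsLinearMap R g ∧ ∀ y : LinearMap.ker t.d, g y = f y := by
    intro t f
    by_cases hf : ∃ f' : LinearMap.ker t.d →ₗ[R] M, ∀ y, f' y = f y
    · obtain ⟨f', hf'⟩ := hf
      obtain ⟨g, hg⟩ := hM _ t.d t.isSGP f'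
      exact ⟨g, fun _ _ => ⟨g.isLinear, fun y => (hg y).trans (hf' y)⟩⟩
    · exact ⟨0, fun f' h => absurd ⟨f', h⟩ hf⟩
  choose E hE using hE
  let e := SmallTree.eval E x
  let N : Submodule R M :=
    { carrier := Set.range e
      add_mem' := by
        rintro _ _ ⟨a, rfl⟩ ⟨b, rfl⟩
        exact ⟨.add a b, rfl⟩
      zero_mem' := ⟨.smul 0 .root, zero_smul R x⟩
      smul_mem' := by
        rintro r _ ⟨a, rfl⟩
        exact ⟨.smul r a, rfl⟩ }
  have hN : LinearMap.range (Finsupp.linearCombination R e) = N := by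
    rw [Finsupp.range_linearCombination]
    exact Submodule.span_eq N
  refine ⟨e, hN ▸ ⟨.root, rfl⟩, ?_⟩
  rw [hN, gpTrivial_iff_small hVG]
  intro t f
  have hk : ∀ y, ∃ k : SmallTree R, e k = f y := fun y => (f y).2
  choose k hk using hk
  obtain ⟨h1, h2⟩ := hE t (fun y => e (k y)) (N.subtype ∘ₗ f) fun y => (hk y).symm
  refine ⟨(IsLinearMap.mk' _ h1).codRestrict N fun p => ⟨.ext t p k, rfl⟩, fun y => ?_⟩
  exact Subtype.ext ((h2 y).trans (hk y))

/-- Every map to `e` extends along monomorphisms with trivial cokernel. -/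
def GIExtendable (R : Type u) [CommRing R] (e : Type u) [AddCommGroup e] [Module R e] : Prop :=
  ∀ (B : Type u) [AddCommGroup B] [Module R B] (A : Submodule R B), GPTrivial R (B ⧸ A) →
    A.ExtendsTo e

/-- The submodules with trivial quotient of a sufficiently large free module. -/
def SmallSyzygy (R : Type u) [CommRing R] : Type u :=
  {K : Submodule R (SmallTree R →₀ R) // GPTrivial R ((SmallTree R →₀ R) ⧸ K)}

/-- The underlying submodule of a small syzygy. -/
def SmallSyzygy.ker (t : SmallSyzygy R) : Submodule R (SmallTree R →₀ R) := t.1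

section GIExtendable

variable {A B C e : Type u} [AddCommGroup A] [Module R A] [AddCommGroup B] [Module R B]
  [AddCommGroup C] [Module R C] [AddCommGroup e] [Module R e]

theorem GIExtendable.exists_extend (he : GIExtendable R e) (hC : GPTrivial R C) (i : A →ₗ[R] B)
    (p : B →ₗ[R] C) (hi : Function.Injective i) (hp : Function.Surjective p)
    (h : Function.Exact i p) (f : A →ₗ[R] e) : ∃ g : B →ₗ[R] e, ∀ x, g (i x) = f x := by
  obtain ⟨g, hg⟩ := he B (LinearMap.ker p) (hC.of_equiv (p.quotKerEquivOfSurjective hp))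
    (f ∘ₗ (LinearEquiv.ofInjective i hi).symm.toLinearMap ∘ₗ
      (LinearEquiv.ofEq _ _ (LinearMap.exact_iff.1 h)).toLinearMap)
  refine ⟨g, fun x => (hg ⟨i x, h.apply_apply_eq_zero x⟩).trans ?_⟩
  simp only [LinearMap.comp_apply, LinearEquiv.coe_coe]
  congr 1
  rw [LinearEquiv.symm_apply_eq]
  exact Subtype.ext rfl

theorem GIExtendable.of_injective [Module.Injective R e] : GIExtendable R e :=
  fun _ _ _ A _ f => exists_extend_of_injective A.subtype Subtype.val_injective f

theorem exists_extend_step {D : Submodule R B} (f : D →ₗ[R] e) (π : B →ₗ[R] C)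
    (hπ : Function.Surjective π) (hD : LinearMap.ker π = D) {F : Type u} [AddCommGroup F]
    [Module R F] [Module.Projective R F] (l : F →ₗ[R] C)
    (hl : (LinearMap.ker l).ExtendsTo e) :
    ∃ g : (LinearMap.range l).comap π →ₗ[R] e,
      ∀ x (hx : x ∈ D) (hx' : x ∈ (LinearMap.range l).comap π), g ⟨x, hx'⟩ = f ⟨x, hx⟩ := by
  subst hD
  obtain ⟨a, ha⟩ := exists_lift_of_projective π hπ l
  obtain ⟨h, hh⟩ := hl (f ∘ₗ (a ∘ₗ Submodule.subtype _).codRestrict _ fun x => by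
    simp [ha])
  let s : LinearMap.ker π × F →ₗ[R] (LinearMap.range l).comap π :=
    (Submodule.subtype _ ∘ₗ LinearMap.fst R _ _ + a ∘ₗ LinearMap.snd R _ _).codRestrict _
      fun x => ⟨x.2, by simp [ha]⟩
  obtain ⟨g, hg⟩ := exists_factor_of_surjective s (by
    rintro ⟨x, φ, hφ⟩
    refine ⟨(⟨x - a φ, by simp [ha, hφ]⟩, φ), Subtype.ext ?_⟩
    exact sub_add_cancel x (a φ)) (f ∘ₗ LinearMap.fst R _ _ + h ∘ₗ LinearMap.snd R _ _) (by
    rintro ⟨⟨d, hd⟩, φ⟩ h0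
    have h1 : d + a φ = 0 := congrArg Subtype.val h0
    have h2 : l φ = 0 := by
      rw [← ha, eq_neg_of_add_eq_zero_right h1, map_neg, hd, neg_zero]
    have h3 := hh ⟨φ, h2⟩
    simp only [LinearMap.add_apply, LinearMap.comp_apply, LinearMap.fst_apply,
      LinearMap.snd_apply] at h3 ⊢
    rw [h3, ← map_add]
    refine (congrArg f (Subtype.ext ?_)).trans (map_zero f)
    exact h1)
  refine ⟨g, fun x hx hx' => ?_⟩
  have h4 := hg (⟨x, hx⟩, 0)
  simp only [LinearMap.add_apply, LinearMap.comp_apply, LinearMap.fst_apply,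
    LinearMap.snd_apply, map_zero, add_zero] at h4
  rw [← h4]
  congr 1
  refine Subtype.ext ?_
  change x = x + a 0
  rw [map_zero, add_zero]

end GIExtendable

section SmallExtension

variable {A B C M N V W e : Type u} [AddCommGroup A] [Module R A] [AddCommGroup B] [Module R B]
  [AddCommGroup C] [Module R C] [AddCommGroup M] [Module R M] [AddCommGroup N] [Module R N]
  [AddCommGroup V] [Module R V] [AddCommGroup W] [Module R W] [AddCommGroup e] [Module R e]

theorem GIExtendable.of_small [IsNoetherianRing R] (hVG : VirtuallyGorenstein R)
    (h : ∀ t : SmallSyzygy R, t.ker.ExtendsTo e) : GIExtendable R e := by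
  intro B _ _ A hBA f₀
  let p := A.mkQ
  have hpsurj : Function.Surjective p := A.mkQ_surjective
  let F₀ : B →ₗ.[R] e := ⟨A, f₀⟩
  obtain ⟨f, ⟨hf0, hfW⟩, hmax⟩ : ∃ m, Maximal
      (· ∈ {f : B →ₗ.[R] e | F₀ ≤ f ∧ GPTrivial R (f.domain.map p)}) m := by
    refine (zorn_le_nonempty₀ _ (fun c hcS hc f₁ hf₁ => ?_) F₀ (And.intro le_rfl ?_)).imp
      fun m hm => hm.2
    · have hdir := hc.directedOn
      refine ⟨LinearPMap.sSup c hdir, ⟨(hcS hf₁).1.trans (LinearPMap.le_sSup hdir hf₁), ?_⟩,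
        fun z hz => LinearPMap.le_sSup hdir hz⟩
      rw [LinearPMap.domain_sSup]
      have heq : Submodule.map p (sSup (LinearPMap.domain '' c)) =
          sSup ((fun f : B →ₗ.[R] e => f.domain.map p) '' c) := by
        simp only [sSup_image, Submodule.map_iSup]
      rw [heq]
      refine GPTrivial.sSup_of_isChain hVG ?_ ?_
      · rintro _ ⟨a, ha, rfl⟩ _ ⟨b, hb, rfl⟩ -
        exact (hc.total ha hb).imp (fun h => Submodule.map_mono h.1)
          fun h => Submodule.map_mono h.1
      · rintro _ ⟨a, ha, rfl⟩
        exact (hcS ha).2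
    · have : F₀.domain.map p = ⊥ := by
        change A.map A.mkQ = ⊥
        exact Submodule.mkQ_map_self A
      rw [this]
      exact GPTrivial.of_subsingleton
  have hA : A ≤ f.domain := hf0.1
  have htop : f.domain = ⊤ := by
    by_contra hne
    obtain ⟨x, hx⟩ : ∃ x, x ∉ f.domain := by
      by_contra! hall
      exact hne (eq_top_iff.2 fun x _ => hall x)
    let L := f.domain.map p
    let π : B →ₗ[R] (B ⧸ A) ⧸ L := L.mkQ ∘ₗ p
    have hπ : Function.Surjective π := L.mkQ_surjective.comp hpsurj
    have hker : LinearMap.ker π = f.domain := by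
      rw [LinearMap.ker_comp, Submodule.ker_mkQ, Submodule.comap_map_eq, Submodule.ker_mkQ,
        sup_eq_left]
      exact hA
    have hCW : GPTrivial R ((B ⧸ A) ⧸ L) := hBA.quotient L hfW
    obtain ⟨ev, hxe, heW⟩ := hCW.exists_small_submodule hVG (π x)
    let l := Finsupp.linearCombination R ev
    obtain ⟨g, hg⟩ := exists_extend_step f.toFun π hπ hker l
      (h ⟨LinearMap.ker l, heW.of_equiv l.quotKerEquivRange⟩)
    have hle : f.domain ≤ (LinearMap.range l).comap π := by
      intro y hy
      have : π y = 0 := by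
        rw [← LinearMap.mem_ker, hker]
        exact hy
      rw [Submodule.mem_comap, this]
      exact zero_mem _
    have hfg : f ≤ ⟨(LinearMap.range l).comap π, g⟩ := by
      refine ⟨hle, ?_⟩
      rintro ⟨y, hy⟩ ⟨z, hz⟩ hyz
      obtain rfl : y = z := hyz
      exact (hg y hy hz).symm
    have hW : GPTrivial R (Submodule.map p ((LinearMap.range l).comap π)) := by
      have heq : Submodule.map p ((LinearMap.range l).comap π) =
          (LinearMap.range l).comap L.mkQ := by
        rw [Submodule.comap_comp, Submodule.map_comap_eq_of_surjective hpsurj]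
      rw [heq]
      have hLle : L ≤ (LinearMap.range l).comap L.mkQ := by
        intro y hy
        have : L.mkQ y = 0 := (Submodule.Quotient.mk_eq_zero L).2 hy
        rw [Submodule.mem_comap, this]
        exact zero_mem _
      refine GPTrivial.extension hVG hfW heW (Submodule.inclusion hLle)
        (L.mkQ.restrict (p := (LinearMap.range l).comap L.mkQ) fun y hy => hy)
        (Submodule.inclusion_injective _) ?_ ?_
      · rintro ⟨y, hy⟩
        obtain ⟨z, rfl⟩ := L.mkQ_surjective y
        exact ⟨⟨z, hy⟩, rfl⟩
      · rintro ⟨y, hy⟩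
        refine (Subtype.ext_iff.trans (Submodule.Quotient.mk_eq_zero L)).trans ?_
        constructor
        · intro hyL
          exact ⟨⟨y, hyL⟩, rfl⟩
        · rintro ⟨z, hz⟩
          have : z.1 = y := congrArg Subtype.val hz
          exact this ▸ z.2
    exact hx ((hmax ⟨hf0.trans hfg, hW⟩ hfg).1 hxe)
  obtain ⟨D, f⟩ := f
  change D = ⊤ at htop
  subst htop
  refine ⟨f ∘ₗ LinearMap.id.codRestrict ⊤ fun _ => trivial, fun x => ?_⟩
  exact (hf0.2 (x := x) (y := ⟨x, trivial⟩) rfl).symm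

end SmallExtension

section Factorization

variable {A B M N V W e : Type u} [AddCommGroup A] [Module R A] [AddCommGroup B] [Module R B]
  [AddCommGroup M] [Module R M] [AddCommGroup N] [Module R N]
  [AddCommGroup V] [Module R V] [AddCommGroup W] [Module R W] [AddCommGroup e] [Module R e]

theorem GIExtendable.liftsAgainst {K : Submodule R A} [Module.Projective R A]
    (hK : GPTrivial R (A ⧸ K)) (p : V →ₗ[R] W) (hp : Function.Surjective p)
    (hk : GIExtendable R (LinearMap.ker p)) : LiftsAgainst K.subtype p := by
  intro f g hfg
  obtain ⟨h, hh⟩ := exists_lift_of_projective p hp g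
  obtain ⟨k, hk⟩ := hk A K hK ((f - h ∘ₗ K.subtype).codRestrict _ fun x => by
    have := LinearMap.congr_fun hfg x
    simp only [LinearMap.comp_apply, Submodule.subtype_apply] at this
    simp [hh, this])
  refine ⟨h + Submodule.subtype _ ∘ₗ k, LinearMap.ext fun x => ?_, LinearMap.ext fun x => ?_⟩
  · have h1 : (k x : V) = f x - h x := congrArg Subtype.val (hk x)
    simp [h1]
  · simp [hh, LinearMap.mem_ker.1 (k x).2]

/-- The monomorphisms against which the epimorphisms with extendable kernel are
characterised. -/
noncomputable def smallSyzygyMap (t : SmallSyzygy R) : t.ker →ₗ[R] (SmallTree R →₀ R) × R :=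
  t.ker.subtype.prod 0

theorem smallSyzygyMap_injective (t : SmallSyzygy R) : Function.Injective (smallSyzygyMap t) := by
  intro x y hxy
  exact Subtype.ext (congrArg Prod.fst hxy)

theorem forall_liftsAgainst_smallSyzygyMap_iff [IsNoetherianRing R]
    (hVG : VirtuallyGorenstein R) (p : V →ₗ[R] W) :
    (∀ t : SmallSyzygy R, LiftsAgainst (A := t.ker) (B := (SmallTree R →₀ R) × R) (smallSyzygyMap t) p) ↔
      Function.Surjective p ∧ GIExtendable R (LinearMap.ker p) := by
  constructor
  · intro h
    have h' : ∀ t : SmallSyzygy R, _ := fun t => (liftsAgainst_prod_zero_iff _ _).1 (h t)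
    refine ⟨(h' ⟨⊤, GPTrivial.of_subsingleton⟩).2, GIExtendable.of_small hVG fun t f => ?_⟩
    obtain ⟨k, hk1, hk2⟩ := (h' t).1 (Submodule.subtype _ ∘ₗ f) 0 (by
      ext x
      simp)
    refine ⟨k.codRestrict _ fun x => LinearMap.congr_fun hk2 x, fun x => Subtype.ext ?_⟩
    exact LinearMap.congr_fun hk1 x
  · rintro ⟨h1, h2⟩ t
    exact (liftsAgainst_prod_zero_iff _ _).2 ⟨h2.liftsAgainst t.2 p h1, h1⟩

/-- Factorizations with respect to the cotorsion pair generated by the trivial modules. -/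
theorem exists_gi_factorization [IsNoetherianRing R] (hVG : VirtuallyGorenstein R)
    (f : M →ₗ[R] N) :
    ∃ (Z : Type u) (_ : AddCommGroup Z) (_ : Module R Z) (a : M →ₗ[R] Z) (p : Z →ₗ[R] N),
      p ∘ₗ a = f ∧ Function.Surjective p ∧ GIExtendable R (LinearMap.ker p) ∧
      ∀ (V W : Type u) [AddCommGroup V] [Module R V] [AddCommGroup W] [Module R W]
        (q : V →ₗ[R] W), Function.Surjective q → GIExtendable R (LinearMap.ker q) →
        LiftsAgainst a q := by
  obtain ⟨Z, _, _, a, p, hpa, hp, ha⟩ := exists_factorization_liftsAgainst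
    (fun t : SmallSyzygy R => t.ker) (fun _ => (SmallTree R →₀ R) × R) smallSyzygyMap
    smallSyzygyMap_injective f
  obtain ⟨h1, h2⟩ := (forall_liftsAgainst_smallSyzygyMap_iff hVG p).1 hp
  exact ⟨Z, _, _, a, p, hpa, h1, h2, fun V W _ _ _ _ q hq hk =>
    ha V W q ((forall_liftsAgainst_smallSyzygyMap_iff hVG q).2 ⟨hq, hk⟩)⟩

end Factorization

section GIExtendable

variable {A B C I K M N e : Type u} [AddCommGroup A] [Module R A] [AddCommGroup B] [Module R B]
  [AddCommGroup C] [Module R C] [AddCommGroup I] [Module R I] [AddCommGroup K] [Module R K]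
  [AddCommGroup M] [Module R M] [AddCommGroup N] [Module R N] [AddCommGroup e] [Module R e]

theorem GIExtendable.of_retract (hM : GIExtendable R M) (i : e →ₗ[R] M) (r : M →ₗ[R] e)
    (h : ∀ x, r (i x) = x) : GIExtendable R e := by
  intro B _ _ A hA f
  obtain ⟨g, hg⟩ := hM B A hA (i ∘ₗ f)
  exact ⟨r ∘ₗ g, fun x => by simp [hg, h]⟩

theorem GIExtendable.of_equiv (hM : GIExtendable R M) (i : e ≃ₗ[R] M) : GIExtendable R e :=
  hM.of_retract i.toLinearMap i.symm.toLinearMap (by simp)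

theorem IsSGI.giExtendable (hVG : VirtuallyGorenstein R) {d : I →ₗ[R] I} (hd : IsSGI d) :
    GIExtendable R (LinearMap.ker d) := by
  intro B _ _ A hA f
  have := hd.inj
  obtain ⟨τ, hτ⟩ := exists_extend_of_injective A.subtype Subtype.val_injective
    (Submodule.subtype _ ∘ₗ f)
  have hτ' : ∀ x : A, τ x = f x := hτ
  obtain ⟨v, hv⟩ := exists_factor_of_surjective A.mkQ A.mkQ_surjective (toKer d hd.exact ∘ₗ τ)
    (fun b hb => by
      have hb' : b ∈ A := (Submodule.Quotient.mk_eq_zero A).1 hb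
      apply Subtype.ext
      simp [hτ' ⟨b, hb'⟩])
  obtain ⟨w, hw⟩ := (hVG _).1 hA I d hd v
  refine ⟨(τ - w ∘ₗ A.mkQ).codRestrict _ fun b => ?_, fun x => Subtype.ext ?_⟩
  · have h1 := congrArg Subtype.val (hv b)
    have h2 := hw (A.mkQ b)
    simp only [LinearMap.comp_apply, coe_toKer] at h1
    rw [h1] at h2
    rw [LinearMap.mem_ker, LinearMap.sub_apply, map_sub, LinearMap.comp_apply, h2, sub_self]
  · have h1 : A.mkQ x = 0 := (Submodule.Quotient.mk_eq_zero A).2 x.2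
    change τ x - w (A.mkQ x) = f x
    rw [h1, map_zero, sub_zero, hτ']

theorem GIExtendable.of_projective
    (h : ∀ (F : Type u) [AddCommGroup F] [Module R F] [Module.Projective R F]
      (K : Submodule R F), GPTrivial R (F ⧸ K) → K.ExtendsTo e) : GIExtendable R e := by
  intro B _ _ A hA f
  let l := Finsupp.linearCombination R (id : (B ⧸ A) → (B ⧸ A))
  have hl : Function.Surjective l := linearCombination_id_surjective _
  obtain ⟨g, hg⟩ := exists_extend_step f A.mkQ A.mkQ_surjective A.ker_mkQ l
    (h _ _ (hA.of_equiv (l.quotKerEquivOfSurjective hl)))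
  exact ⟨g ∘ₗ LinearMap.id.codRestrict _ fun x => hl _, fun x => hg x x.2 _⟩

theorem GIExtendable.exists_lift (he : GIExtendable R e) (hK : GPTrivial R K) (i : e →ₗ[R] I)
    (p : I →ₗ[R] C) (hi : Function.Injective i) (hp : Function.Surjective p)
    (h : Function.Exact i p) (f : K →ₗ[R] C) : ∃ g : K →ₗ[R] I, ∀ x, p (g x) = f x := by
  let Z : Submodule R (I × K) :=
    LinearMap.ker (p ∘ₗ LinearMap.fst R I K - f ∘ₗ LinearMap.snd R I K)
  have hZ : ∀ z : I × K, z ∈ Z ↔ p z.1 = f z.2 := fun z => by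
    rw [LinearMap.mem_ker, LinearMap.sub_apply, sub_eq_zero]
    rfl
  let j : e →ₗ[R] Z := (LinearMap.inl R I K ∘ₗ i).codRestrict _ fun x => by
    rw [hZ]
    simp [h.apply_apply_eq_zero]
  let q : Z →ₗ[R] K := LinearMap.snd R I K ∘ₗ Z.subtype
  have hq : Function.Surjective q := fun x => by
    obtain ⟨y, hy⟩ := hp (f x)
    exact ⟨⟨(y, x), (hZ _).2 hy⟩, rfl⟩
  have hjq : Function.Exact j q := by
    rintro ⟨⟨y, x⟩, hz⟩
    constructor
    · intro hx
      obtain rfl : x = 0 := hx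
      obtain ⟨w, rfl⟩ := (h y).1 (((hZ _).1 hz).trans (map_zero f))
      exact ⟨w, rfl⟩
    · rintro ⟨w, hw⟩
      exact (congrArg (fun z : Z => z.1.2) hw).symm
  obtain ⟨r, hr⟩ := he.exists_extend hK j q
    (fun x y hxy => hi (congrArg (fun z : Z => z.1.1) hxy)) hq hjq LinearMap.id
  obtain ⟨g, hg⟩ := exists_factor_of_surjective q hq
    (LinearMap.fst R I K ∘ₗ Z.subtype - i ∘ₗ r) (fun z hz => by
      obtain ⟨w, rfl⟩ := (hjq z).1 hz
      have h1 : (LinearMap.fst R I K ∘ₗ Z.subtype) (j w) = i w := rfl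
      rw [LinearMap.sub_apply, h1, LinearMap.comp_apply, hr, LinearMap.id_apply, sub_self])
  refine ⟨g, fun x => ?_⟩
  obtain ⟨z, rfl⟩ := hq x
  rw [hg, LinearMap.sub_apply, map_sub, LinearMap.comp_apply i, h.apply_apply_eq_zero, sub_zero]
  exact (hZ _).1 z.2

theorem GIExtendable.cokernel [Module.Injective R I] (he : GIExtendable R e) (i : e →ₗ[R] I)
    (p : I →ₗ[R] C) (hi : Function.Injective i) (hp : Function.Surjective p)
    (h : Function.Exact i p) : GIExtendable R C := by
  refine GIExtendable.of_projective fun F _ _ _ K hK f => ?_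
  have hKW : GPTrivial R K := GPTrivial.of_projective.kernel hK K.subtype K.mkQ
    Subtype.val_injective K.mkQ_surjective (LinearMap.exact_subtype_mkQ K)
  obtain ⟨g, hg⟩ := he.exists_lift hKW i p hi hp h f
  obtain ⟨k, hk⟩ := exists_extend_of_injective K.subtype Subtype.val_injective g
  refine ⟨p ∘ₗ k, fun x => ?_⟩
  rw [LinearMap.comp_apply, ← hg x, ← hk x, Submodule.subtype_apply]

theorem GIExtendable.extension (hC : GIExtendable R C) (p : B →ₗ[R] C)
    (hp : Function.Surjective p) (hk : GIExtendable R (LinearMap.ker p)) :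
    GIExtendable R B := by
  refine GIExtendable.of_projective fun F _ _ _ K hK f => ?_
  obtain ⟨g, hg⟩ := hC F K hK (p ∘ₗ f)
  obtain ⟨h, h1, -⟩ := hk.liftsAgainst hK p hp f g (LinearMap.ext fun x => (hg x).symm)
  exact ⟨h, LinearMap.congr_fun h1⟩

theorem GIExtendable.injective_of_gpTrivial (he : GIExtendable R e) (hW : GPTrivial R e) :
    Module.Injective R e := by
  obtain ⟨I, _, _, i, hI, hi⟩ := exists_injective_embedding (R := R) e
  obtain ⟨r, hr⟩ := he.exists_extend (hW.cokernel GPTrivial.of_injective i (Submodule.mkQ _) hi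
    (Submodule.mkQ_surjective _) (LinearMap.exact_map_mkQ_range i)) i (Submodule.mkQ _) hi
    (Submodule.mkQ_surjective _) (LinearMap.exact_map_mkQ_range i) LinearMap.id
  refine ⟨fun X Y _ _ _ _ f hf g => ?_⟩
  obtain ⟨k, hk⟩ := exists_extend_of_injective f hf (i ∘ₗ g)
  exact ⟨r ∘ₗ k, fun x => by simp [hk, hr]⟩

theorem gpTrivial_of_liftsAgainst (hVG : VirtuallyGorenstein R) (a : A →ₗ[R] B)
    (ha : ∀ (V W : Type u) [AddCommGroup V] [Module R V] [AddCommGroup W] [Module R W]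
      (q : V →ₗ[R] W), Function.Surjective q → GIExtendable R (LinearMap.ker q) →
        LiftsAgainst a q) : GPTrivial R (B ⧸ LinearMap.range a) := by
  rw [hVG]
  intro I _ _ d hd φ
  have h2 : LinearMap.ker (toKer d hd.exact) = LinearMap.ker d := by
    ext x
    simp [Subtype.ext_iff]
  obtain ⟨h, h1, h2⟩ := ha I _ (toKer d hd.exact) (toKer_surjective d hd.exact)
    ((hd.giExtendable hVG).of_equiv (LinearEquiv.ofEq _ _ h2)) 0 (φ ∘ₗ Submodule.mkQ _)
    (LinearMap.ext fun x => by
      have h0 : Submodule.mkQ (LinearMap.range a) (a x) = 0 :=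
        (Submodule.Quotient.mk_eq_zero _).2 ⟨x, rfl⟩
      rw [LinearMap.comp_apply, LinearMap.comp_apply, LinearMap.comp_apply, h0]
      simp)
  refine ⟨Submodule.liftQ _ h ?_, fun x => ?_⟩
  · rintro _ ⟨x, rfl⟩
    exact LinearMap.congr_fun h1 x
  · obtain ⟨y, rfl⟩ := Submodule.mkQ_surjective _ x
    exact congrArg Subtype.val (LinearMap.congr_fun h2 y)

theorem exists_giExtendable_embedding [IsNoetherianRing R] (hVG : VirtuallyGorenstein R)
    (M : Type u) [AddCommGroup M] [Module R M] :
    ∃ (e : Type u) (_ : AddCommGroup e) (_ : Module R e) (a : M →ₗ[R] e),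
      GIExtendable R e ∧ Function.Injective a ∧ GPTrivial R (e ⧸ LinearMap.range a) := by
  obtain ⟨e, _, _, a, p, -, hp, hk, ha⟩ :=
    exists_gi_factorization hVG (0 : M →ₗ[R] (PUnit.{u + 1} : Type u))
  refine ⟨e, _, _, a, hk.of_equiv (LinearEquiv.ofTop (LinearMap.ker p)
    (eq_top_iff.2 fun x _ => Subsingleton.elim _ _)).symm, ?_, gpTrivial_of_liftsAgainst hVG a ha⟩
  obtain ⟨I, _, _, ι, hI, hι⟩ := exists_injective_embedding (R := R) M
  obtain ⟨h, hh, -⟩ := ha I (PUnit.{u + 1} : Type u) 0 (fun x => ⟨0, Subsingleton.elim _ _⟩)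
    (GIExtendable.of_injective.of_equiv (LinearEquiv.ofTop _ LinearMap.ker_zero)) ι 0 (by
      ext)
  refine Function.Injective.of_comp (f := h) ?_
  rw [← LinearMap.coe_comp, hh]
  exact hι

theorem GIExtendable.exists_cover [IsNoetherianRing R] (hVG : VirtuallyGorenstein R)
    (he : GIExtendable R e) :
    ∃ (I : Type u) (_ : AddCommGroup I) (_ : Module R I) (p : I →ₗ[R] e),
      Module.Injective R I ∧ Function.Surjective p ∧ GIExtendable R (LinearMap.ker p) := by
  obtain ⟨I, _, _, a, p, -, hp, hk, ha⟩ :=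
    exists_gi_factorization hVG (0 : (PUnit.{u + 1} : Type u) →ₗ[R] e)
  have ha0 : LinearMap.range a = ⊥ := by
    rw [LinearMap.range_eq_bot]
    exact LinearMap.ext fun x => by rw [Subsingleton.elim x 0, map_zero, map_zero]
  have hI : GPTrivial R I := (gpTrivial_of_liftsAgainst hVG a ha).of_equiv
    (Submodule.quotEquivOfEqBot _ ha0).symm
  exact ⟨I, _, _, p, (he.extension p hp hk).injective_of_gpTrivial hI, hp, hk⟩

/-- The cycles of totally acyclic complexes of injectives contain all `e` such that every map
to `e` extends along monomorphisms with trivial cokernel. -/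
theorem GIExtendable.exists_retract [IsNoetherianRing R] (hVG : VirtuallyGorenstein R)
    (he : GIExtendable R e) :
    ∃ (I : Type u) (_ : AddCommGroup I) (_ : Module R I) (d : I →ₗ[R] I), IsSGI d ∧
      ∃ (i : e →ₗ[R] LinearMap.ker d) (r : LinearMap.ker d →ₗ[R] e), ∀ x, r (i x) = x := by
  obtain ⟨s, X, i, p, hs, hQ, hX, hi, hp, hip⟩ := exists_int_complex
    (fun M : ModuleCat.{u} R => GIExtendable R M) (fun M => Module.Injective R M)
    (fun B hB => by
      obtain ⟨I, _, _, p, hI, hp, hk⟩ := hB.exists_cover hVG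
      exact ⟨ModuleCat.of R (LinearMap.ker p), hk, ModuleCat.of R I, hI, Submodule.subtype _, p,
        Subtype.val_injective, hp, LinearMap.exact_subtype_ker_map _⟩)
    (fun A hA => by
      obtain ⟨I, _, _, ι, hI, hι⟩ := exists_injective_embedding (R := R) A
      exact ⟨ModuleCat.of R (I ⧸ LinearMap.range ι), hA.cokernel ι (Submodule.mkQ _) hι
        (Submodule.mkQ_surjective _) (LinearMap.exact_map_mkQ_range ι), ModuleCat.of R I, hI, ι,
        Submodule.mkQ _, hι, Submodule.mkQ_surjective _, LinearMap.exact_map_mkQ_range ι⟩)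
    (ModuleCat.of R e) he
  let D : ∀ j, X (j + 1) →ₗ[R] X j := fun j => i j ∘ₗ p (j + 1)
  have hD : ∀ j x, D j x = 0 ↔ p (j + 1) x = 0 := fun j x =>
    (map_eq_zero_iff (i j) (hi j))
  have hSGI : IsSGI (prodDiff (X := fun j => X j) D) := by
    refine isSGI_prodDiff (X := fun j => X j) D (fun j x => ?_) (fun j x hx => ?_)
      fun J _ _ _ j f hf => ?_
    · exact (hD _ _).2 ((hip (j + 1)).apply_apply_eq_zero _)
    · obtain ⟨y, rfl⟩ := (hip (j + 1) x).1 ((hD _ _).1 hx)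
      obtain ⟨z, rfl⟩ := hp _ y
      exact ⟨z, rfl⟩
    · obtain ⟨f', hf'⟩ := exists_factor_of_injective (i (j + 1)) (hi _) f fun a =>
        (hip (j + 1) _).1 ((hD _ _).1 (hf a))
      obtain ⟨g, hg⟩ := (hQ _).exists_lift GPTrivial.of_injective (i (j + 1 + 1))
        (p (j + 1 + 1)) (hi _) (hp _) (hip _) f'
      exact ⟨g, fun x => (congrArg (i (j + 1)) (hg x)).trans (hf' x)⟩
  have key : ∀ n, ∃ (a : s n →ₗ[R] LinearMap.ker (prodDiff (X := fun j => X j) D))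
      (r : LinearMap.ker (prodDiff (X := fun j => X j) D) →ₗ[R] s n), ∀ x, r (a x) = x := by
    intro n
    obtain ⟨j, rfl⟩ : ∃ j, n = j + 1 + 1 := ⟨n - 2, by omega⟩
    obtain ⟨a, r, hr⟩ := exists_retract_ker_prodDiff (X := fun j => X j) D j
    let e : s (j + 1 + 1) →ₗ[R] LinearMap.ker (D j) := (i (j + 1)).codRestrict _ fun x =>
      (hD _ _).2 ((hip (j + 1)).apply_apply_eq_zero _)
    have he : Function.Bijective e := by
      refine ⟨fun x y hxy => hi _ (congrArg Subtype.val hxy), fun ⟨x, hx⟩ => ?_⟩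
      obtain ⟨y, rfl⟩ := (hip (j + 1) x).1 ((hD _ _).1 hx)
      exact ⟨y, rfl⟩
    let e' := LinearEquiv.ofBijective e he
    exact ⟨a ∘ₗ e'.toLinearMap, e'.symm.toLinearMap ∘ₗ r, fun x => by simp [hr]⟩
  obtain ⟨a, r, hr⟩ := hs ▸ key 0
  exact ⟨_, _, _, _, hSGI, a, r, hr⟩

end GIExtendable

section Purity

variable {X₁ X₂ X₃ : Type u} [AddCommGroup X₁] [Module R X₁] [AddCommGroup X₂] [Module R X₂]
  [AddCommGroup X₃] [Module R X₃]

theorem exists_extend_of_lifts [IsNoetherianRing R] (hVG : VirtuallyGorenstein R)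
    (i : X₁ →ₗ[R] X₂) (q : X₂ →ₗ[R] X₃) (hi : Function.Injective i) (hiq : Function.Exact i q)
    (h : ∀ (P : Type u) [AddCommGroup P] [Module R P] (d : P →ₗ[R] P), IsSGP d →
      ∀ f : LinearMap.ker d →ₗ[R] X₃, ∃ g : LinearMap.ker d →ₗ[R] X₂, ∀ x, q (g x) = f x)
    {I : Type u} [AddCommGroup I] [Module R I] {d : I →ₗ[R] I} (hd : IsSGI d)
    (φ : X₁ →ₗ[R] LinearMap.ker d) : ∃ ψ : X₂ →ₗ[R] LinearMap.ker d, ∀ x, ψ (i x) = φ x := by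
  have := hd.inj
  obtain ⟨G, _, _, p, hG, hp, hk⟩ := exists_gpLiftable_cover hVG X₃
  obtain ⟨P, _, _, δ, hδ, j, r, hr⟩ := hG.exists_retract hVG
  obtain ⟨l, hl⟩ := h P δ hδ (p ∘ₗ r)
  have hlj : ∀ x, q (l (j x)) = p x := fun x => by rw [hl, LinearMap.comp_apply, hr]
  obtain ⟨μ, hμ⟩ := exists_factor_of_injective i hi (l ∘ₗ j ∘ₗ (LinearMap.ker p).subtype)
    fun x => (hiq _).1 ((hlj x).trans x.2)
  obtain ⟨ν, hν⟩ := (hVG _).1 hk I d hd (φ ∘ₗ μ)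
  obtain ⟨ν', hν'⟩ := exists_extend_of_injective (LinearMap.ker p).subtype Subtype.val_injective ν
  obtain ⟨ψ, hψ⟩ := exists_factor_of_surjective (i.coprod (l ∘ₗ j)) (fun x => by
    obtain ⟨g, hg⟩ := hp (q x)
    obtain ⟨z, hz⟩ := (hiq (x - l (j g))).1 (by rw [map_sub, hlj, hg, sub_self])
    exact ⟨(z, g), by simp [hz]⟩) (φ.coprod (toKer d hd.exact ∘ₗ ν')) (by
    rintro ⟨x, g⟩ hxg
    have h1 : i x + l (j g) = 0 := by simpa using hxg
    have hg : p g = 0 := by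
      rw [← hlj, eq_neg_of_add_eq_zero_right h1, map_neg, hiq.apply_apply_eq_zero, neg_zero]
    have h2 : x + μ ⟨g, hg⟩ = 0 := hi (by
      rw [map_add, hμ, map_zero]
      exact h1)
    have h3 : toKer d hd.exact (ν' g) = φ (μ ⟨g, hg⟩) := Subtype.ext (by
      rw [coe_toKer]
      exact (congrArg d (hν' ⟨g, hg⟩)).trans (hν ⟨g, hg⟩))
    rw [LinearMap.coprod_apply, LinearMap.comp_apply, h3, ← map_add, h2, map_zero])
  refine ⟨ψ, fun x => ?_⟩
  have := hψ (x, 0)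
  simpa using this

theorem exists_lift_of_extends [IsNoetherianRing R] (hVG : VirtuallyGorenstein R)
    (i : X₁ →ₗ[R] X₂) (q : X₂ →ₗ[R] X₃) (hq : Function.Surjective q) (hiq : Function.Exact i q)
    (h : ∀ (I : Type u) [AddCommGroup I] [Module R I] (d : I →ₗ[R] I), IsSGI d →
      ∀ f : X₁ →ₗ[R] LinearMap.ker d, ∃ g : X₂ →ₗ[R] LinearMap.ker d, ∀ x, g (i x) = f x)
    {P : Type u} [AddCommGroup P] [Module R P] {d : P →ₗ[R] P} (hd : IsSGP d)
    (φ : LinearMap.ker d →ₗ[R] X₃) : ∃ ψ : LinearMap.ker d →ₗ[R] X₂, ∀ x, q (ψ x) = φ x := by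
  have := hd.proj
  obtain ⟨e, _, _, a, he, ha, hL⟩ := exists_giExtendable_embedding hVG X₁
  obtain ⟨I, _, _, δ, hδ, j, r, hr⟩ := he.exists_retract hVG
  obtain ⟨α, hα⟩ := h I δ hδ (j ∘ₗ a)
  have hrα : ∀ x, r (α (i x)) = a x := fun x => by rw [hα, LinearMap.comp_apply, hr]
  let L := LinearMap.range a
  obtain ⟨β, hβ⟩ := exists_factor_of_surjective q hq (L.mkQ ∘ₗ r ∘ₗ α) (fun x hx => by
    obtain ⟨z, rfl⟩ := (hiq x).1 hx
    rw [LinearMap.comp_apply, LinearMap.comp_apply, hrα]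
    exact (Submodule.Quotient.mk_eq_zero L).2 ⟨z, rfl⟩)
  obtain ⟨γ, hγ⟩ := hL P d hd (β ∘ₗ φ)
  obtain ⟨η, hη⟩ := exists_lift_of_projective L.mkQ L.mkQ_surjective γ
  obtain ⟨ψ, hψ⟩ := exists_factor_of_injective (q.prod (r ∘ₗ α)) (by
    rw [← LinearMap.ker_eq_bot, LinearMap.ker_eq_bot']
    intro x hx
    obtain ⟨z, rfl⟩ := (hiq x).1 (congrArg Prod.fst hx)
    have h1 : r (α (i z)) = 0 := congrArg Prod.snd hx
    rw [hrα] at h1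
    rw [ha (h1.trans (map_zero a).symm), map_zero])
    (φ.prod (η ∘ₗ (LinearMap.ker d).subtype)) (fun y => by
    obtain ⟨x, hx⟩ := hq (φ y)
    have h1 : L.mkQ (η y - r (α x)) = 0 := by
      rw [map_sub, hη, hγ, LinearMap.comp_apply, ← hx, hβ]
      exact sub_self _
    obtain ⟨z, hz⟩ := (Submodule.Quotient.mk_eq_zero L).1 h1
    exact ⟨x + i z, by simp [hx, hrα, hz, hiq.apply_apply_eq_zero]⟩)
  exact ⟨ψ, fun x => congrArg Prod.fst (hψ x)⟩

theorem gpPureExact_iff_isSGP (S : ShortComplex (ModuleCat.{u} R)) : GPPureExact S ↔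
    ∀ (P : Type u) [AddCommGroup P] [Module R P] (d : P →ₗ[R] P), IsSGP d →
      ∀ f : LinearMap.ker d →ₗ[R] S.X₃, ∃ g : LinearMap.ker d →ₗ[R] S.X₂,
        ∀ x, S.g.hom (g x) = f x := by
  constructor
  · intro h P _ _ d hd f
    obtain ⟨g, hg⟩ := h _ hd.isGorensteinProjective (ModuleCat.ofHom f)
    exact ⟨g.hom, LinearMap.congr_fun (congrArg ModuleCat.Hom.hom hg)⟩
  · intro h U hU φ
    obtain ⟨P, _, _, d, hd, i, r, hr⟩ := hU.exists_retract
    obtain ⟨g, hg⟩ := h P d hd (φ.hom ∘ₗ r)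
    refine ⟨ModuleCat.ofHom (g ∘ₗ i), ModuleCat.hom_ext (LinearMap.ext fun x => ?_)⟩
    exact (hg (i x)).trans (congrArg φ.hom (hr x))

theorem giCopureExact_iff_isSGI (S : ShortComplex (ModuleCat.{u} R)) : GICopureExact S ↔
    ∀ (I : Type u) [AddCommGroup I] [Module R I] (d : I →ₗ[R] I), IsSGI d →
      ∀ f : S.X₁ →ₗ[R] LinearMap.ker d, ∃ g : S.X₂ →ₗ[R] LinearMap.ker d,
        ∀ x, g (S.f.hom x) = f x := by
  constructor
  · intro h I _ _ d hd f
    obtain ⟨g, hg⟩ := h _ hd.isGorensteinInjective (ModuleCat.ofHom f)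
    exact ⟨g.hom, LinearMap.congr_fun (congrArg ModuleCat.Hom.hom hg)⟩
  · intro h V hV φ
    obtain ⟨I, _, _, d, hd, i, r, hr⟩ := hV.exists_retract
    obtain ⟨g, hg⟩ := h I d hd (i ∘ₗ φ.hom)
    refine ⟨ModuleCat.ofHom (r ∘ₗ g), ModuleCat.hom_ext (LinearMap.ext fun x => ?_)⟩
    exact (congrArg r (hg x)).trans (hr _)

end Purity

/-- Over a virtually Gorenstein Noetherian ring of finite Krull dimension,
a short exact sequence is `GP`-pure exact iff it is `GI`-copure exact. -/
theorem stmt16 {R : Type u} [CommRing R] (hNoeth : IsNoetherianRing R)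
    (hdim : ringKrullDim R < ⊤)
    (hVG : ∀ M : ModuleCat.{u} R, MemGPperp M ↔ MemPerpGI M) :
    ∀ S : ShortComplex (ModuleCat.{u} R), S.ShortExact →
      (GPPureExact S ↔ GICopureExact S) := by
  have hVG' : VirtuallyGorenstein R := fun M _ _ =>
    (memGPperp_iff (ModuleCat.of R M)).symm.trans
      ((hVG (ModuleCat.of R M)).trans (memPerpGI_iff (ModuleCat.of R M)))
  intro S hS
  have hi : Function.Injective S.f.hom := hS.moduleCat_injective_f
  have hq : Function.Surjective S.g.hom := hS.moduleCat_surjective_g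
  have hiq : Function.Exact S.f.hom S.g.hom :=
    (ShortComplex.ShortExact.moduleCat_exact_iff_function_exact S).1 hS.exact
  rw [gpPureExact_iff_isSGP, giCopureExact_iff_isSGI]
  exact ⟨fun h I _ _ d hd f => exists_extend_of_lifts hVG' S.f.hom S.g.hom hi hiq h hd f,
    fun h P _ _ d hd f => exists_lift_of_extends hVG' S.f.hom S.g.hom hq hiq h hd f⟩
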